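/- Let X ⊂ ℙ^{n+c} be a nondegenerate smooth complex projective quadratic variety of dimension n and codimension c which is not a complete intersection, with n = 2c−1 and c ≥ 3. Then for a general point x ∈ X, 2 dim L_x ≥ n − 1; in particular, L_x ⊂ ℙ^{n−1} is smooth, irreducible, and nondegenerate. -/

import Mathlib

/-!
Common framework for formalizing "Quadratic Varieties of Small Codimension"
(K. Watanabe), following Ionescu–Russo.

We model a projective variety as a subset of the complex projective space
`PS m := ℙ ℂ (Fin m → ℂ)` (which is `ℙ^{m-1}`, with `m` homogeneous coordinates).
-/

noncomputable section

open scoped BigOperators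

/-- Complex projective space `ℙ^{m-1}`, described by `m` homogeneous coordinates. -/
abbrev PS (m : ℕ) : Type := Projectivization ℂ (Fin m → ℂ)

namespace PaperQV

/-- A polynomial vanishes at a point of projective space, i.e. on the whole
corresponding line in affine space. -/
def PVanish {m : ℕ} (p : MvPolynomial (Fin m) ℂ) (x : PS m) : Prop :=
  ∀ v ∈ x.submodule, MvPolynomial.eval v p = 0

/-- The common zero locus, in projective space, of a set of polynomials. -/
def ZeroLocus {m : ℕ} (P : Set (MvPolynomial (Fin m) ℂ)) : Set (PS m) :=
  {x | ∀ p ∈ P, PVanish p x}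

/-- Zariski-closed subsets of projective space. -/
def ZClosed {m : ℕ} (S : Set (PS m)) : Prop :=
  ∃ P : Set (MvPolynomial (Fin m) ℂ), S = ZeroLocus P

/-- Zariski closure. -/
def ZClosure {m : ℕ} (S : Set (PS m)) : Set (PS m) :=
  ⋂₀ {C | ZClosed C ∧ S ⊆ C}

/-- Irreducibility with respect to the Zariski topology. -/
def ZIrreducible {m : ℕ} (S : Set (PS m)) : Prop :=
  S.Nonempty ∧ ∀ C₁ C₂ : Set (PS m), ZClosed C₁ → ZClosed C₂ → S ⊆ C₁ ∪ C₂ →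
    S ⊆ C₁ ∨ S ⊆ C₂

/-- `X` contains a strictly increasing chain of `n + 1` irreducible Zariski-closed
subsets, i.e. `dim X ≥ n`. -/
def DimGE {m : ℕ} (X : Set (PS m)) (n : ℕ) : Prop :=
  ∃ c : Fin (n + 1) → Set (PS m),
    StrictMono c ∧ ∀ i, ZClosed (c i) ∧ ZIrreducible (c i) ∧ c i ⊆ X

/-- `X` has dimension exactly `n`. -/
def HasDim {m : ℕ} (X : Set (PS m)) (n : ℕ) : Prop :=
  DimGE X n ∧ ¬ DimGE X (n + 1)

/-- The differential of a polynomial `p` at the vector `v`, as a linear functional. -/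
def polyDiff {m : ℕ} (p : MvPolynomial (Fin m) ℂ) (v : Fin m → ℂ) :
    (Fin m → ℂ) →ₗ[ℂ] ℂ :=
  ∑ j, MvPolynomial.eval v (MvPolynomial.pderiv j p) • LinearMap.proj j

/-- The Zariski tangent space at `x ∈ X` of the affine cone over `X`:
the intersection of the kernels of the differentials at `x.rep` of all
polynomials vanishing on `X`. -/
def tangentSubmodule {m : ℕ} (X : Set (PS m)) (x : PS m) :
    Submodule ℂ (Fin m → ℂ) :=
  ⨅ (p : MvPolynomial (Fin m) ℂ) (_ : ∀ y ∈ X, PVanish p y),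
    LinearMap.ker (polyDiff p x.rep)

/-- `X ⊆ ℙ^{m-1}` is a smooth projective variety of dimension `n`:
it is Zariski closed, irreducible, of dimension `n`, and at every point the
Zariski tangent space of its affine cone has dimension `n + 1`. -/
def SmoothVariety {m : ℕ} (X : Set (PS m)) (n : ℕ) : Prop :=
  ZClosed X ∧ ZIrreducible X ∧ HasDim X n ∧
    ∀ x ∈ X, Module.finrank ℂ (tangentSubmodule X x) = n + 1

/-- `X` is nondegenerate: it is contained in no hyperplane. -/
def Nondegenerate {m : ℕ} (X : Set (PS m)) : Prop :=
  ∀ φ : (Fin m → ℂ) →ₗ[ℂ] ℂ, (∀ x ∈ X, ∀ v ∈ x.submodule, φ v = 0) → φ = 0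

/-- The hypersurfaces `Q i = 0` cut out `X` scheme-theoretically: `X` is their
set-theoretic intersection, and at every point of `X` the `Q i` realize the full
Zariski tangent space (i.e. their differentials span the conormal space, so they
generate the ideal sheaf of the smooth variety `X`). -/
def SchemeCutOutBy {m k : ℕ} (X : Set (PS m)) (Q : Fin k → MvPolynomial (Fin m) ℂ) : Prop :=
  X = {x | ∀ i, PVanish (Q i) x} ∧
    ∀ x ∈ X, ∀ p : MvPolynomial (Fin m) ℂ, (∀ y ∈ X, PVanish p y) →
      (⨅ i, LinearMap.ker (polyDiff (Q i) x.rep)) ≤ LinearMap.ker (polyDiff p x.rep)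

/-- `X` is scheme-theoretically defined by `c` (linearly) independent quadratic equations. -/
def CutOutByQuadrics {m : ℕ} (X : Set (PS m)) (c : ℕ) : Prop :=
  ∃ Q : Fin c → MvPolynomial (Fin m) ℂ,
    (∀ i, (Q i).IsHomogeneous 2) ∧ LinearIndependent ℂ Q ∧ SchemeCutOutBy X Q

/-- A quadratic variety: scheme-theoretically an intersection of quadrics. -/
def IsQuadratic {m : ℕ} (X : Set (PS m)) : Prop :=
  ∃ c : ℕ, CutOutByQuadrics X c

/-- `X ⊆ ℙ^{m-1}` of dimension `n` is a complete intersection: it is cut out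
scheme-theoretically by exactly `codim X = (m - 1) - n` hypersurfaces. -/
def IsCompleteIntersection {m : ℕ} (X : Set (PS m)) (n : ℕ) : Prop :=
  ∃ F : Fin (m - 1 - n) → MvPolynomial (Fin m) ℂ, ∃ d : Fin (m - 1 - n) → ℕ,
    (∀ i, (F i).IsHomogeneous (d i)) ∧ (∀ i, 1 ≤ d i) ∧ SchemeCutOutBy X F

/-- Lines in projective space: projectivizations of 2-dimensional subspaces. -/
def IsLine {m : ℕ} (L : Set (PS m)) : Prop :=
  ∃ W : Submodule ℂ (Fin m → ℂ), Module.finrank ℂ W = 2 ∧ L = {x | x.submodule ≤ W}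

/-- `X` is covered by lines. -/
def CoveredByLines {m : ℕ} (X : Set (PS m)) : Prop :=
  ∀ x ∈ X, ∃ L : Set (PS m), IsLine L ∧ x ∈ L ∧ L ⊆ X

/-- `X` and `Y` are projectively equivalent (via a linear isomorphism of the
ambient homogeneous coordinate spaces). -/
def ProjEquiv {m₁ m₂ : ℕ} (X : Set (PS m₁)) (Y : Set (PS m₂)) : Prop :=
  ∃ (f : (Fin m₁ → ℂ) →ₗ[ℂ] (Fin m₂ → ℂ)) (hf : Function.Injective f),
    Function.Surjective f ∧ Projectivization.map f hf '' X = Y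

/-- `X ⊆ ℙ^{m₁-1}` is projectively equivalent to a hyperplane section of
`S ⊆ ℙ^{m₂-1}`: a linear embedding of the ambient space of `X` onto a hyperplane
carries `X` onto the corresponding hyperplane section of `S`. -/
def ProjEquivToHyperplaneSection {m₁ m₂ : ℕ} (X : Set (PS m₁)) (S : Set (PS m₂)) : Prop :=
  ∃ (f : (Fin m₁ → ℂ) →ₗ[ℂ] (Fin m₂ → ℂ)) (hf : Function.Injective f),
    Module.finrank ℂ (LinearMap.range f) + 1 = m₂ ∧
    Projectivization.map f hf '' X = S ∩ {y | y.submodule ≤ LinearMap.range f}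

/-! ### Explicit varieties: the Segre 3-fold, the Grassmannian `G(2,ℂ⁵)`,
the 10-dimensional spinor variety, cones, and Gushel–Mukai 6-folds. -/

/-- Index bookkeeping for the Segre embedding `ℙ¹ × ℙ² → ℙ⁵`. -/
def segreIdx : Fin 6 → Fin 2 × Fin 3 :=
  ![(0, 0), (0, 1), (0, 2), (1, 0), (1, 1), (1, 2)]

/-- The Segre coordinates of a pair of vectors. -/
def segreVec (a : Fin 2 → ℂ) (b : Fin 3 → ℂ) : Fin 6 → ℂ :=
  fun k => a (segreIdx k).1 * b (segreIdx k).2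

/-- The Segre 3-fold `ℙ¹ × ℙ² ⊆ ℙ⁵`. -/
def Segre12 : Set (PS 6) :=
  {x | ∃ (a : Fin 2 → ℂ) (b : Fin 3 → ℂ) (hv : segreVec a b ≠ 0),
    x = Projectivization.mk ℂ (segreVec a b) hv}

/-- The pairs `i < j` in `Fin 5`, indexing Plücker coordinates. -/
def pluckerPair : Fin 10 → Fin 5 × Fin 5 :=
  ![(0, 1), (0, 2), (0, 3), (0, 4), (1, 2), (1, 3), (1, 4), (2, 3), (2, 4), (3, 4)]

/-- The Plücker coordinates of the 2-plane spanned by `a`, `b` in `ℂ⁵`. -/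
def pluckerVec (a b : Fin 5 → ℂ) : Fin 10 → ℂ :=
  fun k => a (pluckerPair k).1 * b (pluckerPair k).2
    - a (pluckerPair k).2 * b (pluckerPair k).1

/-- The Grassmannian `G(2, ℂ⁵) ⊆ ℙ⁹` in its Plücker embedding. -/
def Grass25 : Set (PS 10) :=
  {x | ∃ (a b : Fin 5 → ℂ) (hv : pluckerVec a b ≠ 0),
    x = Projectivization.mk ℂ (pluckerVec a b) hv}

/-- `pfc i` lists the four elements of `Fin 5 \ {i}`, in increasing order. -/
def pfc : Fin 5 → Fin 4 → Fin 5 :=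
  ![![1, 2, 3, 4], ![0, 2, 3, 4], ![0, 1, 3, 4], ![0, 1, 2, 4], ![0, 1, 2, 3]]

/-- The sub-Pfaffian of a (skew-symmetric) `5 × 5` matrix obtained by deleting
the `i`-th row and column. -/
def subPfaffian (A : Fin 5 → Fin 5 → ℂ) (i : Fin 5) : ℂ :=
  A (pfc i 0) (pfc i 1) * A (pfc i 2) (pfc i 3)
    - A (pfc i 0) (pfc i 2) * A (pfc i 1) (pfc i 3)
    + A (pfc i 0) (pfc i 3) * A (pfc i 1) (pfc i 2)

/-- The spinor coordinates `(1, (a_{ij})_{i<j}, (Pf_i(A))_i)` of a skew-symmetric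
`5 × 5` matrix: the affine parametrization of the spinor embedding. -/
def spinorTail (A : Fin 5 → Fin 5 → ℂ) : Fin 15 → ℂ :=
  (Fin.append (fun t : Fin 10 => A (pluckerPair t).1 (pluckerPair t).2)
    (subPfaffian A) : Fin (10 + 5) → ℂ)

def spinorVec (A : Fin 5 → Fin 5 → ℂ) : Fin 16 → ℂ :=
  fun k =>
    (Fin.cons (1 : ℂ) (spinorTail A) : Fin (15 + 1) → ℂ)
      (Fin.cast (show (16 : ℕ) = 15 + 1 by norm_num) k)

/-- The 10-dimensional spinor variety `S^{10} ⊆ ℙ^{15}`: the Zariski closure of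
the image of the space of skew-symmetric `5 × 5` matrices under the
sub-Pfaffian (spinor) parametrization. -/
def Spinor10 : Set (PS 16) :=
  ZClosure {x | ∃ A : Fin 5 → Fin 5 → ℂ, (∀ i j, A j i = - A i j) ∧
    ∃ hv : spinorVec A ≠ 0, x = Projectivization.mk ℂ (spinorVec A) hv}

/-- The cone with vertex `o` over a subset `Y` of projective space. -/
def ConeOver {m : ℕ} (o : PS m) (Y : Set (PS m)) : Set (PS m) :=
  {z | z = o ∨ ∃ y ∈ Y, z.submodule ≤ o.submodule ⊔ y.submodule}

/-- Gushel–Mukai 6-folds `Σ^6_{10} ⊆ ℙ^{10}`: smooth 6-dimensional sections of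
the cone over the Plücker-embedded `G(2,ℂ⁵) ⊆ ℙ⁹ ⊆ ℙ^{10}` by a smooth quadric
hypersurface. -/
def IsGushelMukai6 (W : Set (PS 11)) : Prop :=
  ∃ (f : (Fin 10 → ℂ) →ₗ[ℂ] (Fin 11 → ℂ)) (hf : Function.Injective f)
    (o : PS 11) (q : MvPolynomial (Fin 11) ℂ),
    ¬ o.submodule ≤ LinearMap.range f ∧
    q.IsHomogeneous 2 ∧
    (∀ v : Fin 11 → ℂ, MvPolynomial.eval v q = 0 →
      (∀ j, MvPolynomial.eval v (MvPolynomial.pderiv j q) = 0) → v = 0) ∧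
    W = ConeOver o (Projectivization.map f hf '' Grass25) ∩ {x | PVanish q x} ∧
    SmoothVariety W 6

/-! ### Lines through a point, the Hilbert scheme of lines `L_x`, general points. -/

/-- The line through `x` with direction vector `v` (the projectivization of the
span of `x` and `v`). -/
def LineThrough {m : ℕ} (x : PS m) (v : Fin m → ℂ) : Set (PS m) :=
  {y | y.submodule ≤ x.submodule ⊔ Submodule.span ℂ {v}}

/-- `W ⊆ ℙ^{n-1} = ℙ(T_x X)` is a model, via the tangent map, of the Hilbert
scheme `L_x` of lines on `X` through `x`:  a linear identification `j` of `ℂⁿ`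
with a complement of the line `x̂` inside the (affine cone) tangent space of `X`
at `x` carries `W` onto the set of tangent directions of lines on `X` through `x`. -/
def IsVMRTModel {m n : ℕ} (X : Set (PS m)) (x : PS m) (W : Set (PS n)) : Prop :=
  ∃ j : (Fin n → ℂ) →ₗ[ℂ] (Fin m → ℂ), Function.Injective j ∧
    LinearMap.range j ⊓ x.submodule = ⊥ ∧
    LinearMap.range j ⊔ x.submodule = tangentSubmodule X x ∧
    W = {u : PS n | LineThrough x (j u.rep) ⊆ X}

/-- `P` holds at all points of `X` off some proper Zariski-closed subset,
i.e. at a general point of `X`. -/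
def GenericallyOn {m : ℕ} (X : Set (PS m)) (P : PS m → Prop) : Prop :=
  ∃ C : Set (PS m), ZClosed C ∧ ¬ X ⊆ C ∧ ∀ x ∈ X \ C, P x

/-- The locus swept out by the lines on `X` through `x`. -/
def LocusOfLines {m : ℕ} (X : Set (PS m)) (x : PS m) : Set (PS m) :=
  ⋃₀ {L | IsLine L ∧ x ∈ L ∧ L ⊆ X}

/-! ### Products, morphisms, double covers, conics. -/

/-- Zariski-closed subsets of a product of projective spaces (cut out by
multihomogeneous polynomials in the two groups of variables). -/
def ZClosedProd {m₁ m₂ : ℕ} (S : Set (PS m₁ × PS m₂)) : Prop :=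
  ∃ P : Set (MvPolynomial (Fin m₁ ⊕ Fin m₂) ℂ),
    S = {z | ∀ p ∈ P, ∀ v ∈ z.1.submodule, ∀ w ∈ z.2.submodule,
      MvPolynomial.eval (Sum.elim v w) p = 0}

/-- `f` restricts to a morphism of projective varieties `X → Y`
(its graph over `X` is Zariski closed). -/
def IsMorphismOn {m₁ m₂ : ℕ} (X : Set (PS m₁)) (Y : Set (PS m₂))
    (f : PS m₁ → PS m₂) : Prop :=
  Set.MapsTo f X Y ∧ ZClosedProd {z : PS m₁ × PS m₂ | z.1 ∈ X ∧ z.2 = f z.1}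

/-- A double cover `X → Y`: a finite surjective morphism of degree `2`. -/
def IsDoubleCover {m₁ m₂ : ℕ} (X : Set (PS m₁)) (Y : Set (PS m₂))
    (f : PS m₁ → PS m₂) : Prop :=
  IsMorphismOn X Y f ∧ Set.SurjOn f X Y ∧
    (∀ y ∈ Y, {x | x ∈ X ∧ f x = y}.Finite) ∧
    GenericallyOn Y (fun y => {x | x ∈ X ∧ f x = y}.ncard = 2)

/-- Irreducible conics: irreducible plane sections of quadrics that are neither
lines nor full planes. -/
def IsIrreducibleConic {m : ℕ} (C : Set (PS m)) : Prop :=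
  ∃ (W : Submodule ℂ (Fin m → ℂ)) (q : MvPolynomial (Fin m) ℂ),
    Module.finrank ℂ W = 3 ∧ q.IsHomogeneous 2 ∧
    C = {x | x.submodule ≤ W ∧ PVanish q x} ∧
    ZIrreducible C ∧ ¬ IsLine C ∧ C ≠ {x | x.submodule ≤ W}

/-- "P holds for two general points of X." -/
def GenericallyOnPairs {m : ℕ} (X : Set (PS m)) (P : PS m → PS m → Prop) : Prop :=
  ∃ B : Set (PS m × PS m), ZClosedProd B ∧ ¬ X ×ˢ X ⊆ B ∧
    ∀ x ∈ X, ∀ y ∈ X, (x, y) ∉ B → P x y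

/-- `X` is conic-connected: through two general points of `X` there passes an
irreducible conic contained in `X`. -/
def ConicConnected {m : ℕ} (X : Set (PS m)) : Prop :=
  GenericallyOnPairs X fun x y =>
    ∃ C : Set (PS m), IsIrreducibleConic C ∧ C ⊆ X ∧ x ∈ C ∧ y ∈ C

/-- An interpretation of the transcendental / cohomological invariants of
embedded projective varieties used in the paper: being Fano, the Fano index,
`Pic ≅ ℤ`, degrees of normal bundles of lines, the degree, and conditions on
`H²`, `H⁴`, Chern classes and the second Chern character. -/
structure GeomInterp where
  /-- `X` is a Fano variety. -/
  IsFanoVariety : ∀ {m : ℕ}, Set (PS m) → Prop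
  /-- The Fano index of `X`: the maximal `r` such that `r` divides `-K_X` in `Pic X`. -/
  fanoIndex : ∀ {m : ℕ}, Set (PS m) → ℕ
  /-- `Pic X ≅ ℤ`. -/
  PicIsZ : ∀ {m : ℕ}, Set (PS m) → Prop
  /-- `deg N_{ℓ/X}`, the degree of the normal bundle of a line `ℓ ⊆ X`. -/
  normalBundleDeg : ∀ {m : ℕ}, Set (PS m) → Set (PS m) → ℤ
  /-- The degree of `X`, i.e. the self-intersection number `H^{dim X}`. -/
  degreeOf : ∀ {m : ℕ}, Set (PS m) → ℕ
  /-- `H²(X, ℤ) ≅ ℤ[H]`, generated by the hyperplane class. -/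
  H2GenByHyperplane : ∀ {m : ℕ}, Set (PS m) → Prop
  /-- `H⁴(X, ℤ) ≅ ℤ[H²]`. -/
  H4GenByHyperplaneSq : ∀ {m : ℕ}, Set (PS m) → Prop
  /-- `c₁(X) = a·H` in `H²(X, ℤ)`. -/
  c1Eq : ∀ {m : ℕ}, Set (PS m) → ℤ → Prop
  /-- `c₂(X) = a·H²` in `H⁴(X, ℤ)`. -/
  c2Eq : ∀ {m : ℕ}, Set (PS m) → ℤ → Prop
  /-- `ch₂(X) = (c₁(X)² - 2c₂(X))/2 = a·H²` in `H⁴(X, ℤ)`. -/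
  ch2Eq : ∀ {m : ℕ}, Set (PS m) → ℤ → Prop

end PaperQV

open PaperQV

namespace QuadVar

open MvPolynomial Module

section

/-- A subspace `R` stable under `Θ` which contains `K` is everything, provided that
`Θ - s` is onto modulo `K` for every scalar `s` (Hautus criterion). -/
theorem eq_top_of_hautus {D : Type*} [AddCommGroup D] [Module ℂ D] [FiniteDimensional ℂ D]
    (Θ : D →ₗ[ℂ] D) (K R : Submodule ℂ D) (hK : K ≤ R) (hR : R ≤ R.comap Θ)
    (h : ∀ s : ℂ, LinearMap.range (Θ - s • LinearMap.id) ⊔ K = ⊤) : R = ⊤ := by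
  by_contra hne
  have : Nontrivial (D ⧸ R) := Submodule.Quotient.nontrivial_iff.2 hne
  let T : Module.End ℂ (D ⧸ R) := R.mapQ R Θ hR
  obtain ⟨s, hs⟩ := Module.End.exists_eigenvalue T
  obtain ⟨v, hv⟩ := hs.exists_hasEigenvector
  have hsurj : Function.Surjective (T - s • (LinearMap.id : Module.End ℂ (D ⧸ R))) := by
    intro y
    obtain ⟨y, rfl⟩ := Submodule.mkQ_surjective R y
    have hy : y ∈ LinearMap.range (Θ - s • LinearMap.id) ⊔ K := by rw [h s]; trivial
    obtain ⟨_, ⟨z, rfl⟩, k, hk, rfl⟩ := Submodule.mem_sup.1 hy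
    refine ⟨R.mkQ z, ?_⟩
    have : R.mkQ k = 0 := by simpa using hK hk
    rw [map_add, this]
    simp [T]
  have hinj := LinearMap.injective_iff_surjective.2 hsurj
  apply hv.2
  apply hinj
  have := hv.apply_eq_smul
  simp [this]

theorem finrank_comap_add {D : Type*} [AddCommGroup D] [Module ℂ D] [FiniteDimensional ℂ D]
    (M : D →ₗ[ℂ] D) (K : Submodule ℂ D)
    (h : Module.finrank ℂ (K.comap M) = Module.finrank ℂ K) :
    LinearMap.range M ⊔ K = ⊤ := by
  apply Submodule.eq_top_of_finrank_eq
  have h1 := Submodule.finrank_sup_add_finrank_inf_eq (LinearMap.range M) K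
  have h2 := LinearMap.finrank_range_add_finrank_ker M
  have h3 := LinearMap.finrank_range_add_finrank_ker (M.domRestrict (K.comap M))
  have h4 : LinearMap.range (M.domRestrict (K.comap M)) = LinearMap.range M ⊓ K := by
    ext y
    constructor
    · rintro ⟨⟨x, hx⟩, rfl⟩
      exact ⟨⟨x, rfl⟩, hx⟩
    · rintro ⟨⟨x, rfl⟩, hx⟩
      exact ⟨⟨x, hx⟩, rfl⟩
  have h5 : Module.finrank ℂ (LinearMap.ker (M.domRestrict (K.comap M))) =
      Module.finrank ℂ (LinearMap.ker M) := by
    have hle : LinearMap.ker M ≤ K.comap M := fun x hx => by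
      simp [LinearMap.mem_ker.1 hx]
    rw [LinearMap.ker_domRestrict]
    exact (Submodule.comapSubtypeEquivOfLe hle).finrank_eq
  rw [h4, h5, h] at h3
  omega

/-- If `R` contains the preimage of `K` under `1 + t Θ` for all but finitely many `t`, then so
does the whole space. -/
theorem eq_top_of_pencil {D : Type*} [AddCommGroup D] [Module ℂ D] [FiniteDimensional ℂ D]
    (Θ : D →ₗ[ℂ] D) (K P : Submodule ℂ D) (F : Set ℂ) (hF : F.Finite)
    (hP : ∀ t, t ∉ F → K.comap (LinearMap.id + t • Θ) ≤ P)
    (h : ∀ s : ℂ, LinearMap.range (Θ - s • LinearMap.id) ⊔ K = ⊤) : P = ⊤ := by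
  classical
  -- scalars for which `1 + t Θ` is invertible
  have hbad : {t : ℂ | ¬ Function.Injective ((LinearMap.id : D →ₗ[ℂ] D) + t • Θ)}.Finite := by
    have h1 : (Module.End.HasEigenvalue Θ : ℂ → Prop) = Module.End.HasEigenvalue Θ := rfl
    have h2 : {μ : ℂ | Module.End.HasEigenvalue Θ μ}.Finite := Module.End.finite_hasEigenvalue Θ
    refine (h2.image (fun μ => -μ⁻¹)).subset ?_
    intro t ht
    simp only [Set.mem_ofPred_eq] at ht
    rw [← LinearMap.ker_eq_bot, Submodule.eq_bot_iff] at ht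
    push Not at ht
    obtain ⟨x, hx, hx0⟩ := ht
    have hx' : x + t • Θ x = 0 := by simpa using hx
    have ht0 : t ≠ 0 := by
      rintro rfl
      simp at hx'
      exact hx0 hx'
    refine ⟨-t⁻¹, ?_, by simp⟩
    apply Module.End.hasEigenvalue_of_hasEigenvector (x := x)
    refine ⟨?_, hx0⟩
    rw [Module.End.mem_eigenspace_iff]
    have : t • Θ x = - x := by rw [eq_neg_iff_add_eq_zero, add_comm]; exact hx'
    rw [neg_smul, ← smul_neg, ← this, smul_smul, inv_mul_cancel₀ ht0, one_smul]
  set B : Set ℂ := F ∪ {0} ∪ {t : ℂ | ¬ Function.Injective ((LinearMap.id : D →ₗ[ℂ] D) + t • Θ)}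
    with hB
  have hBfin : B.Finite := (hF.union (Set.finite_singleton _)).union hbad
  set G : Set D := {u | ∃ t, t ∉ B ∧ u + t • Θ u ∈ K} with hG
  obtain ⟨G', hG'G, hG'fin, hspan⟩ : ∃ G' ⊆ G, G'.Finite ∧
      Submodule.span ℂ G' = Submodule.span ℂ G := by
    obtain ⟨b, hb, hb2, hb3⟩ := exists_linearIndependent ℂ G
    exact ⟨b, hb, hb3.setFinite, hb2⟩
  choose! τ hτB hτK using (fun u (hu : u ∈ G) => hu)
  have hinf : (B ∪ τ '' G')ᶜ.Infinite := (hBfin.union (hG'fin.image τ)).infinite_compl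
  obtain ⟨s, hs⟩ := hinf.nonempty
  rw [Set.mem_compl_iff, Set.mem_union, not_or] at hs
  obtain ⟨hsB, hsτ⟩ := hs
  have hs0 : s ≠ 0 := by rintro rfl; exact hsB (by simp [hB])
  have hsinj : Function.Injective ((LinearMap.id : D →ₗ[ℂ] D) + s • Θ) := by
    by_contra hh; exact hsB (by simp only [hB]; right; exact hh)
  have hssurj := LinearMap.injective_iff_surjective.1 hsinj
  set R := Submodule.span ℂ G with hR
  set M : D →ₗ[ℂ] D := LinearMap.id + s • Θ with hM
  have hMapp : ∀ x, M x = x + s • Θ x := fun x => by simp [hM]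
  have hRP : R ≤ P := by
    rw [hR, Submodule.span_le]
    rintro u ⟨t, htB, htK⟩
    refine hP t (fun h' => htB (by simp [hB, h'])) ?_
    simpa using htK
  have hRM : R ≤ R.map M := by
    rw [← hspan, Submodule.span_le]
    intro u hu
    have hu' := hG'G hu
    obtain ⟨u', hu'M⟩ := hssurj (u + τ u • Θ u)
    have hne : s - τ u ≠ 0 := by
      intro h'
      exact hsτ ⟨u, hu, (sub_eq_zero.1 h').symm⟩
    rw [hspan]
    have hu'R : u' ∈ R := by
      apply Submodule.subset_span
      refine ⟨s, hsB, ?_⟩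
      rw [← hMapp, hu'M]
      exact hτK u hu'
    refine ⟨(s - τ u)⁻¹ • (s • u' - τ u • u), ?_, ?_⟩
    · exact R.smul_mem _ (R.sub_mem (R.smul_mem _ hu'R) (R.smul_mem _ (Submodule.subset_span hu')))
    · rw [map_smul, map_sub, map_smul, map_smul, hu'M, hMapp, inv_smul_eq_iff₀ hne]
      module
  have hRM' : R.map M = R := by
    symm
    apply Submodule.eq_of_le_of_finrank_le hRM
    exact Submodule.finrank_map_le M R
  have hΘR : R ≤ R.comap Θ := by
    intro x hx
    have h1 : M x ∈ R := by rw [← hRM']; exact Submodule.mem_map_of_mem hx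
    rw [hMapp] at h1
    have h2 : s • Θ x ∈ R := (R.add_mem_iff_right hx).1 h1
    exact (R.smul_mem_iff hs0).1 h2
  have hKR : K ≤ R := by
    intro k hk
    obtain ⟨u, hu⟩ := hssurj k
    have : u ∈ R := Submodule.subset_span ⟨s, hsB, by rw [← hMapp, hu]; exact hk⟩
    rw [← hu, ← hRM']
    exact Submodule.mem_map_of_mem this
  have := eq_top_of_hautus Θ K R hKR hΘR h
  exact top_le_iff.1 (this ▸ hRP)

/-- The pencil lemma. -/
theorem pencil {A E : Type*} [AddCommGroup A] [Module ℂ A] [FiniteDimensional ℂ A]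
    [AddCommGroup E] [Module ℂ E] (φ ψ : A →ₗ[ℂ] E) (κ : ℕ)
    (hrk : ∀ s t : ℂ, (s ≠ 0 ∨ t ≠ 0) → Module.finrank ℂ (LinearMap.ker (s • φ + t • ψ)) = κ)
    (h₁ : ∀ a, φ a = 0 → ψ a ∈ LinearMap.range φ)
    (h₂ : ∀ a, φ a ∈ LinearMap.range ψ → ψ a ∈ LinearMap.range φ)
    (P : Submodule ℂ A) (F : Set ℂ) (hF : F.Finite)
    (hP : ∀ t, t ∉ F → LinearMap.ker (φ + t • ψ) ≤ P) :
    (LinearMap.range φ).comap ψ ≤ P := by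
  set D := (LinearMap.range φ).comap ψ with hD
  have hker : ∀ s t : ℂ, (s ≠ 0 ∨ t ≠ 0) → LinearMap.ker (s • φ + t • ψ) ≤ D := by
    intro s t hst a ha
    have ha' : s • φ a + t • ψ a = 0 := by simpa using ha
    rw [hD, Submodule.mem_comap]
    by_cases ht : t = 0
    · subst ht
      have hs : s ≠ 0 := by tauto
      simp [hs] at ha'
      exact h₁ a ha'
    · refine ⟨-(t⁻¹ * s) • a, ?_⟩
      rw [map_smul, neg_smul, mul_smul, neg_eq_iff_add_eq_zero, ← smul_right_inj ht, smul_add,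
        smul_smul t t⁻¹, mul_inv_cancel₀ ht, one_smul, smul_zero, ha']
  have hψ : ∀ a ∈ D, ∃ b ∈ D, φ b = ψ a := by
    rintro a ⟨b, hb⟩
    exact ⟨b, h₂ b (hb ▸ ⟨a, rfl⟩), hb⟩
  obtain ⟨Θ, hΘ⟩ : ∃ Θ : D →ₗ[ℂ] D, ∀ a : D, φ (Θ a) = ψ a := by
    let φ' : D →ₗ[ℂ] (D.map φ) := φ.submoduleMap D
    have hφ' : Function.Surjective φ' := φ.submoduleMap_surjective D
    let ψ' : D →ₗ[ℂ] (D.map φ) := (ψ.domRestrict D).codRestrict (D.map φ) (by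
      rintro ⟨a, ha⟩
      obtain ⟨b, hb, hab⟩ := hψ a ha
      exact ⟨b, hb, hab⟩)
    obtain ⟨Θ, hΘ⟩ := Module.projective_lifting_property φ' ψ' hφ'
    refine ⟨Θ, fun a => ?_⟩
    have := congrArg (fun f => (f a : E)) hΘ
    simpa [φ', ψ'] using this
  set K : Submodule ℂ D := (LinearMap.ker φ).comap D.subtype with hK
  have hcom : ∀ s t : ℂ, K.comap (s • LinearMap.id + t • Θ) =
      (LinearMap.ker (s • φ + t • ψ)).comap D.subtype := by
    intro s t
    ext a
    simp [hK, hΘ]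
  have hfin : ∀ s t : ℂ, (s ≠ 0 ∨ t ≠ 0) →
      Module.finrank ℂ (K.comap (s • LinearMap.id + t • Θ)) = κ := by
    intro s t hst
    rw [hcom, ← hrk s t hst]
    exact (Submodule.comapSubtypeEquivOfLe (hker s t hst)).finrank_eq
  have hKκ : Module.finrank ℂ K = κ := by
    have := hfin 1 0 (by simp)
    rwa [one_smul, zero_smul, add_zero, Submodule.comap_id] at this
  have htop := eq_top_of_pencil Θ K (P.comap D.subtype) F hF
    (by
      intro t ht a ha
      have := hcom 1 t
      rw [one_smul, one_smul] at this
      rw [this] at ha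
      exact hP t ht ha)
    (by
      intro s
      apply finrank_comap_add
      rw [hKκ, ← hfin (-s) 1 (by simp)]
      have : Θ - s • LinearMap.id = -s • LinearMap.id + (1 : ℂ) • Θ := by module
      rw [this])
  intro a ha
  have : (⟨a, ha⟩ : D) ∈ P.comap D.subtype := by rw [htop]; trivial
  exact this

end

section

open MvPolynomial

theorem derivation_aeval {σ A M : Type*} [Fintype σ] [CommRing A] [Algebra ℂ A]
    [AddCommGroup M] [Module A M] [Module ℂ M] [IsScalarTower ℂ A M]
    (D : Derivation ℂ A M) (x : σ → A) (p : MvPolynomial σ ℂ) :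
    D (aeval x p) = ∑ l, aeval x (pderiv l p) • D (x l) := by
  classical
  induction p using MvPolynomial.induction_on with
  | C a => simp
  | add p q hp hq => simp [hp, hq, add_smul, Finset.sum_add_distrib]
  | mul_X p i hp =>
    simp only [map_mul, aeval_X, Derivation.leibniz, hp, pderiv_X, smul_eq_mul, map_add, add_smul,
      Finset.sum_add_distrib, Finset.smul_sum]
    congr 1
    · rw [Finset.sum_eq_single i]
      · simp
      · intro b _ hb
        simp [hb.symm]
      · simp
    · simp [mul_smul]

/-- First order Taylor formula for increments of square zero. -/
theorem aeval_add_eq {σ A : Type*} [Fintype σ] [CommRing A] [Algebra ℂ A]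
    (y e : σ → A) (he : ∀ i j, e i * e j = 0) (p : MvPolynomial σ ℂ) :
    aeval (fun i => y i + e i) p = aeval y p + ∑ l, aeval y (pderiv l p) * e l := by
  classical
  induction p using MvPolynomial.induction_on with
  | C a => simp
  | add p q hp hq => simp only [map_add, hp, hq, add_mul, Finset.sum_add_distrib]; ring
  | mul_X p i hp =>
    have h1 : (∑ l, aeval y (pderiv l p) * e l) * e i = 0 := by
      rw [Finset.sum_mul]
      exact Finset.sum_eq_zero fun l _ => by rw [mul_assoc, he, mul_zero]
    have h2 : ∑ l, aeval y (pderiv l (p * X i)) * e l =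
        aeval y p * e i + (∑ l, aeval y (pderiv l p) * e l) * y i := by
      simp only [Derivation.leibniz, pderiv_X, smul_eq_mul, map_add, map_mul, aeval_X, add_mul,
        Finset.sum_add_distrib, Finset.sum_mul]
      congr 1
      · rw [Finset.sum_eq_single i]
        · simp
        · intro b _ hb
          simp [hb.symm]
        · simp
      · exact Finset.sum_congr rfl fun l _ => by ring
    rw [h2, map_mul, aeval_X, hp, map_mul, aeval_X]
    linear_combination h1

theorem isNilpotent_of_mul_eq_zero {B : Type*} [CommRing B] (I : Ideal B)
    (h : ∀ r ∈ I, ∀ s ∈ I, r * s = 0) : IsNilpotent I := by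
  refine ⟨2, ?_⟩
  rw [pow_two, Ideal.zero_eq_bot, eq_bot_iff, Ideal.mul_le]
  exact h

/-- In characteristic zero derivations extend along injective maps to fields. -/
theorem exists_derivation_extension {A K : Type} [CommRing A] [IsDomain A] [Algebra ℂ A] [Field K]
    [Algebra ℂ K] [Algebra A K] [IsScalarTower ℂ A K] [Algebra.EssFiniteType ℂ K]
    (hinj : Function.Injective (algebraMap A K)) (D : Derivation ℂ A K) :
    ∃ D' : Derivation ℂ K K, ∀ a, D' (algebraMap A K a) = D a := by
  have hfai : FaithfulSMul A K := (faithfulSMul_iff_algebraMap_injective A K).2 hinj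
  let K0 := FractionRing A
  let : Algebra K0 K := FractionRing.liftAlgebra A K
  have : IsScalarTower A K0 K := FractionRing.isScalarTower_liftAlgebra A K
  have : IsScalarTower ℂ K0 K := by
    refine IsScalarTower.of_algebraMap_eq fun x => ?_
    rw [IsScalarTower.algebraMap_apply ℂ A K0, ← IsScalarTower.algebraMap_apply A K0 K,
      ← IsScalarTower.algebraMap_apply]
  have : Algebra.EssFiniteType K0 K := Algebra.EssFiniteType.of_comp ℂ K0 K
  have : CharZero K0 := charZero_of_injective_algebraMap (algebraMap ℂ K0).injective
  have : Algebra.FormallySmooth A K0 := Algebra.FormallySmooth.of_isLocalization (nonZeroDivisors A)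
  have : Algebra.FormallySmooth K0 K := inferInstance
  have hsm : Algebra.FormallySmooth A K := Algebra.FormallySmooth.comp A K0 K
  let B := TrivSqZeroExt K K
  let φ : A →+* TrivSqZeroExt K K :=
    { toFun := fun a => (algebraMap A K a, D a)
      map_one' := TrivSqZeroExt.ext (map_one (algebraMap A K)) D.map_one_eq_zero
      map_mul' := fun a b => TrivSqZeroExt.ext (map_mul (algebraMap A K) a b) (by
        change D (a * b) = algebraMap A K a • D b + MulOpposite.op (algebraMap A K b) • D a
        simp [Algebra.smul_def, mul_comm])
      map_zero' := TrivSqZeroExt.ext (map_zero (algebraMap A K)) D.map_zero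
      map_add' := fun a b => TrivSqZeroExt.ext (map_add (algebraMap A K) a b) (D.map_add a b) }
  let algB : Algebra A B := φ.toAlgebra
  let g : B →ₐ[A] K :=
    { toRingHom := (TrivSqZeroExt.fstHom K K K).toRingHom
      commutes' := fun a => rfl }
  have hgsurj : Function.Surjective g := fun x => ⟨TrivSqZeroExt.inl x, rfl⟩
  have hnil : IsNilpotent (RingHom.ker (g : B →+* K)) := by
    refine isNilpotent_of_mul_eq_zero _ fun r hr s hs => ?_
    have hr' : r.fst = 0 := hr
    have hs' : s.fst = 0 := hs
    apply TrivSqZeroExt.ext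
    · rw [TrivSqZeroExt.fst_mul, hr', zero_mul, TrivSqZeroExt.fst_zero]
    · rw [TrivSqZeroExt.snd_mul, hr', hs', zero_smul, MulOpposite.op_zero, zero_smul, zero_add,
        TrivSqZeroExt.snd_zero]
  let ψ : K →ₐ[A] B := Algebra.FormallySmooth.liftOfSurjective (AlgHom.id A K) g hgsurj hnil
  have hψ : ∀ x, (ψ x).fst = x := fun x =>
    Algebra.FormallySmooth.liftOfSurjective_apply (AlgHom.id A K) g hgsurj hnil x
  have hψA : ∀ a, (ψ (algebraMap A K a)).snd = D a := fun a => by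
    rw [ψ.commutes]
    rfl
  have hmul : ∀ x y, (ψ (x * y)).snd = x * (ψ y).snd + y * (ψ x).snd := fun x y => by
    rw [map_mul, TrivSqZeroExt.snd_mul, hψ, hψ]
    simp [mul_comm]
  have hC : ∀ r : ℂ, (ψ (algebraMap ℂ K r)).snd = 0 := fun r => by
    rw [IsScalarTower.algebraMap_apply ℂ A K, hψA]
    simp
  refine ⟨Derivation.mk'
    { toFun := fun x => (ψ x).snd
      map_add' := fun x y => by rw [map_add]; exact TrivSqZeroExt.snd_add _ _
      map_smul' := fun r x => by
        rw [Algebra.smul_def, hmul, hC]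
        simp [Algebra.smul_def] } (fun x y => by simpa using hmul x y), fun a => hψA a⟩

/-- An element of an essentially finitely generated field killed by all derivations
is a constant. -/
theorem mem_range_of_forall_derivation {K : Type} [Field K] [Algebra ℂ K]
    [Algebra.EssFiniteType ℂ K] (r : K) (h : ∀ D : Derivation ℂ K K, D r = 0) :
    ∃ c : ℂ, algebraMap ℂ K c = r := by
  by_cases hr : Transcendental ℂ r
  · exfalso
    let : Algebra (Polynomial ℂ) K := (Polynomial.aeval r).toRingHom.toAlgebra
    have hmap : ∀ p, algebraMap (Polynomial ℂ) K p = Polynomial.aeval r p := fun p => rfl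
    have : IsScalarTower ℂ (Polynomial ℂ) K := IsScalarTower.of_algebraMap_eq fun x => by
      rw [hmap]; simp
    have hinj : Function.Injective (algebraMap (Polynomial ℂ) K) :=
      transcendental_iff_injective.1 hr
    let D0 : Derivation ℂ (Polynomial ℂ) K := Polynomial.mkDerivation ℂ (1 : K)
    obtain ⟨D', hD'⟩ := exists_derivation_extension hinj D0
    have h1 := hD' Polynomial.X
    rw [hmap, Polynomial.aeval_X, h] at h1
    simp [D0] at h1
  · rw [Transcendental, not_not] at hr
    have : r ∈ (algebraMap ℂ K).range := by
      exact minpoly.mem_range_of_degree_eq_one ℂ r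
        (IsAlgClosed.degree_eq_one_of_irreducible ℂ (minpoly.irreducible hr.isIntegral))
    exact this

/-- Local form of Nakayama's lemma. -/
theorem local_nakayama {S : Type*} [CommRing S] [IsNoetherianRing S] (P : Ideal S) [P.IsPrime]
    (J N : Ideal S) (h : ∀ x ∈ J, ∃ g, g ∉ P ∧ g * x ∈ N ⊔ P * J) :
    ∃ g, g ∉ P ∧ ∀ x ∈ J, g * x ∈ N := by
  let L := Localization.AtPrime P
  have key : ∀ (I : Ideal S) (x : S),
      algebraMap S L x ∈ I.map (algebraMap S L) ↔ ∃ g, g ∉ P ∧ g * x ∈ I := fun I x => by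
    rw [IsLocalization.algebraMap_mem_map_algebraMap_iff P.primeCompl L]
    exact ⟨fun ⟨m, hm, h⟩ => ⟨m, hm, h⟩, fun ⟨m, hm, h⟩ => ⟨m, hm, h⟩⟩
  have hle : J.map (algebraMap S L) ≤ N.map (algebraMap S L) := by
    apply Submodule.le_of_le_smul_of_le_jacobson_bot (I := IsLocalRing.maximalIdeal L)
      (IsNoetherian.noetherian _) (IsLocalRing.maximalIdeal_le_jacobson ⊥)
    rw [Ideal.map_le_iff_le_comap]
    intro x hx
    obtain ⟨g, hg, hgx⟩ := h x hx
    have := (key _ x).2 ⟨g, hg, hgx⟩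
    rw [Ideal.map_sup, Ideal.map_mul, Localization.AtPrime.map_eq_maximalIdeal] at this
    exact this
  obtain ⟨s, hs⟩ : J.FG := IsNoetherian.noetherian J
  have : ∀ x ∈ s, ∃ g, g ∉ P ∧ g * x ∈ N := fun x hx =>
    (key N x).1 (hle (Ideal.mem_map_of_mem _ (hs ▸ Ideal.subset_span hx)))
  choose! g hg hgN using this
  refine ⟨∏ x ∈ s, g x, ?_, ?_⟩
  · intro hmem
    obtain ⟨x, hx, hx'⟩ := (Ideal.IsPrime.prod_mem_iff (p := P)).1 hmem
    exact hg x hx hx'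
  · intro x hx
    have : J ≤ Submodule.comap (LinearMap.mulLeft S (∏ x ∈ s, g x)) N := by
      rw [← hs, Ideal.span_le]
      intro y hy
      obtain ⟨q, hq⟩ := Finset.dvd_prod_of_mem g hy
      change (∏ x ∈ s, g x) * y ∈ N
      rw [hq, mul_comm (g y) q, mul_assoc]
      exact N.mul_mem_left _ (hgN y hy)
    exact this hx

theorem eq_zero_of_pderiv_eq_zero {σ A K : Type} [Fintype σ] [CommRing A] [Algebra ℂ A] [Field K]
    [Algebra ℂ K] [Algebra.EssFiniteType ℂ K] (π : A →ₐ[ℂ] K) (hπ : Function.Surjective π)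
    (hsq : ∀ x y, π x = 0 → π y = 0 → x * y = 0) (α : MvPolynomial σ ℂ →ₐ[ℂ] A)
    (p : MvPolynomial σ ℂ) (hp : π (α p) = 0) (hd : ∀ l, π (α (pderiv l p)) = 0) : α p = 0 := by
  have hnil : IsNilpotent (RingHom.ker (π : A →+* K)) :=
    isNilpotent_of_mul_eq_zero _ fun r hr s hs => hsq r s hr hs
  let τ : K →ₐ[ℂ] A := Algebra.FormallySmooth.liftOfSurjective (AlgHom.id ℂ K) π hπ hnil
  have hτ : ∀ x, π (τ x) = x := fun x =>
    Algebra.FormallySmooth.liftOfSurjective_apply (AlgHom.id ℂ K) π hπ hnil x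
  let β : MvPolynomial σ ℂ →ₐ[ℂ] A := (τ.comp π).comp α
  have hβ : ∀ q, π (α q) = 0 → β q = 0 := by
    intro q hq
    change τ (π (α q)) = 0
    rw [hq, map_zero]
  have hα1 : ∀ q, α q = aeval (fun i => α (X i)) q := fun q => by
    rw [← MvPolynomial.comp_aeval_apply, MvPolynomial.aeval_X_left_apply]
  have hβ1 : ∀ q, β q = aeval (fun i => β (X i)) q := fun q => by
    rw [← MvPolynomial.comp_aeval_apply, MvPolynomial.aeval_X_left_apply]
  have hz : ∀ i, π (α (X i) - β (X i)) = 0 := fun i => by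
    rw [map_sub, sub_eq_zero]
    exact (hτ _).symm
  have h1 := aeval_add_eq (fun i => β (X i)) (fun i => α (X i) - β (X i))
    (fun i j => hsq _ _ (hz i) (hz j)) p
  simp only [add_sub_cancel] at h1
  rw [← hα1, ← hβ1, hβ p hp, zero_add] at h1
  rw [h1]
  refine Finset.sum_eq_zero fun l _ => ?_
  rw [← hβ1, hβ _ (hd l), zero_mul]

/-- A polynomial all of whose derivatives lie in the prime `P`, together with itself,
lies in `P²` locally at `P`. -/
theorem mem_sq_of_pderiv_mem {σ : Type} [Fintype σ] (P : Ideal (MvPolynomial σ ℂ)) [P.IsPrime]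
    (p : MvPolynomial σ ℂ) (hp : p ∈ P) (hd : ∀ l, pderiv l p ∈ P) :
    ∃ g, g ∉ P ∧ g * p ∈ P * P := by
  let L := Localization.AtPrime P
  let m := IsLocalRing.maximalIdeal L
  let : Field (L ⧸ m) := Ideal.Quotient.field m
  have hle : m ^ 2 ≤ m := Ideal.pow_le_self two_ne_zero
  have hα : ∀ q ∈ P, Ideal.Quotient.factorₐ ℂ hle (((Ideal.Quotient.mkₐ ℂ (m ^ 2)).comp
      (IsScalarTower.toAlgHom ℂ (MvPolynomial σ ℂ) L)) q) = 0 := by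
    intro q hq
    change Ideal.Quotient.mk m (algebraMap _ L q) = 0
    rw [Ideal.Quotient.eq_zero_iff_mem]
    exact (IsLocalization.AtPrime.to_map_mem_maximal_iff L P q).2 hq
  have h1 := eq_zero_of_pderiv_eq_zero (A := L ⧸ m ^ 2) (K := L ⧸ m) (Ideal.Quotient.factorₐ ℂ hle)
    (Ideal.Quotient.factor_surjective hle) (fun x y hx hy => by
      obtain ⟨x, rfl⟩ := Ideal.Quotient.mk_surjective (I := m ^ 2) x
      obtain ⟨y, rfl⟩ := Ideal.Quotient.mk_surjective (I := m ^ 2) y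
      have hx : x ∈ m := (Ideal.Quotient.eq_zero_iff_mem (I := m)).1 hx
      have hy : y ∈ m := (Ideal.Quotient.eq_zero_iff_mem (I := m)).1 hy
      rw [← map_mul, Ideal.Quotient.eq_zero_iff_mem, pow_two]
      exact Ideal.mul_mem_mul hx hy) _ p (hα p hp) (fun l => hα _ (hd l))
  have h2 : algebraMap _ L p ∈ (P ^ 2).map (algebraMap _ L) := by
    rw [Ideal.map_pow, Localization.AtPrime.map_eq_maximalIdeal]
    exact (Ideal.Quotient.eq_zero_iff_mem (I := m ^ 2)).1 h1
  rw [IsLocalization.algebraMap_mem_map_algebraMap_iff P.primeCompl L] at h2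
  obtain ⟨g, hg, hgp⟩ := h2
  exact ⟨g, hg, by rwa [pow_two] at hgp⟩

end

section

open MvPolynomial

theorem dominating_prime {ι σ : Type} [Finite ι] (e : σ → ι) (P : Ideal (MvPolynomial σ ℂ))
    [P.IsPrime] (B : Set (ι → ℂ)) (hB : ∀ z ∈ B, ∀ p ∈ P, eval (z ∘ e) p = 0)
    (hdom : ∀ f ∉ P, ∃ z ∈ B, eval (z ∘ e) f ≠ 0) :
    ∃ 𝔓 : Ideal (MvPolynomial ι ℂ), 𝔓.IsPrime ∧ (∀ p, rename e p ∈ 𝔓 ↔ p ∈ P) ∧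
      ∀ h ∉ 𝔓, ∃ z ∈ B, (∀ q ∈ 𝔓, eval z q = 0) ∧ eval z h ≠ 0 := by
  have hmem : ∀ (B' : Set (ι → ℂ)) p, p ∈ vanishingIdeal ℂ B' ↔ ∀ z ∈ B', eval z p = 0 := by
    intro B' p
    rw [mem_vanishingIdeal_iff]
    simp [aeval_eq_eval]
  let 𝒥 : Set (Ideal (MvPolynomial ι ℂ)) :=
    {I | ∃ B' ⊆ B, (∀ f ∉ P, ∃ z ∈ B', eval (z ∘ e) f ≠ 0) ∧ I = vanishingIdeal ℂ B'}
  have hne : 𝒥.Nonempty := ⟨_, B, subset_rfl, hdom, rfl⟩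
  obtain ⟨I, ⟨B', hB', hd, rfl⟩, hmax⟩ := set_has_maximal_iff_noetherian.mpr
    (inferInstance : IsNoetherianRing (MvPolynomial ι ℂ)) 𝒥 hne
  refine ⟨vanishingIdeal ℂ B', ?_, ?_, ?_⟩
  · refine Ideal.isPrime_iff.mpr ⟨?_, ?_⟩
    · obtain ⟨z, hz, h1⟩ := hd 1 ((Ideal.ne_top_iff_one P).mp (Ideal.IsPrime.ne_top inferInstance))
      intro h
      have := (hmem B' 1).mp (h ▸ Submodule.mem_top) z hz
      simp at this
    · intro a b hab
      have key : ∀ a, (∀ f ∉ P, ∃ z ∈ B' ∩ {z | eval z a = 0}, eval (z ∘ e) f ≠ 0) →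
          a ∈ vanishingIdeal ℂ B' := by
        intro a ha
        have h1 : vanishingIdeal ℂ (B' ∩ {z | eval z a = 0}) ∈ 𝒥 :=
          ⟨_, Set.inter_subset_left.trans hB', ha, rfl⟩
        have h2 : vanishingIdeal ℂ B' ≤ vanishingIdeal ℂ (B' ∩ {z | eval z a = 0}) := by
          intro p hp
          rw [hmem] at hp ⊢
          exact fun z hz => hp z hz.1
        have h3 : vanishingIdeal ℂ B' = vanishingIdeal ℂ (B' ∩ {z | eval z a = 0}) := by
          by_contra hne
          exact hmax _ h1 (lt_of_le_of_ne h2 hne)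
        rw [h3, hmem]
        exact fun z hz => hz.2
      by_contra! hcon
      have ha := mt (key a) hcon.1
      have hb := mt (key b) hcon.2
      push Not at ha hb
      obtain ⟨f, hf, hfz⟩ := ha
      obtain ⟨g, hg, hgz⟩ := hb
      obtain ⟨z, hz, hz'⟩ := hd (f * g) (fun h => (Ideal.IsPrime.mem_or_mem inferInstance h).elim hf hg)
      have h0 := (hmem B' _).mp hab z hz
      rw [map_mul] at h0 hz'
      rcases mul_eq_zero.mp h0 with h | h
      · exact hz' (by rw [hfz z ⟨hz, h⟩, zero_mul])
      · exact hz' (by rw [hgz z ⟨hz, h⟩, mul_zero])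
  · intro p
    rw [hmem]
    simp only [eval_rename]
    constructor
    · intro h
      by_contra hp
      obtain ⟨z, hz, hz'⟩ := hd p hp
      exact hz' (h z hz)
    · intro hp z hz
      exact hB z (hB' hz) p hp
  · intro h hh
    rw [hmem] at hh
    push Not at hh
    obtain ⟨z, hz, hz'⟩ := hh
    exact ⟨z, hB' hz, fun q hq => (hmem _ _).mp hq z hz, hz'⟩

theorem mkDerivation_apply_eq {σ : Type} [Fintype σ] (w : σ → MvPolynomial σ ℂ)
    (p : MvPolynomial σ ℂ) : mkDerivation ℂ w p = ∑ l, w l * pderiv l p := by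
  have := derivation_aeval (mkDerivation ℂ w) (X : σ → MvPolynomial σ ℂ) p
  simp only [aeval_X_left_apply, mkDerivation_X, smul_eq_mul] at this
  rw [this]
  exact Finset.sum_congr rfl fun l _ => mul_comm _ _

theorem exists_quotient_derivation {σ : Type} [Fintype σ] (P : Ideal (MvPolynomial σ ℂ))
    (w : σ → MvPolynomial σ ℂ) (hw : ∀ p ∈ P, ∑ l, w l * pderiv l p ∈ P) :
    ∃ D : Derivation ℂ (MvPolynomial σ ℂ ⧸ P) (MvPolynomial σ ℂ ⧸ P), ∀ p,
      D (Ideal.Quotient.mk P p) = Ideal.Quotient.mk P (∑ l, w l * pderiv l p) := by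
  have hd : ∀ p, Ideal.Quotient.mkₐ ℂ P p = 0 →
      Ideal.Quotient.mkₐ ℂ P (mkDerivation ℂ w p) = 0 := by
    intro p hp
    rw [mkDerivation_apply_eq]
    exact Ideal.Quotient.eq_zero_iff_mem.mpr (hw p (Ideal.Quotient.eq_zero_iff_mem.mp hp))
  refine ⟨Derivation.liftOfSurjective (Ideal.Quotient.mkₐ_surjective ℂ P) hd, fun p => ?_⟩
  rw [← mkDerivation_apply_eq]
  exact Derivation.liftOfSurjective_apply (Ideal.Quotient.mkₐ_surjective ℂ P) hd p

theorem generic_lift {σ τ κ : Type} [Fintype σ] [Fintype τ] (P : Ideal (MvPolynomial σ ℂ))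
    [P.IsPrime] (w : σ → MvPolynomial σ ℂ) (hw : ∀ p ∈ P, ∑ l, w l * pderiv l p ∈ P)
    (G : κ → MvPolynomial (σ ⊕ τ) ℂ) :
    ∃ f ∉ P, ∀ (x : σ → ℂ) (v : τ → ℂ), (∀ p ∈ P, eval x p = 0) → eval x f ≠ 0 →
      (∀ j, eval (Sum.elim x v) (G j) = 0) → ∃ u : τ → ℂ, ∀ j,
        ∑ l, eval (Sum.elim x v) (pderiv (Sum.inl l) (G j)) * eval x (w l) +
        ∑ l, eval (Sum.elim x v) (pderiv (Sum.inr l) (G j)) * u l = 0 := by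
  by_contra! hcon
  let B : Set (σ ⊕ τ → ℂ) := {z | (∀ p ∈ P, eval (z ∘ Sum.inl) p = 0) ∧ (∀ j, eval z (G j) = 0) ∧
    ∀ u : τ → ℂ, ∃ j, ∑ l, eval z (pderiv (Sum.inl l) (G j)) * eval (z ∘ Sum.inl) (w l) +
        ∑ l, eval z (pderiv (Sum.inr l) (G j)) * u l ≠ 0}
  obtain ⟨𝔓, hprime, hiff, hgen⟩ := dominating_prime (Sum.inl : σ → σ ⊕ τ) P B
    (fun z hz => hz.1) (by
      intro f hf
      obtain ⟨x, v, h1, h2, h3, h4⟩ := hcon f hf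
      exact ⟨Sum.elim x v, ⟨by simpa using h1, h3, by simpa using h4⟩, by simpa using h2⟩)
  have hG : ∀ j, G j ∈ 𝔓 := by
    intro j
    by_contra h
    obtain ⟨z, hz, -, hz'⟩ := hgen _ h
    exact hz' (hz.2.1 j)
  let S' := MvPolynomial (σ ⊕ τ) ℂ
  let A := MvPolynomial σ ℂ ⧸ P
  let R' := S' ⧸ 𝔓
  let K := FractionRing R'
  let ρ : MvPolynomial σ ℂ →ₐ[ℂ] K :=
    (IsScalarTower.toAlgHom ℂ R' K).comp ((Ideal.Quotient.mkₐ ℂ 𝔓).comp (rename Sum.inl))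
  have hρ0 : ∀ q : S', algebraMap R' K (Ideal.Quotient.mk 𝔓 q) = 0 ↔ q ∈ 𝔓 := by
    intro q
    rw [IsFractionRing.to_map_eq_zero_iff, Ideal.Quotient.eq_zero_iff_mem]
  have hρ : ∀ p, ρ p = 0 ↔ p ∈ P := by
    intro p
    rw [← hiff p, ← hρ0]
    rfl
  let ρA : A →ₐ[ℂ] K := Ideal.Quotient.liftₐ P ρ (fun a ha => (hρ a).mpr ha)
  let : Algebra A K := ρA.toRingHom.toAlgebra
  have : IsScalarTower ℂ A K := IsScalarTower.of_algebraMap_eq' ρA.comp_algebraMap.symm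
  have hinj : Function.Injective (algebraMap A K) := by
    refine (injective_iff_map_eq_zero _).mpr ?_
    intro a ha
    obtain ⟨p, rfl⟩ := Ideal.Quotient.mk_surjective a
    exact Ideal.Quotient.eq_zero_iff_mem.mpr ((hρ p).mp ha)
  have : Algebra.EssFiniteType ℂ K := by
    have : Algebra.EssFiniteType R' K :=
      Algebra.EssFiniteType.of_isLocalization K (nonZeroDivisors R')
    exact Algebra.EssFiniteType.comp ℂ R' K
  obtain ⟨D0, hD0⟩ := exists_quotient_derivation P w hw
  let D1 : Derivation ℂ A K := (Algebra.linearMap A K).compDer D0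
  obtain ⟨D, hD⟩ := exists_derivation_extension hinj D1
  let ξ : σ ⊕ τ → K := fun l => algebraMap R' K (Ideal.Quotient.mk 𝔓 (X l))
  have hξ : ∀ q : S', aeval ξ q = algebraMap R' K (Ideal.Quotient.mk 𝔓 q) := by
    intro q
    have : (aeval ξ : S' →ₐ[ℂ] K) =
        (IsScalarTower.toAlgHom ℂ R' K).comp (Ideal.Quotient.mkₐ ℂ 𝔓) := by
      ext l
      simp only [aeval_X, ξ]
      rfl
    rw [this]
    rfl
  have hρX : ∀ p, algebraMap A K (Ideal.Quotient.mk P p) = aeval ξ (rename Sum.inl p) := by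
    intro p
    rw [hξ]
    rfl
  have hDl : ∀ l, D (ξ (Sum.inl l)) = aeval ξ (rename Sum.inl (w l)) := by
    intro l
    have h1 : ξ (Sum.inl l) = algebraMap A K (Ideal.Quotient.mk P (X l)) := by
      rw [hρX]; simp
    have h2 : ∑ i, w i * pderiv i (X l : MvPolynomial σ ℂ) = w l := by
      rw [← mkDerivation_apply_eq, mkDerivation_X]
    rw [h1, hD, ← hρX, ← h2, ← hD0]
    rfl
  classical
  obtain ⟨b, hb⟩ := IsLocalization.exist_integer_multiples_of_finset (nonZeroDivisors R')
    (Finset.univ.image fun l : τ => D (ξ (Sum.inr l)))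
  have hb' : ∀ l : τ, ∃ a : S', algebraMap R' K (Ideal.Quotient.mk 𝔓 a) =
      algebraMap R' K b * D (ξ (Sum.inr l)) := by
    intro l
    obtain ⟨a, ha⟩ := hb _ (Finset.mem_image_of_mem _ (Finset.mem_univ l))
    obtain ⟨a, rfl⟩ := Ideal.Quotient.mk_surjective a
    exact ⟨a, by rw [ha, Algebra.smul_def]⟩
  choose a ha using hb'
  obtain ⟨h, hh⟩ := Ideal.Quotient.mk_surjective (b : R')
  have hh0 : h ∉ 𝔓 := by
    intro hmem
    have := nonZeroDivisors.coe_ne_zero b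
    rw [← hh] at this
    exact this (Ideal.Quotient.eq_zero_iff_mem.mpr hmem)
  have key : ∀ j, h * ∑ l, pderiv (Sum.inl l) (G j) * rename Sum.inl (w l) +
      ∑ l, pderiv (Sum.inr l) (G j) * a l ∈ 𝔓 := by
    intro j
    have h1 := derivation_aeval D ξ (G j)
    rw [hξ (G j), (hρ0 _).mpr (hG j), map_zero, Fintype.sum_sum_type] at h1
    rw [← hρ0, ← hξ]
    simp only [map_add, map_mul, map_sum, hDl, smul_eq_mul] at h1 ⊢
    have h2 : ∀ l, aeval ξ (a l) = aeval ξ h * D (ξ (Sum.inr l)) := by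
      intro l
      rw [hξ, hξ, hh, ha]
    have h3 := congrArg (aeval ξ h * ·) h1
    simp only [mul_zero, mul_add, Finset.mul_sum] at h3
    rw [Finset.mul_sum]
    simp only [h2]
    rw [h3]
    congr 1
    · rw [Finset.mul_sum]
    · rw [Finset.mul_sum]
      exact Finset.sum_congr rfl fun l _ => by ring
  obtain ⟨z, hz, hz', hzh⟩ := hgen h hh0
  obtain ⟨j, hj⟩ := hz.2.2 (fun l => eval z (a l) / eval z h)
  refine hj ?_
  have := hz' _ (key j)
  simp only [map_add, map_mul, map_sum, eval_rename] at this
  have h4 : eval z h * (∑ l, eval z (pderiv (Sum.inl l) (G j)) * eval (z ∘ Sum.inl) (w l) +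
        ∑ l, eval z (pderiv (Sum.inr l) (G j)) * (eval z (a l) / eval z h)) = 0 := by
    rw [mul_add, ← this]
    congr 1
    rw [Finset.mul_sum]
    exact Finset.sum_congr rfl fun l _ => by field_simp
  exact (mul_eq_zero.mp h4).resolve_left hzh

end

section

theorem exists_fin_subfamily {ι M : Type} [Finite ι] [AddCommGroup M] [Module ℂ M] (u : ι → M)
    (c : ℕ) (h : finrank ℂ (Submodule.span ℂ (Set.range u)) = c) :
    ∃ I : Fin c → ι, LinearIndependent ℂ (u ∘ I) ∧
      Submodule.span ℂ (Set.range (u ∘ I)) = Submodule.span ℂ (Set.range u) := by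
  obtain ⟨κ, a, ha, hs, hl⟩ := exists_linearIndependent' ℂ u
  have : Finite κ := Finite.of_injective a ha
  have := Fintype.ofFinite κ
  have hc : Fintype.card κ = c := by
    rw [← h, ← hs, finrank_span_eq_card hl]
  let e : Fin c ≃ κ := (Fintype.equivFinOfCardEq hc).symm
  refine ⟨a ∘ e, ?_, ?_⟩
  · exact hl.comp e e.injective
  · rw [← hs, ← Function.comp_assoc, Set.range_comp (u ∘ a) e, e.surjective.range_eq,
      Set.image_univ]

theorem exists_minor {k m c : ℕ} (M : Matrix (Fin k) (Fin m) ℂ)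
    (h : finrank ℂ (Submodule.span ℂ (Set.range M.row)) = c) :
    ∃ (I : Fin c → Fin k) (J : Fin c → Fin m), (M.submatrix I J).det ≠ 0 := by
  obtain ⟨I, hI, -⟩ := exists_fin_subfamily M.row c h
  have hr : (M.submatrix I id).rank = c := by
    have := LinearIndependent.rank_matrix (M := M.submatrix I id) hI
    simpa using this
  rw [Matrix.rank_eq_finrank_span_cols] at hr
  obtain ⟨J, hJ, -⟩ := exists_fin_subfamily (M.submatrix I id).col c hr
  refine ⟨I, J, ?_⟩
  have : IsUnit (M.submatrix I J) := by
    rw [← Matrix.linearIndependent_cols_iff_isUnit]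
    exact hJ
  exact ((Matrix.isUnit_iff_isUnit_det _).mp this).ne_zero

/-- A system of quadratic forms whose zero cone is the irreducible affine cone over a smooth
variety of codimension `c`. -/
structure QuadSystem (m k c : ℕ) where
  q : (Fin k → ℂ) →ₗ[ℂ] MvPolynomial (Fin m) ℂ
  B : (Fin k → ℂ) →ₗ[ℂ] (Fin m → ℂ) →ₗ[ℂ] (Fin m → ℂ) →ₗ[ℂ] ℂ
  symm : ∀ a x y, B a x y = B a y x
  two_eval : ∀ a x, 2 * eval x (q a) = B a x x
  deriv_eval : ∀ a x w, ∑ l, eval x (pderiv l (q a)) * w l = B a x w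
  P : Ideal (MvPolynomial (Fin m) ℂ)
  prime : P.IsPrime
  mem_P : ∀ p, p ∈ P ↔ ∀ v, (∀ a, B a v v = 0) → eval v p = 0
  rank : ∀ x, x ≠ 0 → (∀ a, B a x x = 0) → finrank ℂ (LinearMap.range (B.flip x)) = c
  reg : ∀ p ∈ P, ∀ x, x ≠ 0 → (∀ a, B a x x = 0) → ∀ w, (∀ a, B a x w = 0) →
    ∑ l, eval x (pderiv l p) * w l = 0
  exists_ne : ∃ x, x ≠ 0 ∧ ∀ a, B a x x = 0
  nondeg : ∀ φ : (Fin m → ℂ) →ₗ[ℂ] ℂ, (∀ v, (∀ a, B a v v = 0) → φ v = 0) → φ = 0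

namespace QuadSystem

variable {m k c : ℕ} (D : QuadSystem m k c)

instance : D.P.IsPrime := D.prime

def cone : Set (Fin m → ℂ) := {v | ∀ a, D.B a v v = 0}

theorem eval_of_mem_P {p} (hp : p ∈ D.P) {v} (hv : v ∈ D.cone) : eval v p = 0 :=
  (D.mem_P p).mp hp v hv

theorem eval_q {v} (hv : v ∈ D.cone) (a) : eval v (D.q a) = 0 := by
  have := D.two_eval a v
  rw [hv a] at this
  simpa using this

theorem q_mem_P (a) : D.q a ∈ D.P := (D.mem_P _).mpr fun _ hv => D.eval_q hv a

/-- To check membership in `P` it suffices to do so where a polynomial outside `P` is nonzero. -/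
theorem mem_P_of_eval {g} (hg : g ∉ D.P) {p} (h : ∀ x ∈ D.cone, eval x g ≠ 0 → eval x p = 0) :
    p ∈ D.P := by
  have : g * p ∈ D.P := by
    rw [D.mem_P]
    intro x hx
    by_cases h0 : eval x g = 0
    · simp [h0]
    · simp [h x hx h0]
  exact (D.prime.mem_or_mem this).resolve_left hg

theorem eval_pderiv_q (a x l) : eval x (pderiv l (D.q a)) = D.B a x (Pi.single l 1) := by
  rw [← D.deriv_eval]
  simp [Pi.single_apply]

/-- The conormal forms at a point of the cone. -/
theorem mem_range_flip {x : Fin m → ℂ} (ψ : (Fin m → ℂ) →ₗ[ℂ] ℂ)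
    (h : ∀ w, (∀ a, D.B a x w = 0) → ψ w = 0) : ψ ∈ LinearMap.range (D.B.flip x) := by
  have := Subspace.dualCoannihilator_dualAnnihilator_eq (W := LinearMap.range (D.B.flip x))
  rw [← this, Submodule.mem_dualAnnihilator]
  intro w hw
  rw [Submodule.mem_dualCoannihilator] at hw
  exact h w fun a => hw _ ⟨a, rfl⟩

/-- The distinguished minor. -/
theorem exists_chart : ∃ (I : Fin c → Fin k) (J : Fin c → Fin m),
    (Matrix.of fun s t => pderiv (J t) (D.q (Pi.single (I s) 1))).det ∉ D.P := by
  obtain ⟨x, hx0, hx⟩ := D.exists_ne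
  let M : Matrix (Fin k) (Fin m) ℂ := Matrix.of fun i l => D.B (Pi.single i 1) x (Pi.single l 1)
  have hM : finrank ℂ (Submodule.span ℂ (Set.range M.row)) = c := by
    rw [← D.rank x hx0 hx]
    let e : ((Fin m → ℂ) →ₗ[ℂ] ℂ) →ₗ[ℂ] (Fin m → ℂ) :=
      LinearMap.pi fun l => LinearMap.applyₗ (Pi.single l 1)
    have he : Function.Injective e := by
      intro ψ ψ' h
      refine LinearMap.pi_ext' fun l => LinearMap.ext_ring ?_
      exact congrFun h l
    have h1 : Submodule.span ℂ (Set.range M.row) = (LinearMap.range (D.B.flip x)).map e := by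
      rw [← LinearMap.range_comp, LinearMap.range_eq_map, ← (Pi.basisFun ℂ (Fin k)).span_eq,
        Submodule.map_span, ← Set.range_comp]
      congr 1
      ext
      simp only [Set.mem_range, Function.comp]
      refine exists_congr fun i => ?_
      rw [Pi.basisFun_apply]
      rfl
    rw [h1]
    exact (Submodule.equivMapOfInjective e he _).symm.finrank_eq
  obtain ⟨I, J, h⟩ := exists_minor M hM
  refine ⟨I, J, fun hmem => h ?_⟩
  have := D.eval_of_mem_P hmem hx
  rw [← this, RingHom.map_det]
  congr 1
  ext s t
  simp [M, D.eval_pderiv_q]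

end QuadSystem

end

section

/-- The differential of a polynomial at `x` in the direction `w`. -/
def dif {σ : Type} [Fintype σ] (p : MvPolynomial σ ℂ) (x w : σ → ℂ) : ℂ :=
  ∑ l, eval x (pderiv l p) * w l

section dif
variable {σ : Type} [Fintype σ]

theorem dif_sum {ι : Type} (s : Finset ι) (p : ι → MvPolynomial σ ℂ) (x w) :
    dif (∑ i ∈ s, p i) x w = ∑ i ∈ s, dif (p i) x w := by
  simp only [dif, map_sum, Finset.sum_mul]
  exact Finset.sum_comm

theorem dif_mul (p r : MvPolynomial σ ℂ) (x w) :
    dif (p * r) x w = eval x p * dif r x w + eval x r * dif p x w := by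
  simp only [dif, Derivation.leibniz, smul_eq_mul, map_add, map_mul, add_mul,
    Finset.sum_add_distrib, Finset.mul_sum, mul_assoc]

theorem dif_C (a : ℂ) (x w : σ → ℂ) : dif (C a) x w = 0 := by
  simp [dif]

theorem dif_X (i : σ) (x w : σ → ℂ) : dif (X i) x w = w i := by
  classical
  simp [dif, pderiv_X, Pi.single_apply, apply_ite]

end dif

theorem forall_of_basis {k : ℕ} (φ : (Fin k → ℂ) →ₗ[ℂ] ℂ) (h : ∀ i, φ (Pi.single i 1) = 0)
    (a : Fin k → ℂ) : φ a = 0 := by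
  have : φ = 0 := LinearMap.pi_ext' fun i => LinearMap.ext_ring (by simpa using h i)
  rw [this]; rfl

namespace QuadSystem

variable {m k c : ℕ} (D : QuadSystem m k c)

theorem dif_q (a x w) : dif (D.q a) x w = D.B a x w := D.deriv_eval a x w

/-- The basis quadrics. -/
def qs (i : Fin k) : MvPolynomial (Fin m) ℂ := D.q (Pi.single i 1)

theorem qs_mem_P (i) : D.qs i ∈ D.P := D.q_mem_P _

def jac (I : Fin c → Fin k) (J : Fin c → Fin m) :
    Matrix (Fin c) (Fin c) (MvPolynomial (Fin m) ℂ) :=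
  Matrix.of fun s t => pderiv (J t) (D.qs (I s))

variable {D}

def jacAt (D : QuadSystem m k c) (I : Fin c → Fin k) (J : Fin c → Fin m) (x : Fin m → ℂ) :
    Matrix (Fin c) (Fin c) ℂ :=
  Matrix.of fun s t => D.B (Pi.single (I s) 1) x (Pi.single (J t) 1)

theorem map_jac (I J x) : (D.jac I J).map (eval x) = D.jacAt I J x := by
  ext s t
  simp [jac, jacAt, qs, eval_pderiv_q]

theorem eval_det_jac (I J x) : eval x (D.jac I J).det = (D.jacAt I J x).det := by
  rw [RingHom.map_det, ← map_jac]
  rfl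

theorem linearIndependent_rows {I J x} (h : eval x (D.jac I J).det ≠ 0) :
    LinearIndependent ℂ fun s => D.B (Pi.single (I s) 1) x := by
  rw [eval_det_jac] at h
  have h1 := Matrix.linearIndependent_rows_of_det_ne_zero h
  let e : ((Fin m → ℂ) →ₗ[ℂ] ℂ) →ₗ[ℂ] (Fin c → ℂ) :=
    LinearMap.pi fun t => LinearMap.applyₗ (Pi.single (J t) 1)
  exact LinearIndependent.of_comp e h1

theorem exists_coeff {I J x} (hx0 : x ≠ 0) (hx : x ∈ D.cone) (h : eval x (D.jac I J).det ≠ 0)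
    {ψ} (hψ : ψ ∈ LinearMap.range (D.B.flip x)) :
    ∃ a : Fin c → ℂ, ∑ s, a s • D.B (Pi.single (I s) 1) x = ψ := by
  have h1 : Submodule.span ℂ (Set.range fun s => D.B (Pi.single (I s) 1) x) =
      LinearMap.range (D.B.flip x) := by
    refine Submodule.eq_of_le_of_finrank_eq ?_ ?_
    · rw [Submodule.span_le]
      rintro _ ⟨s, rfl⟩
      exact ⟨_, rfl⟩
    · rw [finrank_span_eq_card (linearIndependent_rows h), D.rank x hx0 hx, Fintype.card_fin]
  rw [← h1] at hψ
  exact (Submodule.mem_span_range_iff_exists_fun ℂ).mp hψ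

variable (D) in
theorem exists_coord : ∃ l, (X l : MvPolynomial (Fin m) ℂ) ∉ D.P := by
  obtain ⟨x, hx0, hx⟩ := D.exists_ne
  obtain ⟨l, hl⟩ := Function.ne_iff.mp hx0
  exact ⟨l, fun h => hl (by simpa using D.eval_of_mem_P h hx)⟩

theorem mem_P_of_eval' {g} (hg : g ∉ D.P) {p}
    (h : ∀ x ∈ D.cone, x ≠ 0 → eval x g ≠ 0 → eval x p = 0) : p ∈ D.P := by
  obtain ⟨l, hl⟩ := D.exists_coord
  have hgl : g * X l ∉ D.P := fun h => (D.prime.mem_or_mem h).elim hg hl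
  refine D.mem_P_of_eval hgl fun x hx hgx => h x hx ?_ ?_
  · rintro rfl
    simp at hgx
  · intro h0
    simp [h0] at hgx

theorem cramer {I J} (hIJ : (D.jac I J).det ∉ D.P) (ψ : Fin m → MvPolynomial (Fin m) ℂ)
    (hψ : ∀ x ∈ D.cone, x ≠ 0 → ∀ w, (∀ a, D.B a x w = 0) → ∑ l, eval x (ψ l) * w l = 0) :
    ∃ N : Fin c → MvPolynomial (Fin m) ℂ, ∀ l,
      (D.jac I J).det * ψ l - ∑ s, N s * pderiv l (D.qs (I s)) ∈ D.P := by
  refine ⟨Matrix.vecMul (fun t => ψ (J t)) (D.jac I J).adjugate, fun l => ?_⟩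
  refine mem_P_of_eval' hIJ fun x hx hx0 hdet => ?_
  let Ψ : (Fin m → ℂ) →ₗ[ℂ] ℂ := ∑ l, eval x (ψ l) • LinearMap.proj l
  have hΨ : ∀ w, Ψ w = ∑ l, eval x (ψ l) * w l := by intro w; simp [Ψ]
  obtain ⟨a, ha⟩ := exists_coeff hx0 hx hdet
    (D.mem_range_flip (x := x) Ψ (fun w hw => by rw [hΨ]; exact hψ x hx hx0 w hw))
  have hl : ∀ l, eval x (ψ l) = ∑ s, a s * D.B (Pi.single (I s) 1) x (Pi.single l 1) := by
    intro l
    have h1 := LinearMap.congr_fun ha (Pi.single l 1)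
    rw [hΨ] at h1
    simpa [Pi.single_apply] using h1.symm
  have hN : ∀ s, eval x (Matrix.vecMul (fun t => ψ (J t)) (D.jac I J).adjugate s) =
      (D.jacAt I J x).det * a s := by
    intro s
    have h2 : (fun t => eval x (ψ (J t))) = Matrix.vecMul a (D.jacAt I J x) := by
      ext t
      rw [hl]
      rfl
    rw [RingHom.map_vecMul, Function.comp_def]
    have h3 : (D.jac I J).adjugate.map (eval x) = (D.jacAt I J x).adjugate := by
      rw [← map_jac]
      exact (RingHom.map_adjugate (eval x) (D.jac I J))
    rw [h3, h2, Matrix.vecMul_vecMul, Matrix.mul_adjugate, Matrix.vecMul_smul, Matrix.vecMul_one]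
    rfl
  simp only [map_sub, map_mul, map_sum, hN, eval_det_jac, hl, qs, eval_pderiv_q]
  rw [Finset.mul_sum, sub_eq_zero]
  exact Finset.sum_congr rfl fun s _ => by ring

theorem exists_local_equations {I J} (hIJ : (D.jac I J).det ∉ D.P) :
    ∃ g ∉ D.P, ∀ p ∈ D.P, ∃ h : Fin c → MvPolynomial (Fin m) ℂ,
      g * p = ∑ s, h s * D.qs (I s) := by
  let N : Ideal (MvPolynomial (Fin m) ℂ) := Ideal.span (Set.range fun s => D.qs (I s))
  have hNP : N ≤ D.P := by
    rw [Ideal.span_le]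
    rintro _ ⟨s, rfl⟩
    exact D.qs_mem_P _
  obtain ⟨g, hg, h⟩ := local_nakayama D.P D.P N (by
    intro p hp
    obtain ⟨H, hH⟩ := cramer hIJ (fun l => pderiv l p) (fun x hx hx0 w hw => D.reg p hp x hx0 hx w hw)
    set g0 := (D.jac I J).det
    have hs : ∑ s, H s * D.qs (I s) ∈ N := 
      Ideal.sum_mem _ fun s _ => Ideal.mul_mem_left _ _ (Ideal.subset_span ⟨s, rfl⟩)
    obtain ⟨g, hg, h⟩ := mem_sq_of_pderiv_mem D.P (g0 * p - ∑ s, H s * D.qs (I s))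
      (D.P.sub_mem (D.P.mul_mem_left _ hp) (hNP hs)) (by
        intro l
        have : pderiv l (g0 * p - ∑ s, H s * D.qs (I s)) =
          (g0 * pderiv l p - ∑ s, H s * pderiv l (D.qs (I s))) +
            (p * pderiv l g0 - ∑ s, D.qs (I s) * pderiv l (H s)) := by
          simp only [map_sub, map_sum, Derivation.leibniz, smul_eq_mul, Finset.sum_add_distrib]
          ring
        rw [this]
        exact D.P.add_mem (hH l) (D.P.sub_mem (D.P.mul_mem_right _ hp)
          (Ideal.sum_mem _ fun s _ => D.P.mul_mem_right _ (D.qs_mem_P _))))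
    refine ⟨g * g0, fun h => (D.prime.mem_or_mem h).elim hg hIJ, ?_⟩
    have : g * g0 * p = g * (∑ s, H s * D.qs (I s)) + g * (g0 * p - ∑ s, H s * D.qs (I s)) := by
      ring
    rw [this]
    exact Submodule.add_mem_sup (N.mul_mem_left _ hs) h)
  refine ⟨g, hg, fun p hp => ?_⟩
  obtain ⟨h', hh'⟩ := Ideal.mem_span_range_iff_exists_fun.mp (h p hp)
  exact ⟨h', hh'.symm⟩

theorem exists_good_equations {I J} (hIJ : (D.jac I J).det ∉ D.P) :
    ∃ g ∉ D.P, (∀ p ∈ D.P, ∃ h : Fin c → MvPolynomial (Fin m) ℂ, g * p = ∑ s, h s * D.qs (I s)) ∧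
      ∀ x ∈ D.cone, eval x g ≠ 0 → x ≠ 0 ∧ eval x (D.jac I J).det ≠ 0 ∧
      ∀ a, D.B a x = 0 → ∃ h : Fin c → MvPolynomial (Fin m) ℂ,
        g * D.q a = ∑ s, h s * D.qs (I s) ∧ ∀ s, eval x (h s) = 0 := by
  obtain ⟨g1, hg1, H⟩ := exists_local_equations hIJ
  obtain ⟨l, hl⟩ := D.exists_coord
  have H' : ∀ p ∈ D.P, ∃ h : Fin c → MvPolynomial (Fin m) ℂ,
      g1 * (D.jac I J).det * X l * p = ∑ s, h s * D.qs (I s) := by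
    intro p hp
    obtain ⟨h, hh⟩ := H p hp
    refine ⟨fun s => (D.jac I J).det * X l * h s, ?_⟩
    simp only [mul_assoc, ← Finset.mul_sum]
    rw [← hh]
    ring
  refine ⟨g1 * (D.jac I J).det * X l, ?_, H', ?_⟩
  · intro h
    rcases D.prime.mem_or_mem h with h | h
    · exact (D.prime.mem_or_mem h).elim hg1 hIJ
    · exact hl h
  · intro x hx hgx
    have hdet : eval x (D.jac I J).det ≠ 0 := by
      intro h0
      simp [h0] at hgx
    refine ⟨by rintro rfl; simp at hgx, hdet, fun a ha => ?_⟩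
    obtain ⟨h, hh⟩ := H' (D.q a) (D.q_mem_P a)
    refine ⟨h, hh, ?_⟩
    have hli := Fintype.linearIndependent_iff.mp (linearIndependent_rows hdet) (fun s => eval x (h s))
    refine hli ?_
    refine LinearMap.ext fun w => ?_
    have := congrArg (fun p => dif p x w) hh
    simp only [dif_mul, dif_sum, dif_q, ha, D.eval_q hx, qs] at this
    simpa using this.symm

end QuadSystem

end

section

namespace QuadSystem

variable {m k c : ℕ} {D : QuadSystem m k c}

theorem two_eval_add_smul {a x w} (hx : x ∈ D.cone) (hxw : D.B a x w = 0) (t : ℂ) :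
    2 * eval (x + t • w) (D.q a) = t ^ 2 * D.B a w w := by
  have h2 : D.B a w x = 0 := by rw [D.symm, hxw]
  rw [D.two_eval]
  simp only [map_add, map_smul, LinearMap.add_apply, LinearMap.smul_apply, smul_eq_mul, hx a, hxw,
    h2]
  ring

theorem continuous_eval_line {σ : Type} (p : MvPolynomial σ ℂ) (x w : σ → ℂ) :
    Continuous fun t : ℂ => eval (x + t • w) p :=
  (MvPolynomial.continuous_eval p).comp (by fun_prop)

/-- Quadrics singular at `x` contain the tangent space at `x`. -/
theorem singular_quadric_tangent {x : Fin m → ℂ} (hx : x ∈ D.cone) {I : Fin c → Fin k} {g a}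
    (hg : eval x g ≠ 0) (ha : D.B a x = 0) (h : Fin c → MvPolynomial (Fin m) ℂ)
    (hh : g * D.q a = ∑ s, h s * D.qs (I s)) (h0 : ∀ s, eval x (h s) = 0) {w : Fin m → ℂ}
    (hw : ∀ a, D.B a x w = 0) : D.B a w w = 0 := by
  have key : ∀ t : ℂ, t ≠ 0 → eval (x + t • w) g * D.B a w w =
      ∑ s, eval (x + t • w) (h s) * D.B (Pi.single (I s) 1) w w := by
    intro t ht
    have h1 := congrArg (fun p => 2 * eval (x + t • w) p) hh
    simp only [map_mul, map_sum, qs, Finset.mul_sum] at h1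
    have h2 : t ^ 2 * (eval (x + t • w) g * D.B a w w) = t ^ 2 *
        ∑ s, eval (x + t • w) (h s) * D.B (Pi.single (I s) 1) w w := by
      rw [Finset.mul_sum]
      calc _ = 2 * (eval (x + t • w) g * eval (x + t • w) (D.q a)) := by
            linear_combination -(eval (x + t • w) g) * two_eval_add_smul hx (hw a) t
        _ = _ := h1.trans (Finset.sum_congr rfl fun s _ => by
            linear_combination (eval (x + t • w) (h s)) * 
              two_eval_add_smul hx (hw (Pi.single (I s) 1)) t)
    exact mul_left_cancel₀ (pow_ne_zero 2 ht) h2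
  have hF : Continuous fun t : ℂ => eval (x + t • w) g * D.B a w w :=
    (continuous_eval_line _ _ _).mul continuous_const
  have hG : Continuous fun t : ℂ =>
      ∑ s, eval (x + t • w) (h s) * D.B (Pi.single (I s) 1) w w :=
    continuous_finsetSum _ fun s _ => (continuous_eval_line _ _ _).mul continuous_const
  have := congrFun (Continuous.ext_on (dense_compl_singleton (0 : ℂ)) hF hG
    (fun t ht => key t ht)) 0
  simp only [zero_smul, add_zero, h0, zero_mul, Finset.sum_const_zero] at this
  exact (mul_eq_zero.mp this).resolve_left hg

theorem polar_zero {a} {T : Submodule ℂ (Fin m → ℂ)} (h : ∀ w ∈ T, D.B a w w = 0) {w w'}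
    (hw : w ∈ T) (hw' : w' ∈ T) : D.B a w w' = 0 := by
  have h1 := h _ (T.add_mem hw hw')
  simp only [map_add, LinearMap.add_apply, h w hw, h w' hw'] at h1
  rw [D.symm a w' w] at h1
  have : 2 * D.B a w w' = 0 := by linear_combination h1
  simpa using this

def tangent (D : QuadSystem m k c) (x : Fin m → ℂ) : Submodule ℂ (Fin m → ℂ) :=
  ⨅ a, LinearMap.ker (D.B a x)

theorem mem_tangent {x w} : w ∈ D.tangent x ↔ ∀ a, D.B a x w = 0 := by
  simp [tangent]

/-- Tangent vector fields attached to a chart. -/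
def field (D : QuadSystem m k c) (I : Fin c → Fin k) (J : Fin c → Fin m) (l : Fin m) :
    Fin m → MvPolynomial (Fin m) ℂ :=
  Pi.single l (D.jac I J).det - ∑ t, Pi.single (J t)
    (Matrix.mulVec (D.jac I J).adjugate (fun s => pderiv l (D.qs (I s))) t)

theorem field_tangent (I : Fin c → Fin k) (J : Fin c → Fin m) (l : Fin m) (s : Fin c) :
    ∑ j, D.field I J l j * pderiv j (D.qs (I s)) = 0 := by
  have h1 : Matrix.mulVec (D.jac I J)
      (Matrix.mulVec (D.jac I J).adjugate (fun s => pderiv l (D.qs (I s)))) s =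
      (D.jac I J).det * pderiv l (D.qs (I s)) := by
    rw [Matrix.mulVec_mulVec, Matrix.mul_adjugate, Matrix.smul_mulVec, Matrix.one_mulVec]
    rfl
  simp only [field, Pi.sub_apply, Finset.sum_apply, sub_mul, Finset.sum_sub_distrib,
    Finset.sum_mul]
  rw [Finset.sum_comm]
  simp only [Pi.single_apply, ite_mul, zero_mul, Finset.sum_ite_eq', Finset.mem_univ, if_true]
  rw [← h1, sub_eq_zero]
  simp only [Matrix.mulVec, dotProduct, jac, Matrix.of_apply]
  exact Finset.sum_congr rfl fun t _ => mul_comm _ _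

theorem field_preserves {I J g} (hg : g ∉ D.P)
    (h : ∀ p ∈ D.P, ∃ h : Fin c → MvPolynomial (Fin m) ℂ, g * p = ∑ s, h s * D.qs (I s)) (l) :
    ∀ p ∈ D.P, ∑ j, D.field I J l j * pderiv j p ∈ D.P := by
  intro p hp
  obtain ⟨h, hh⟩ := h p hp
  have h1 := congrArg (mkDerivation ℂ (D.field I J l)) hh
  have h2 : ∀ s, mkDerivation ℂ (D.field I J l) (D.qs (I s)) = 0 := fun s => by
    rw [mkDerivation_apply_eq, field_tangent]
  simp only [map_sum, Derivation.leibniz, h2, smul_eq_mul, mul_zero, zero_add] at h1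
  rw [← mkDerivation_apply_eq]
  refine (D.prime.mem_or_mem (?_ : g * _ ∈ D.P)).resolve_left hg
  have h3 : g * mkDerivation ℂ (D.field I J l) p = ∑ s, D.qs (I s) *
      mkDerivation ℂ (D.field I J l) (h s) - p * mkDerivation ℂ (D.field I J l) g := by
    rw [← h1]; ring
  rw [h3]
  exact D.P.sub_mem (Ideal.sum_mem _ fun s _ => D.P.mul_mem_right _ (D.qs_mem_P _))
    (D.P.mul_mem_right _ hp)

theorem sum_field {I J} {x w : Fin m → ℂ} (hw : ∀ a, D.B a x w = 0) (j : Fin m) :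
    ∑ l, w l * eval x (D.field I J l j) = eval x (D.jac I J).det * w j := by
  have h1 : ∀ s, ∑ l, w l * eval x (pderiv l (D.qs (I s))) = 0 := by
    intro s
    rw [← hw (Pi.single (I s) 1), ← D.deriv_eval]
    exact Finset.sum_congr rfl fun l _ => mul_comm _ _
  have h2 : ∀ t, ∑ l, w l * eval x (Matrix.mulVec (D.jac I J).adjugate
      (fun s => pderiv l (D.qs (I s))) t) = 0 := by
    intro t
    simp only [Matrix.mulVec, dotProduct, map_sum, map_mul, Finset.mul_sum]
    rw [Finset.sum_comm]
    refine Finset.sum_eq_zero fun s _ => ?_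
    have := congrArg (eval x ((D.jac I J).adjugate t s) * ·) (h1 s)
    simp only [mul_zero, Finset.mul_sum] at this
    rw [← this]
    exact Finset.sum_congr rfl fun l _ => by ring
  simp only [field, Pi.sub_apply, Finset.sum_apply, map_sub, map_sum, mul_sub,
    Finset.sum_sub_distrib, Finset.mul_sum]
  have h3 : ∑ l, ∑ t, w l * eval x ((Pi.single (J t) (Matrix.mulVec (D.jac I J).adjugate
      (fun s => pderiv l (D.qs (I s))) t) : Fin m → MvPolynomial (Fin m) ℂ) j) = 0 := by
    rw [Finset.sum_comm]
    refine Finset.sum_eq_zero fun t _ => ?_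
    by_cases hj : j = J t
    · subst hj
      simpa using h2 t
    · simp [Pi.single_apply, hj]
  rw [h3, sub_zero]
  simp [Pi.single_apply, apply_ite, mul_comm]

/-- The equations of the family of lines. -/
def lineEq (D : QuadSystem m k c) : Fin k ⊕ Fin k → MvPolynomial (Fin m ⊕ Fin m) ℂ :=
  Sum.elim (fun i => ∑ l, rename Sum.inl (pderiv l (D.qs i)) * X (Sum.inr l))
    (fun i => rename Sum.inr (D.qs i))

theorem dif_rename_inl {σ τ : Type} [Fintype σ] [Fintype τ] (p : MvPolynomial σ ℂ)
    (x w : σ → ℂ) (v u : τ → ℂ) :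
    dif (rename Sum.inl p) (Sum.elim x v) (Sum.elim w u) = dif p x w := by
  simp only [dif, Fintype.sum_sum_type, Sum.elim_inl, Sum.elim_inr]
  have h1 : ∀ l : τ, pderiv (Sum.inr l) (rename (Sum.inl : σ → σ ⊕ τ) p) = 0 := by
    intro l
    refine pderiv_eq_zero_of_notMem_vars fun h => ?_
    classical
    have := vars_rename (Sum.inl : σ → σ ⊕ τ) p h
    simp at this
  simp only [h1, map_zero, zero_mul, Finset.sum_const_zero, add_zero]
  refine Finset.sum_congr rfl fun l _ => ?_
  rw [pderiv_rename Sum.inl_injective, eval_rename, Sum.elim_comp_inl]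

theorem dif_rename_inr {σ τ : Type} [Fintype σ] [Fintype τ] (p : MvPolynomial τ ℂ)
    (x w : σ → ℂ) (v u : τ → ℂ) :
    dif (rename Sum.inr p) (Sum.elim x v) (Sum.elim w u) = dif p v u := by
  simp only [dif, Fintype.sum_sum_type, Sum.elim_inl, Sum.elim_inr]
  have h1 : ∀ l : σ, pderiv (Sum.inl l) (rename (Sum.inr : τ → σ ⊕ τ) p) = 0 := by
    intro l
    refine pderiv_eq_zero_of_notMem_vars fun h => ?_
    classical
    have := vars_rename (Sum.inr : τ → σ ⊕ τ) p h
    simp at this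
  simp only [h1, map_zero, zero_mul, Finset.sum_const_zero, zero_add]
  refine Finset.sum_congr rfl fun l _ => ?_
  rw [pderiv_rename Sum.inr_injective, eval_rename, Sum.elim_comp_inr]

theorem pderiv_q (a l) : pderiv l (D.q a) = ∑ j, C (D.B a (Pi.single j 1) (Pi.single l 1)) * X j := by
  refine MvPolynomial.funext fun x => ?_
  rw [D.eval_pderiv_q, D.symm]
  have := LinearMap.pi_apply_eq_sum_univ (D.B a (Pi.single l 1)) x
  rw [this]
  simp only [map_sum, map_mul, eval_C, eval_X, smul_eq_mul]
  refine Finset.sum_congr rfl fun j _ => ?_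
  rw [mul_comm, D.symm]
  have h1 : (fun i => if j = i then (1 : ℂ) else 0) = Pi.single j 1 := by
    ext i
    simp [Pi.single_apply, eq_comm]
  rw [h1]

theorem dif_pderiv_q (a l x w) : dif (pderiv l (D.q a)) x w = D.B a w (Pi.single l 1) := by
  rw [← D.eval_pderiv_q, pderiv_q, dif_sum]
  simp [dif_mul, dif_C, dif_X]

theorem B_eq_sum (a x w) : ∑ l, D.B a x (Pi.single l 1) * w l = D.B a x w := by
  rw [← D.deriv_eval]
  simp [D.eval_pderiv_q]

theorem dif_lineEq (x v w u : Fin m → ℂ) (i) :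
    dif (D.lineEq i) (Sum.elim x v) (Sum.elim w u) =
      Sum.elim (fun i => D.B (Pi.single i 1) w v + D.B (Pi.single i 1) x u)
        (fun i => D.B (Pi.single i 1) v u) i := by
  rcases i with i | i
  · simp only [lineEq, Sum.elim_inl, dif_sum, dif_mul, dif_rename_inl, dif_X, eval_rename,
      Sum.elim_comp_inl, eval_X, Sum.elim_inr, Finset.sum_add_distrib, qs, dif_pderiv_q]
    rw [add_comm, D.deriv_eval]
    congr 1
    rw [← B_eq_sum]
    exact Finset.sum_congr rfl fun l _ => mul_comm _ _
  · simp [lineEq, dif_rename_inr, qs, dif_q]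

theorem eval_lineEq (x v : Fin m → ℂ) (hv : v ∈ D.cone) (hxv : ∀ a, D.B a x v = 0) (i) :
    eval (Sum.elim x v) (D.lineEq i) = 0 := by
  rcases i with i | i
  · simp only [lineEq, Sum.elim_inl, map_sum, map_mul, eval_rename, Sum.elim_comp_inl, eval_X,
      Sum.elim_inr, qs]
    rw [D.deriv_eval, hxv]
  · simp only [lineEq, Sum.elim_inr, eval_rename, Sum.elim_comp_inr, qs, D.eval_q hv]

/-- Lines through a general point are free. -/
theorem exists_free (D : QuadSystem m k c) : ∃ f ∉ D.P, ∀ x ∈ D.cone, eval x f ≠ 0 → ∀ v ∈ D.cone,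
    (∀ a, D.B a x v = 0) → ∀ w, (∀ a, D.B a x w = 0) →
      ∃ u, ∀ a, D.B a v u = 0 ∧ D.B a w v + D.B a x u = 0 := by
  obtain ⟨I, J, hIJ⟩ := D.exists_chart
  replace hIJ : (D.jac I J).det ∉ D.P := hIJ
  obtain ⟨g, hg, hP⟩ := exists_local_equations hIJ
  choose f hf hfree using fun l => generic_lift D.P (D.field I J l) (field_preserves hg hP l)
    D.lineEq
  refine ⟨(D.jac I J).det * ∏ l, f l, ?_, ?_⟩
  · intro h
    rcases D.prime.mem_or_mem h with h | h
    · exact hIJ h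
    · obtain ⟨l, -, hl⟩ := (Ideal.IsPrime.prod_mem_iff (hp := D.prime)).mp h
      exact hf l hl
  · intro x hx hfx v hv hxv w hw
    rw [map_mul, map_prod] at hfx
    have hdet := left_ne_zero_of_mul hfx
    have hfl : ∀ l, eval x (f l) ≠ 0 := fun l =>
      Finset.prod_ne_zero_iff.mp (right_ne_zero_of_mul hfx) l (Finset.mem_univ l)
    have h1 : ∀ l, ∃ u, ∀ a, D.B a v u = 0 ∧
        D.B a (fun j => eval x (D.field I J l j)) v + D.B a x u = 0 := by
      intro l
      obtain ⟨u, hu⟩ := hfree l x v (fun p hp => D.eval_of_mem_P hp hx) (hfl l)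
        (eval_lineEq x v hv hxv)
      have h2 : ∀ i, dif (D.lineEq i) (Sum.elim x v)
          (Sum.elim (fun j => eval x (D.field I J l j)) u) = 0 := by
        intro i
        rw [← hu i]
        simp [dif, Fintype.sum_sum_type]
      refine ⟨u, fun a => ⟨?_, ?_⟩⟩
      · refine forall_of_basis ((D.B.flip v).flip u) (fun i => ?_) a
        have := h2 (Sum.inr i)
        rwa [dif_lineEq] at this
      · refine forall_of_basis ((D.B.flip (fun j => eval x (D.field I J l j))).flip v +
          (D.B.flip x).flip u) (fun i => ?_) a
        have := h2 (Sum.inl i)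
        rwa [dif_lineEq] at this
    choose u hu using h1
    set δ := eval x (D.jac I J).det
    refine ⟨δ⁻¹ • ∑ l, w l • u l, fun a => ⟨?_, ?_⟩⟩
    · simp [fun l => (hu l a).1]
    · have h3 : w = δ⁻¹ • ∑ l, w l • (fun j => eval x (D.field I J l j)) := by
        ext j
        simp only [Pi.smul_apply, Finset.sum_apply, smul_eq_mul]
        rw [sum_field hw]
        exact (inv_mul_cancel_left₀ hdet (w j)).symm
      have h4 : D.B a w v = δ⁻¹ * ∑ l, w l * D.B a (fun j => eval x (D.field I J l j)) v := by
        conv_lhs => rw [h3]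
        simp [LinearMap.sum_apply]
      rw [h4]
      simp only [map_smul, map_sum, smul_eq_mul]
      rw [← mul_add, ← Finset.sum_add_distrib]
      simp [← mul_add, fun l => (hu l a).2]

end QuadSystem

end

section

/-- A fraction killed by all derivations preserving the prime ideal is constant. -/
theorem exists_constant_ratio {m : ℕ} (P : Ideal (MvPolynomial (Fin m) ℂ)) [P.IsPrime]
    (g N : MvPolynomial (Fin m) ℂ) (hg : g ∉ P)
    (h : ∀ w : Fin m → MvPolynomial (Fin m) ℂ, (∀ p ∈ P, mkDerivation ℂ w p ∈ P) →
      mkDerivation ℂ w g * N - g * mkDerivation ℂ w N ∈ P) : ∃ r : ℂ, N - C r * g ∈ P := by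
  let A := MvPolynomial (Fin m) ℂ ⧸ P
  let K := FractionRing A
  have : Algebra.EssFiniteType ℂ K := by
    have : Algebra.EssFiniteType A K :=
      Algebra.EssFiniteType.of_isLocalization K (nonZeroDivisors A)
    exact Algebra.EssFiniteType.comp ℂ A K
  let ι : MvPolynomial (Fin m) ℂ →ₐ[ℂ] K :=
    (IsScalarTower.toAlgHom ℂ A K).comp (Ideal.Quotient.mkₐ ℂ P)
  have hι0 : ∀ p, ι p = 0 ↔ p ∈ P := by
    intro p
    change algebraMap A K (Ideal.Quotient.mk P p) = 0 ↔ _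
    rw [IsFractionRing.to_map_eq_zero_iff, Ideal.Quotient.eq_zero_iff_mem]
  have hgK : ι g ≠ 0 := fun h => hg ((hι0 g).mp h)
  obtain ⟨r, hr⟩ := mem_range_of_forall_derivation (ι N / ι g) (by
    intro D
    classical
    obtain ⟨b, hb⟩ := IsLocalization.exist_integer_multiples_of_finset (nonZeroDivisors A)
      (Finset.univ.image fun l : Fin m => D (ι (X l)))
    have hb' : ∀ l, ∃ a, ι a = algebraMap A K b * D (ι (X l)) := by
      intro l
      obtain ⟨a, ha⟩ := hb _ (Finset.mem_image_of_mem _ (Finset.mem_univ l))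
      obtain ⟨a, rfl⟩ := Ideal.Quotient.mk_surjective a
      exact ⟨a, by rw [← Algebra.smul_def, ← ha]; rfl⟩
    choose w hw using hb'
    set β := algebraMap A K b
    have hβ : β ≠ 0 := IsFractionRing.to_map_ne_zero_of_mem_nonZeroDivisors b.2
    have hι : ∀ p, aeval (fun l => ι (X l)) p = ι p := by
      intro p
      have : aeval (fun l => ι (X l)) = ι := by
        ext l
        simp
      rw [this]
    have hD : ∀ p, ι (mkDerivation ℂ w p) = β * D (ι p) := by
      intro p
      rw [mkDerivation_apply_eq, ← hι p, derivation_aeval]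
      simp only [map_sum, map_mul, hw, smul_eq_mul, hι]
      rw [Finset.mul_sum]
      exact Finset.sum_congr rfl fun l _ => by ring
    have h1 := h w (fun p hp => by
      rw [← hι0, hD, (hι0 p).mpr hp, map_zero, mul_zero])
    rw [← hι0, map_sub, map_mul, map_mul, hD, hD] at h1
    have h2 : D (ι g) * ι N - ι g * D (ι N) = 0 := by
      have : β * (D (ι g) * ι N - ι g * D (ι N)) = 0 := by rw [← h1]; ring
      exact (mul_eq_zero.mp this).resolve_left hβ
    have h3 : D (ι N) = D (ι N / ι g * ι g) := by rw [div_mul_cancel₀ _ hgK]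
    rw [Derivation.leibniz, smul_eq_mul, smul_eq_mul] at h3
    have h4 : ι g * ι g * D (ι N / ι g) = 0 := by
      have h5 : ι g * (ι N / ι g) = ι N := mul_div_cancel₀ _ hgK
      linear_combination -h2 - ι g * h3 - D (ι g) * h5
    simpa [hgK] using h4)
  refine ⟨r, ?_⟩
  rw [← hι0, map_sub, map_mul, ← MvPolynomial.algebraMap_eq, AlgHom.commutes, hr,
    div_mul_cancel₀ _ hgK, sub_self]

namespace QuadSystem

variable {m k c : ℕ} {D : QuadSystem m k c}

/-- If the quadrics singular at a general point are singular along the tangent space, they vanish. -/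
theorem exists_moving (D : QuadSystem m k c) :
    (∃ I : Fin c → Fin k, ∀ a, ∃ r : Fin c → ℂ, D.q a = ∑ s, r s • D.qs (I s)) ∨
    ∃ f ∉ D.P, ∀ x ∈ D.cone, eval x f ≠ 0 → ∃ a, D.B a x = 0 ∧
      ∃ w, (∀ b, D.B b x w = 0) ∧ D.B a w ≠ 0 := by
  refine or_iff_not_imp_right.mpr fun hcon => ?_
  push Not at hcon
  have := D.prime
  obtain ⟨I, J, hIJ⟩ := D.exists_chart
  replace hIJ : (D.jac I J).det ∉ D.P := hIJ
  refine ⟨I, fun a => ?_⟩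
  obtain ⟨N, hN⟩ := cramer hIJ (fun l => pderiv l (D.q a)) (fun x hx _ w hw => by
    rw [D.deriv_eval, hw])
  set g := (D.jac I J).det
  have key : ∀ w : Fin m → MvPolynomial (Fin m) ℂ, (∀ p ∈ D.P, mkDerivation ℂ w p ∈ D.P) → ∀ l,
      g * mkDerivation ℂ w (pderiv l (D.q a)) -
        ∑ s, N s * mkDerivation ℂ w (pderiv l (D.qs (I s))) ∈ D.P := by
    intro w hw l
    by_contra hF
    obtain ⟨x, hx, hFx, hsing⟩ := hcon _ hF
    have hδ : ∀ p, eval x (mkDerivation ℂ w p) = dif p x (fun j => eval x (w j)) := by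
      intro p
      rw [mkDerivation_apply_eq, dif, map_sum]
      exact Finset.sum_congr rfl fun _ _ => by rw [map_mul, mul_comm]
    have h1 : D.B (eval x g • a - ∑ s, eval x (N s) • Pi.single (I s) 1) x = 0 := by
      refine LinearMap.pi_ext' fun l => LinearMap.ext_ring ?_
      have := D.eval_of_mem_P (hN l) hx
      simp only [map_sub, map_mul, map_sum, qs, eval_pderiv_q] at this
      simpa using this
    have h2 := hsing _ h1 (fun j => eval x (w j)) (fun b => by
      rw [← dif_q, ← hδ]
      exact D.eval_of_mem_P (hw _ (D.q_mem_P b)) hx)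
    refine hFx ?_
    have h3 := LinearMap.congr_fun h2 (Pi.single l 1)
    simp only [map_sub, map_mul, map_sum, hδ, qs, dif_pderiv_q]
    simpa using h3
  have key2 : ∀ w : Fin m → MvPolynomial (Fin m) ℂ, (∀ p ∈ D.P, mkDerivation ℂ w p ∈ D.P) → ∀ s,
      mkDerivation ℂ w g * N s - g * mkDerivation ℂ w (N s) ∈ D.P := by
    intro w hw
    have h1 : ∀ l, ∑ s, (mkDerivation ℂ w g * N s - g * mkDerivation ℂ w (N s)) *
        pderiv l (D.qs (I s)) ∈ D.P := by
      intro l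
      have h2 := hw _ (hN l)
      have h3 := key w hw l
      have h4 : ∑ s, (mkDerivation ℂ w g * N s - g * mkDerivation ℂ w (N s)) *
          pderiv l (D.qs (I s)) = g * (mkDerivation ℂ w (g * pderiv l (D.q a) -
            ∑ s, N s * pderiv l (D.qs (I s)))) - g * (g * mkDerivation ℂ w (pderiv l (D.q a)) -
        ∑ s, N s * mkDerivation ℂ w (pderiv l (D.qs (I s)))) - mkDerivation ℂ w g * 
          (g * pderiv l (D.q a) - ∑ s, N s * pderiv l (D.qs (I s))) := by
        simp only [map_sub, map_sum, Derivation.leibniz, smul_eq_mul, Finset.sum_add_distrib,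
          sub_mul, Finset.sum_sub_distrib, mul_assoc, ← Finset.mul_sum]
        have h5 : ∑ s, pderiv l (D.qs (I s)) * mkDerivation ℂ w (N s) =
            ∑ s, mkDerivation ℂ w (N s) * pderiv l (D.qs (I s)) :=
          Finset.sum_congr rfl fun _ _ => mul_comm _ _
        rw [h5]
        ring
      rw [h4]
      exact D.P.sub_mem (D.P.sub_mem (D.P.mul_mem_left _ h2) (D.P.mul_mem_left _ h3))
        (D.P.mul_mem_left _ (hN l))
    intro s
    refine mem_P_of_eval' hIJ fun x hx _ hgx => ?_
    refine Fintype.linearIndependent_iff.mp (linearIndependent_rows hgx)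
      (fun s => eval x (mkDerivation ℂ w g * N s - g * mkDerivation ℂ w (N s))) ?_ s
    refine LinearMap.pi_ext' fun l => LinearMap.ext_ring ?_
    have := D.eval_of_mem_P (h1 l) hx
    rw [map_sum] at this
    simpa [qs, eval_pderiv_q] using this
  choose r hr using fun s => exists_constant_ratio D.P g (N s) hIJ (fun w hw => key2 w hw s)
  refine ⟨r, ?_⟩
  have h1 : ∀ l, pderiv l (D.q a) - ∑ s, C (r s) * pderiv l (D.qs (I s)) ∈ D.P := by
    intro l
    refine (D.prime.mem_or_mem (?_ : g * _ ∈ D.P)).resolve_left hIJ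
    have h2 : g * (pderiv l (D.q a) - ∑ s, C (r s) * pderiv l (D.qs (I s))) =
        (g * pderiv l (D.q a) - ∑ s, N s * pderiv l (D.qs (I s))) +
          ∑ s, (N s - C (r s) * g) * pderiv l (D.qs (I s)) := by
      simp only [sub_mul, Finset.sum_sub_distrib, mul_sub, Finset.mul_sum]
      have : ∀ s, g * (C (r s) * pderiv l (D.qs (I s))) = C (r s) * g * pderiv l (D.qs (I s)) := 
        fun s => by ring
      simp only [this]
      ring
    rw [h2]
    exact D.P.add_mem (hN l) (Ideal.sum_mem _ fun s _ => D.P.mul_mem_right _ (hr s))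
  have h2 : D.B (a - ∑ s, r s • Pi.single (I s) 1) = 0 := by
    refine LinearMap.ext fun w => ?_
    refine D.nondeg _ fun x hx => ?_
    rw [D.symm]
    have : D.B (a - ∑ s, r s • Pi.single (I s) 1) x = 0 := by
      refine LinearMap.pi_ext' fun l => LinearMap.ext_ring ?_
      have := D.eval_of_mem_P (h1 l) hx
      simp only [map_sub, map_mul, map_sum, qs, eval_pderiv_q, eval_C] at this
      simpa using this
    rw [this]
    rfl
  have h3 : D.q (a - ∑ s, r s • Pi.single (I s) 1) = 0 := by
    refine MvPolynomial.funext fun x => ?_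
    have := D.two_eval (a - ∑ s, r s • Pi.single (I s) 1) x
    rw [h2] at this
    simpa using this
  rw [map_sub, map_sum, sub_eq_zero] at h3
  rw [h3]
  simp [qs]

end QuadSystem

end

section

open MvPolynomial Module IsLocalRing

/-- A Noetherian local ring whose maximal ideal has `e` generators, `e` at most the dimension, is
a domain. -/
theorem isDomain_of_generators (e : ℕ) : ∀ (B : Type) [CommRing B] [IsLocalRing B]
    [IsNoetherianRing B] (b : Fin e → B), maximalIdeal B = Ideal.span (Set.range b) →
    (e : WithBot ℕ∞) ≤ ringKrullDim B → IsDomain B := by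
  induction e with
  | zero =>
    intro B _ _ _ b hb _
    have h0 : maximalIdeal B = ⊥ := by
      rw [hb]
      simp
    have : (⊥ : Ideal B).IsPrime := by rw [← h0]; infer_instance
    exact IsDomain.of_bot_isPrime B
  | succ e ih =>
    intro B _ _ _ b hb hdim
    have hnm : maximalIdeal B ∉ minimalPrimes B := by
      intro h
      rw [← Ideal.height_eq_zero_iff] at h
      have h1 := maximalIdeal_height_eq_ringKrullDim (R := B)
      rw [h] at h1
      rw [← h1] at hdim
      have : ((e + 1 : ℕ) : ℕ∞) ≤ 0 := by exact_mod_cast hdim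
      simp at this
    obtain ⟨x, hx, hx2, hxm⟩ : ∃ x ∈ maximalIdeal B, x ∉ maximalIdeal B ^ 2 ∧
        ∀ p ∈ minimalPrimes B, x ∉ p := by
      classical
      by_contra! hcon
      let s : Finset (Ideal B) := insert (maximalIdeal B ^ 2)
        (minimalPrimes.finite_of_isNoetherianRing B).toFinset
      have h1 : (maximalIdeal B : Set B) ⊆ ⋃ i ∈ (↑s : Set (Ideal B)), ((id i : Ideal B) : Set B) := by
        intro x hx
        by_cases h2 : x ∈ maximalIdeal B ^ 2
        · exact Set.mem_biUnion (x := maximalIdeal B ^ 2) (by simp [s]) h2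
        · obtain ⟨p, hp, hxp⟩ := hcon x hx h2
          exact Set.mem_biUnion (x := p) (by simp [s, hp]) hxp
      rw [Ideal.subset_union_prime (maximalIdeal B ^ 2) (maximalIdeal B ^ 2)] at h1
      · obtain ⟨p, hp, hle⟩ := h1
        simp only [s, Finset.mem_insert, Set.Finite.mem_toFinset, id] at hp hle
        rcases hp with rfl | hp
        · refine hnm ?_
          have h3 : maximalIdeal B = ⊥ := by
            refine Submodule.eq_bot_of_le_smul_of_le_jacobson_bot (maximalIdeal B) _
              (IsNoetherian.noetherian _) ?_ (jacobson_eq_maximalIdeal ⊥ bot_ne_top).ge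
            rwa [smul_eq_mul, ← pow_two]
          have : (⊥ : Ideal B).IsPrime := by rw [← h3]; infer_instance
          have := IsDomain.of_bot_isPrime B
          rw [h3, IsDomain.minimalPrimes_eq_singleton_bot]
          rfl
        · have hp' : p.IsPrime := hp.1.1
          have : maximalIdeal B = p := le_antisymm hle (le_maximalIdeal hp'.ne_top)
          exact hnm (this ▸ hp)
      · intro i hi h2 _
        simp only [s, Finset.mem_insert, Set.Finite.mem_toFinset] at hi
        exact (hi.resolve_left h2).1.1
    have hle : Ideal.span {x} ≤ maximalIdeal B := by
      rwa [Ideal.span_singleton_le_iff_mem]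
    have hnt : Nontrivial (B ⧸ Ideal.span {x}) :=
      Ideal.Quotient.nontrivial_iff.mpr (fun h => (maximalIdeal.isMaximal B).ne_top
        (top_le_iff.mp (h ▸ hle)))
    have hloc : IsLocalRing (B ⧸ Ideal.span {x}) :=
      IsLocalRing.of_surjective' (Ideal.Quotient.mk _) Ideal.Quotient.mk_surjective
    obtain ⟨a, ha⟩ := Ideal.mem_span_range_iff_exists_fun.mp (hb ▸ hx)
    obtain ⟨i, hi⟩ : ∃ i, IsUnit (a i) := by
      by_contra! h
      refine hx2 ?_
      rw [← ha, pow_two]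
      exact Ideal.sum_mem _ fun i _ => Ideal.mul_mem_mul ((mem_maximalIdeal _).mpr (h i))
        (hb ▸ Ideal.subset_span ⟨i, rfl⟩)
    let π := Ideal.Quotient.mk (Ideal.span {x})
    have hmax : maximalIdeal (B ⧸ Ideal.span {x}) = (maximalIdeal B).map π := by
      refine le_antisymm ?_ ?_
      · intro y hy
        obtain ⟨y, rfl⟩ := Ideal.Quotient.mk_surjective y
        refine Ideal.mem_map_of_mem _ ?_
        rw [mem_maximalIdeal] at hy ⊢
        exact fun hu => hy (hu.map π)
      · refine le_maximalIdeal fun h => ?_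
        have h4 := (Ideal.eq_top_iff_one _).mp h
        obtain ⟨y, hy, hy1⟩ := (Ideal.mem_map_iff_of_surjective π
          Ideal.Quotient.mk_surjective).mp h4
        have h5 : y - 1 ∈ Ideal.span {x} := Ideal.Quotient.eq.mp (hy1.trans (map_one π).symm)
        have h6 := (maximalIdeal B).sub_mem hy (hle h5)
        rw [sub_sub_cancel] at h6
        exact (maximalIdeal.isMaximal B).ne_top ((Ideal.eq_top_iff_one _).mpr h6)
    have hdom := ih (B ⧸ Ideal.span {x}) (fun j => π (b (i.succAbove j))) (by
      rw [hmax]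
      refine le_antisymm ?_ ?_
      · rw [hb, Ideal.map_span, Ideal.span_le]
        rintro _ ⟨_, ⟨j, rfl⟩, rfl⟩
        refine Fin.succAboveCases i ?_ (fun j => Ideal.subset_span ⟨j, rfl⟩) j
        have h7 : a i * b i + ∑ j, a (i.succAbove j) * b (i.succAbove j) = x := by
          rw [← ha, Fin.sum_univ_succAbove _ i]
        have h8 : π (a i) * π (b i) = - ∑ j, π (a (i.succAbove j)) * π (b (i.succAbove j)) := by
          have := congrArg π h7
          have hx0 : π x = 0 := Ideal.Quotient.eq_zero_iff_mem.mpr (Ideal.mem_span_singleton_self x)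
          rw [hx0, map_add, map_mul, map_sum] at this
          simp only [map_mul] at this
          exact eq_neg_of_add_eq_zero_left this
        have h9 := hi.map π
        refine (Ideal.unit_mul_mem_iff_mem _ h9).mp ?_
        rw [h8]
        exact neg_mem (Ideal.sum_mem _ fun j _ => Ideal.mul_mem_left _ _ (Ideal.subset_span ⟨j, rfl⟩))
      · rw [Ideal.span_le]
        rintro _ ⟨j, rfl⟩
        exact Ideal.mem_map_of_mem _ (hb ▸ Ideal.subset_span ⟨_, rfl⟩)) (by
      have h1 := ringKrullDim_le_ringKrullDim_quotient_add_encard ({x} : Set B) (by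
        simpa [IsLocalRing.ringJacobson_eq_maximalIdeal] using hx)
      have h2 := hdim.trans h1
      simp only [Set.encard_singleton] at h2
      push_cast at h2
      cases hB : ringKrullDim (B ⧸ Ideal.span {x}) with
      | bot => exact absurd hB (ringKrullDim_ne_bot)
      | coe d =>
        rw [hB] at h2
        have h3 : ((e : ℕ∞) + 1) ≤ d + 1 := by exact_mod_cast h2
        exact_mod_cast (ENat.add_le_add_iff_right (by simp)).mp h3)
    have hprime : (Ideal.span {x}).IsPrime := (Ideal.Quotient.isDomain_iff_prime _).mp hdom
    obtain ⟨p, hp, hple⟩ := Ideal.exists_minimalPrimes_le (bot_le : ⊥ ≤ Ideal.span {x})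
    have hpp : p.IsPrime := hp.1.1
    have hp0 : p = ⊥ := by
      refine Submodule.eq_bot_of_le_smul_of_le_jacobson_bot (maximalIdeal B) _
        (IsNoetherian.noetherian _) ?_ (jacobson_eq_maximalIdeal ⊥ bot_ne_top).ge
      intro y hy
      obtain ⟨r, rfl⟩ := Ideal.mem_span_singleton'.mp (hple hy)
      have := (hpp.mem_or_mem hy).resolve_right (hxm p hp)
      rw [mul_comm]
      exact Submodule.smul_mem_smul hx this
    have : (⊥ : Ideal B).IsPrime := hp0 ▸ hpp
    exact IsDomain.of_bot_isPrime B

/-- The maximal ideal of a point. -/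
def mz {n : ℕ} (z : Fin n → ℂ) : Ideal (MvPolynomial (Fin n) ℂ) := RingHom.ker (eval z)

theorem mem_mz {n : ℕ} {z : Fin n → ℂ} {p} : p ∈ mz z ↔ eval z p = 0 := Iff.rfl

instance {n : ℕ} (z : Fin n → ℂ) : (mz z).IsMaximal :=
  RingHom.ker_isMaximal_of_surjective _ fun a => ⟨C a, eval_C a⟩

theorem exists_eq_mz {n : ℕ} (M : Ideal (MvPolynomial (Fin n) ℂ)) (hM : M.IsMaximal) :
    ∃ z, M = mz z := by
  obtain ⟨z, hz⟩ := MvPolynomial.isMaximal_iff_eq_vanishingIdeal_singleton.mp hM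
  refine ⟨z, ?_⟩
  rw [hz]
  ext p
  simp [mem_vanishingIdeal_iff, mem_mz, aeval_eq_eval]

/-- Translation of variables. -/
def translate {n : ℕ} (a : Fin n → ℂ) : MvPolynomial (Fin n) ℂ ≃ₐ[ℂ] MvPolynomial (Fin n) ℂ :=
  AlgEquiv.ofAlgHom (aeval fun l => X l + C (a l)) (aeval fun l => X l - C (a l))
    (by ext l; simp [MvPolynomial.algebraMap_eq]) (by ext l; simp [MvPolynomial.algebraMap_eq])

theorem eval_translate {n : ℕ} (a z : Fin n → ℂ) (p) :
    eval z (translate a p) = eval (z + a) p := by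
  change eval z (aeval (fun l => X l + C (a l)) p) = _
  rw [aeval_def, MvPolynomial.algebraMap_eq, ← coe_eval₂Hom, ← RingHom.comp_apply]
  congr 1
  refine MvPolynomial.ringHom_ext (by simp) (by simp)

theorem height_mz {n : ℕ} (z : Fin n → ℂ) : (mz z).height = n := by
  have hd : ringKrullDim (MvPolynomial (Fin n) ℂ) = n := by
    rw [MvPolynomial.ringKrullDim_of_isNoetherianRing, ringKrullDim_eq_zero_of_field]
    simp
  have : FiniteRingKrullDim (MvPolynomial (Fin n) ℂ) := by
    refine finiteRingKrullDim_iff_ne_bot_and_top.mpr ⟨by simp [hd], ?_⟩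
    rw [hd]
    intro h
    exact ENat.coe_ne_top n (WithBot.coe_injective h)
  obtain ⟨M, hM, hMh⟩ := Ideal.exists_isMaximal_height (R := MvPolynomial (Fin n) ℂ)
  obtain ⟨z', rfl⟩ := exists_eq_mz M hM
  have h1 : (mz z').comap (translate (z - z')).toRingEquiv = mz z := by
    ext p
    change eval z' (translate (z - z') p) = 0 ↔ eval z p = 0
    rw [eval_translate, add_sub_cancel]
  rw [← RingEquiv.height_comap (translate (z - z')).toRingEquiv, h1, hd] at hMh
  exact_mod_cast hMh

end

section

/-- The gradient of a polynomial at a point. -/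
def grad {n : ℕ} (z : Fin n → ℂ) : MvPolynomial (Fin n) ℂ →ₗ[ℂ] (Fin n → ℂ) where
  toFun p l := eval z (pderiv l p)
  map_add' p r := by ext l; simp
  map_smul' a p := by ext l; simp [smul_eval]

theorem grad_apply {n : ℕ} (z : Fin n → ℂ) (p : MvPolynomial (Fin n) ℂ) (l : Fin n) :
    grad z p l = eval z (pderiv l p) := rfl

theorem grad_mul {n : ℕ} (z : Fin n → ℂ) (p r : MvPolynomial (Fin n) ℂ) :
    grad z (p * r) = eval z p • grad z r + eval z r • grad z p := by
  ext l
  simp [grad_apply, Derivation.leibniz]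

/-- Elements lying in an ideal locally at a point. -/
def locIdeal {n : ℕ} (z : Fin n → ℂ) (J : Ideal (MvPolynomial (Fin n) ℂ)) :
    Ideal (MvPolynomial (Fin n) ℂ) where
  carrier := {p | ∃ g, eval z g ≠ 0 ∧ g * p ∈ J}
  zero_mem' := ⟨1, by simp, by simp⟩
  add_mem' := by
    rintro p r ⟨g, hg, hgp⟩ ⟨h, hh, hhr⟩
    refine ⟨g * h, by simp [hg, hh], ?_⟩
    have : g * h * (p + r) = h * (g * p) + g * (h * r) := by ring
    rw [this]
    exact J.add_mem (J.mul_mem_left _ hgp) (J.mul_mem_left _ hhr)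
  smul_mem' := by
    rintro a p ⟨g, hg, hgp⟩
    refine ⟨g, hg, ?_⟩
    have : g * (a • p) = a * (g * p) := by rw [smul_eq_mul]; ring
    rw [this]
    exact J.mul_mem_left _ hgp

section
variable {n : ℕ} {z : Fin n → ℂ} {J Q : Ideal (MvPolynomial (Fin n) ℂ)}
  {p : MvPolynomial (Fin n) ℂ}

theorem le_locIdeal : J ≤ locIdeal z J := fun p hp => ⟨1, by simp, by simpa⟩

theorem locIdeal_mono (h : J ≤ Q) : locIdeal z J ≤ locIdeal z Q :=
  fun _ ⟨g, hg, hgp⟩ => ⟨g, hg, h hgp⟩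

theorem locIdeal_le_of_prime (hQ : Q.IsPrime) (h : J ≤ Q) (hz : Q ≤ mz z) : locIdeal z J ≤ Q := by
  rintro p ⟨g, hg, hgp⟩
  exact (hQ.mem_or_mem (h hgp)).resolve_left fun h => hg (hz h)

theorem locIdeal_le_mz (h : J ≤ mz z) : locIdeal z J ≤ mz z :=
  locIdeal_le_of_prime inferInstance h le_rfl

theorem locIdeal_eq_comap : locIdeal z J =
    (J.map (algebraMap _ (Localization.AtPrime (mz z)))).comap (algebraMap _ _) := by
  ext p
  rw [Ideal.mem_comap, IsLocalization.algebraMap_mem_map_algebraMap_iff (mz z).primeCompl]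
  rfl

/-- The gradient of an element locally in `(p)` is a combination of the gradients of the `p i`. -/
theorem grad_mem_of_mem_locIdeal {ι : Type*} [Finite ι] {p : ι → MvPolynomial (Fin n) ℂ}
    (hp : ∀ i, eval z (p i) = 0) {r} (hr : r ∈ locIdeal z (Ideal.span (Set.range p))) :
    grad z r ∈ Submodule.span ℂ (Set.range fun i => grad z (p i)) := by
  have := Fintype.ofFinite ι
  have hr0 : eval z r = 0 := by
    refine locIdeal_le_mz ?_ hr
    rw [Ideal.span_le]
    rintro _ ⟨i, rfl⟩
    exact hp i
  obtain ⟨g, hg, hgr⟩ := hr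
  obtain ⟨a, ha⟩ := Ideal.mem_span_range_iff_exists_fun.mp hgr
  have h1 := congrArg (grad z) ha
  rw [map_sum, grad_mul, hr0, zero_smul, add_zero] at h1
  have h2 : grad z r = (eval z g)⁻¹ • ∑ i, eval z (a i) • grad z (p i) := by
    rw [eq_inv_smul_iff₀ hg, ← h1]
    refine Finset.sum_congr rfl fun i _ => ?_
    rw [grad_mul, hp i, zero_smul, add_zero]
  rw [h2]
  exact Submodule.smul_mem _ _ (Submodule.sum_mem _ fun i _ => Submodule.smul_mem _ _
    (Submodule.subset_span ⟨i, rfl⟩))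

theorem grad_linear (ψ : Fin n → ℂ) (z : Fin n → ℂ) :
    grad z (∑ l, C (ψ l) * (X l - C (z l))) = ψ := by
  classical
  ext l
  simp [grad_apply, map_sum, Derivation.leibniz, pderiv_X, Pi.single_apply, apply_ite]

/-- Functions with independent differentials at a point generate a prime ideal near this point. -/
theorem locIdeal_isPrime {ρ : ℕ} (p : Fin ρ → MvPolynomial (Fin n) ℂ)
    (hp : ∀ i, eval z (p i) = 0) (hd : LinearIndependent ℂ fun i => grad z (p i)) :
    (locIdeal z (Ideal.span (Set.range p))).IsPrime := by
  classical
  obtain ⟨N, hN⟩ := Submodule.exists_isCompl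
    (Submodule.span ℂ (Set.range fun i => grad z (p i)))
  have hfr := Submodule.finrank_add_eq_of_isCompl hN
  rw [finrank_span_eq_card hd, Fintype.card_fin, finrank_fin_fun] at hfr
  let ψ := finBasis ℂ N
  set e := finrank ℂ N with he
  let L : Fin e → MvPolynomial (Fin n) ℂ := fun j => ∑ l, C ((ψ j : Fin n → ℂ) l) * (X l - C (z l))
  have hL0 : ∀ j, eval z (L j) = 0 := fun j => by simp [L]
  have hLg : ∀ j, grad z (L j) = ψ j := fun j => grad_linear _ _
  obtain ⟨g, hg, hgm⟩ := local_nakayama (mz z) (mz z)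
      (Ideal.span (Set.range p) ⊔ Ideal.span (Set.range L)) (by
    intro x hx
    have h1 : grad z x ∈ Submodule.span ℂ (Set.range fun i => grad z (p i)) ⊔ N := by
      rw [hN.sup_eq_top]; trivial
    obtain ⟨y, hy, w, hw, hyw⟩ := Submodule.mem_sup.mp h1
    obtain ⟨a, ha⟩ := Submodule.mem_span_range_iff_exists_fun ℂ |>.mp hy
    have hb := ψ.sum_repr ⟨w, hw⟩
    set b := ψ.repr ⟨w, hw⟩
    have hb' : ∑ j, b j • (ψ j : Fin n → ℂ) = w := by
      have := congrArg (Subtype.val) hb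
      simpa using this
    let x' := x - ((∑ i, a i • p i) + ∑ j, b j • L j)
    have hx' : x' ∈ mz z := by
      rw [mem_mz] at hx ⊢
      simp [x', hx, hp, hL0, smul_eval]
    have hgx' : grad z x' = 0 := by
      simp only [x', map_sub, map_add, map_sum, map_smul, hLg, ha, hb', hyw, sub_self]
    obtain ⟨g, hg, hgx⟩ := mem_sq_of_pderiv_mem (mz z) x' hx' fun l => congrFun hgx' l
    refine ⟨g, hg, ?_⟩
    have h2 : g * x = g * ((∑ i, a i • p i) + ∑ j, b j • L j) + g * x' := by
      simp only [x']; ring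
    rw [h2]
    refine add_mem (Ideal.mul_mem_left _ _ (Ideal.mem_sup_left ?_)) (Ideal.mem_sup_right hgx)
    refine add_mem (Ideal.mem_sup_left ?_) (Ideal.mem_sup_right ?_)
    · exact sum_mem fun i _ => Submodule.smul_of_tower_mem _ _ (Ideal.subset_span ⟨i, rfl⟩)
    · exact sum_mem fun i _ => Submodule.smul_of_tower_mem _ _ (Ideal.subset_span ⟨i, rfl⟩))
  let R := Localization.AtPrime (mz z)
  let ι := algebraMap (MvPolynomial (Fin n) ℂ) R
  let s : Set R := Set.range fun i => ι (p i)
  have hs : (Ideal.span (Set.range p)).map ι = Ideal.span s := by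
    rw [Ideal.map_span, ← Set.range_comp]; rfl
  have hmax : (mz z).map ι = IsLocalRing.maximalIdeal R := Localization.AtPrime.map_eq_maximalIdeal
  have hsle : Ideal.span s ≤ IsLocalRing.maximalIdeal R := by
    rw [← hs, ← hmax]
    refine Ideal.map_mono ?_
    rw [Ideal.span_le]
    rintro _ ⟨i, rfl⟩
    exact hp i
  have hnt : Nontrivial (R ⧸ Ideal.span s) :=
    Ideal.Quotient.nontrivial_iff.mpr (fun h => (IsLocalRing.maximalIdeal.isMaximal R).ne_top
      (top_le_iff.mp (h ▸ hsle)))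
  have hloc : IsLocalRing (R ⧸ Ideal.span s) :=
    IsLocalRing.of_surjective' (Ideal.Quotient.mk _) Ideal.Quotient.mk_surjective
  let π := Ideal.Quotient.mk (Ideal.span s)
  have hdom := isDomain_of_generators e (R ⧸ Ideal.span s) (fun j => π (ι (L j))) (by
      refine le_antisymm ?_ ?_
      · intro y hy
        obtain ⟨y, rfl⟩ := Ideal.Quotient.mk_surjective y
        have hy' : y ∈ (mz z).map ι := by
          rw [hmax, IsLocalRing.mem_maximalIdeal]
          exact fun hu => (IsLocalRing.mem_maximalIdeal _).mp hy (hu.map _)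
        have h3 : (mz z).map ι ≤ Ideal.span s ⊔ (Ideal.span (Set.range L)).map ι := by
          rw [← hs, ← Ideal.map_sup, Ideal.map_le_iff_le_comap]
          intro x hx
          refine (IsLocalization.algebraMap_mem_map_algebraMap_iff (mz z).primeCompl R _ x).mpr
            ⟨g, hg, hgm x hx⟩
        have h4 := Ideal.mem_map_of_mem π (h3 hy')
        rw [Ideal.map_sup, Ideal.map_quotient_self, bot_sup_eq, Ideal.map_map, Ideal.map_span,
          ← Set.range_comp] at h4
        exact h4
      · rw [Ideal.span_le]
        rintro _ ⟨j, rfl⟩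
        refine (IsLocalRing.mem_maximalIdeal _).mpr fun hu => ?_
        have hm : ι (L j) ∈ IsLocalRing.maximalIdeal R := by
          rw [← hmax]
          exact Ideal.mem_map_of_mem _ (hL0 j)
        obtain ⟨y, hy⟩ := Ideal.Quotient.mk_surjective (hu.unit⁻¹ : (R ⧸ Ideal.span s)ˣ).val
        have h5 : π (ι (L j)) * π y = π 1 := by
          rw [hy, map_one]
          exact hu.mul_val_inv
        rw [← map_mul] at h5
        have h6 := hsle (Ideal.Quotient.eq.mp h5)
        have h7 := sub_mem (Ideal.mul_mem_right y _ hm) h6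
        rw [sub_sub_cancel] at h7
        exact (IsLocalRing.maximalIdeal.isMaximal R).ne_top ((Ideal.eq_top_iff_one _).mpr h7)) (by
      have h1 := ringKrullDim_le_ringKrullDim_quotient_add_encard s (by
        rw [IsLocalRing.ringJacobson_eq_maximalIdeal]
        exact (Ideal.subset_span).trans hsle)
      rw [IsLocalization.AtPrime.ringKrullDim_eq_height (mz z), height_mz] at h1
      have h2 : s.encard ≤ ρ := by
        have := Set.encard_image_le (fun i => ι (p i)) (Set.univ : Set (Fin ρ))
        simpa [s, Set.image_univ] using this
      cases hB : ringKrullDim (R ⧸ Ideal.span s) with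
      | bot => exact absurd (hB ▸ ringKrullDim_nonneg_of_nontrivial) (by simp)
      | coe d =>
        rw [hB] at h1
        have h3 : (n : ℕ∞) ≤ d + ρ := (by exact_mod_cast h1 : (n : ℕ∞) ≤ d + s.encard).trans (by gcongr)
        rw [← hfr, add_comm d] at h3
        push_cast at h3
        exact_mod_cast (ENat.add_le_add_iff_left (by simp)).mp h3)
  have hprime : (Ideal.span s).IsPrime := (Ideal.Quotient.isDomain_iff_prime _).mp hdom
  rw [locIdeal_eq_comap]
  have : (Ideal.map (algebraMap (MvPolynomial (Fin n) ℂ) R) (Ideal.span (Set.range p))).IsPrime := by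
    rw [← hs] at hprime; exact hprime
  exact Ideal.IsPrime.comap _

/-- A prime ideal containing `ρ` functions with independent differentials at one of its zeros has
height at least `ρ`. -/
theorem le_height {ρ : ℕ} (p : Fin ρ → MvPolynomial (Fin n) ℂ)
    (hd : LinearIndependent ℂ fun i => grad z (p i)) (hQ : Q.IsPrime) (hpQ : ∀ i, p i ∈ Q)
    (hz : Q ≤ mz z) : (ρ : ℕ∞) ≤ Q.height := by
  have h1 : ∀ i, eval z (p i) = 0 := fun i => hz (hpQ i)
  have h2 := locIdeal_isPrime p h1 hd
  have h3 : locIdeal z (Ideal.span (Set.range p)) ≤ Q :=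
    locIdeal_le_of_prime hQ (Ideal.span_le.mpr (by rintro _ ⟨i, rfl⟩; exact hpQ i)) hz
  refine le_trans ?_ (Ideal.height_mono h3)
  clear hpQ h3
  induction ρ with
  | zero => simp
  | succ ρ ih =>
    have hd' : LinearIndependent ℂ fun i : Fin ρ => grad z (p i.castSucc) :=
      hd.comp _ (Fin.castSucc_injective ρ)
    have h4 := locIdeal_isPrime (fun i => p i.castSucc) (fun i => h1 _) hd'
    have h5 := ih _ hd' (fun i => h1 _) h4
    have h6 : locIdeal z (Ideal.span (Set.range fun i : Fin ρ => p i.castSucc)) <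
        locIdeal z (Ideal.span (Set.range p)) := by
      refine lt_of_le_of_ne (locIdeal_mono (Ideal.span_mono ?_)) fun h => ?_
      · rintro _ ⟨i, rfl⟩
        exact ⟨_, rfl⟩
      · have h7 : p (Fin.last ρ) ∈ locIdeal z (Ideal.span (Set.range p)) :=
          le_locIdeal (Ideal.subset_span ⟨_, rfl⟩)
        rw [← h] at h7
        have h8 := grad_mem_of_mem_locIdeal (p := fun i : Fin ρ => p i.castSucc) (fun i => h1 _) h7
        have h9 := hd.notMem_span_image (s := Set.range Fin.castSucc) (x := Fin.last ρ) (by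
          rintro ⟨i, hi⟩
          exact (Fin.castSucc_lt_last i).ne hi)
        rw [← Set.range_comp] at h9
        exact h9 h8
    have := Ideal.height_add_one_le_of_lt_of_isPrime h6
    push_cast
    exact le_trans (by gcongr) this

end

end

section

section homog
variable {n : ℕ} {Q : Ideal (MvPolynomial (Fin n) ℂ)}
attribute [local instance] MvPolynomial.gradedAlgebra

/-- Homogeneous ideals. -/
def IsHomog (Q : Ideal (MvPolynomial (Fin n) ℂ)) : Prop :=
  ∀ p ∈ Q, ∀ i, homogeneousComponent i p ∈ Q

/-- The largest homogeneous ideal contained in an ideal. -/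
def hcore (Q : Ideal (MvPolynomial (Fin n) ℂ)) : Ideal (MvPolynomial (Fin n) ℂ) :=
  (Q.homogeneousCore (homogeneousSubmodule (Fin n) ℂ)).toIdeal

theorem hcore_le : hcore Q ≤ Q := Ideal.toIdeal_homogeneousCore_le _ _

theorem mem_hcore {p : MvPolynomial (Fin n) ℂ} {d : ℕ} (hd : p.IsHomogeneous d) (hp : p ∈ Q) :
    p ∈ hcore Q :=
  Ideal.mem_homogeneousCore_of_homogeneous_of_mem ⟨d, hd⟩ hp

theorem isHomog_hcore : IsHomog (hcore Q) := fun p hp i =>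
  homogeneousComponent_mem_of_mem (Q.homogeneousCore (homogeneousSubmodule (Fin n) ℂ)).isHomogeneous
    hp i

theorem hcore_isPrime (hQ : Q.IsPrime) : (hcore Q).IsPrime := Ideal.IsPrime.homogeneousCore hQ

theorem mem_of_homogeneousComponent {p : MvPolynomial (Fin n) ℂ}
    (h : ∀ i, homogeneousComponent i p ∈ Q) : p ∈ Q := by
  rw [← sum_homogeneousComponent p]
  exact sum_mem fun i _ => h i

theorem IsHomog.le_hcore {J : Ideal (MvPolynomial (Fin n) ℂ)} (hJ : IsHomog J) (h : J ≤ Q) :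
    J ≤ hcore Q := fun p hp => mem_of_homogeneousComponent fun i =>
  mem_hcore (homogeneousComponent_isHomogeneous i p) (h (hJ p hp i))

theorem IsHomog.of_le_hcore (h : Q ≤ hcore Q) : IsHomog Q := by
  have : Q = hcore Q := le_antisymm h hcore_le
  rw [this]
  exact isHomog_hcore

theorem eval_smul_of_isHomogeneous {p : MvPolynomial (Fin n) ℂ} {d : ℕ} (hd : p.IsHomogeneous d)
    (t : ℂ) (z : Fin n → ℂ) : eval (t • z) p = t ^ d * eval z p := by
  rw [eval_eq, eval_eq, Finset.mul_sum]
  refine Finset.sum_congr rfl fun e he => ?_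
  have h1 := hd.degree_eq_sum_deg_support he
  rw [h1, ← Finset.prod_pow_eq_pow_sum]
  have h2 : ∏ i ∈ e.support, t ^ e i = ∏ i : Fin n, t ^ e i := by
    refine Finset.prod_subset (Finset.subset_univ _) fun i _ hi => ?_
    simp [Finsupp.notMem_support_iff.mp hi]
  have h3 : ∀ y : Fin n → ℂ, ∏ i ∈ e.support, y i ^ e i = ∏ i : Fin n, y i ^ e i := fun y => by
    refine Finset.prod_subset (Finset.subset_univ _) fun i _ hi => ?_
    simp [Finsupp.notMem_support_iff.mp hi]
  rw [h2]
  simp only [h3, Pi.smul_apply, smul_eq_mul, mul_pow, Finset.prod_mul_distrib]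
  ring

theorem IsHomog.le_mz_smul (h : IsHomog Q) {z : Fin n → ℂ} (hz : Q ≤ mz z) (t : ℂ) :
    Q ≤ mz (t • z) := by
  intro p hp
  rw [mem_mz, ← sum_homogeneousComponent p, map_sum]
  refine Finset.sum_eq_zero fun i _ => ?_
  rw [eval_smul_of_isHomogeneous (homogeneousComponent_isHomogeneous i p),
    mem_mz.mp (hz (h p hp i)), mul_zero]

theorem homogeneousComponent_mul_left {a p : MvPolynomial (Fin n) ℂ} {d : ℕ}
    (ha : a.IsHomogeneous d) (e : ℕ) :
    homogeneousComponent (d + e) (a * p) = a * homogeneousComponent e p := by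
  conv_lhs => rw [← sum_homogeneousComponent p, Finset.mul_sum, map_sum]
  have h1 : ∀ i, homogeneousComponent (d + e) (a * homogeneousComponent i p) =
      if i = e then a * homogeneousComponent i p else 0 := fun i => by
    rw [homogeneousComponent_of_mem (ha.mul (homogeneousComponent_isHomogeneous i p))]
    simp [eq_comm]
  simp only [h1]
  rw [Finset.sum_ite_eq']
  split_ifs with h
  · rfl
  · rw [homogeneousComponent_eq_zero, mul_zero]
    simpa [Nat.lt_succ_iff] using h

theorem idealOfVars_eq : idealOfVars (Fin n) ℂ = mz 0 := by
  refine le_antisymm ?_ ?_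
  · rw [idealOfVars, Ideal.span_le]
    rintro _ ⟨i, rfl⟩
    simp [mem_mz]
  · intro p hp
    have h := (mem_pow_idealOfVars_iff' (σ := Fin n) (R := ℂ) 1 p).mpr (by
      intro x hx
      have hx0 : x = 0 := by
        rw [Nat.lt_one_iff] at hx
        exact (Finsupp.degree_eq_zero_iff x).mp hx
      rw [hx0]
      have := mem_mz.mp hp
      simpa [MvPolynomial.eval_zero, constantCoeff_eq] using this)
    rwa [pow_one] at h

/-- An ideal without nonzero zeros contains all homogeneous polynomials of large degree. -/
theorem exists_degree_le (h : ∀ v, v ≠ 0 → ¬ Q ≤ mz v) :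
    ∃ M, ∀ d, M ≤ d → ∀ p : MvPolynomial (Fin n) ℂ, p.IsHomogeneous d → p ∈ Q := by
  have h1 : mz 0 ≤ Q.radical := by
    rw [Ideal.radical_eq_jacobson, Ideal.jacobson]
    refine le_sInf fun M hM => ?_
    obtain ⟨v, rfl⟩ := exists_eq_mz M hM.2
    rcases eq_or_ne v 0 with rfl | hv
    · exact le_rfl
    · exact absurd hM.1 (h v hv)
  obtain ⟨M, hM⟩ := Ideal.exists_pow_le_of_le_radical_of_fg h1 (IsNoetherian.noetherian _)
  refine ⟨M, fun d hd p hp => hM ?_⟩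
  rw [← idealOfVars_eq, mem_pow_idealOfVars_iff']
  intro x hx
  exact hp.coeff_eq_zero (hx.trans_le hd).ne

theorem IsHomogeneous_span_isHomog {ι : Type*} (F : ι → MvPolynomial (Fin n) ℂ)
    (hF : ∀ i, ∃ d, (F i).IsHomogeneous d) (hQ : Ideal.span (Set.range F) ≤ Q) :
    Ideal.span (Set.range F) ≤ hcore Q := by
  rw [Ideal.span_le]
  rintro _ ⟨i, rfl⟩
  obtain ⟨d, hd⟩ := hF i
  exact mem_hcore hd (hQ (Ideal.subset_span ⟨i, rfl⟩))

/-- The height of a prime that is minimal over an ideal with `e` generators. -/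
theorem height_le_of_minimal {ι : Type*} [Fintype ι] (F : ι → MvPolynomial (Fin n) ℂ)
    (hQ : Q ∈ (Ideal.span (Set.range F)).minimalPrimes) : Q.height ≤ Fintype.card ι := by
  refine (Ideal.height_le_card_of_mem_minimalPrimes_span (Set.finite_range F) hQ).trans ?_
  have : (Set.range F).ncard ≤ Fintype.card ι := by
    rw [← Set.image_univ]
    exact (Set.ncard_image_le).trans (by simp [Set.ncard_univ])
  exact_mod_cast this

end homog

end

section

/-- A system of quadratic forms such that every member singular at a common zero lies, near this
zero, in the product of the maximal ideal and the ideal of the system. -/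
structure LocSystem (n c : ℕ) where
  f : Fin c → MvPolynomial (Fin n) ℂ
  β : Fin c → (Fin n → ℂ) →ₗ[ℂ] (Fin n → ℂ) →ₗ[ℂ] ℂ
  hom : ∀ s, (f s).IsHomogeneous 2
  symm : ∀ s z w, β s z w = β s w z
  two_eval : ∀ s z, 2 * eval z (f s) = β s z z
  dif_eq : ∀ s z w, dif (f s) z w = β s z w
  loc : ∀ z, z ≠ 0 → (∀ s, eval z (f s) = 0) → ∀ a : Fin c → ℂ,
    (∀ w, ∑ s, a s * β s z w = 0) → ∃ (g : MvPolynomial (Fin n) ℂ)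
      (h : Fin c → MvPolynomial (Fin n) ℂ), eval z g ≠ 0 ∧ (∀ s, eval z (h s) = 0) ∧
      g * ∑ s, C (a s) * f s = ∑ s, h s * f s

namespace LocSystem

variable {n c : ℕ} (D : LocSystem n c)

/-- The ideal generated by the system. -/
def J : Ideal (MvPolynomial (Fin n) ℂ) := Ideal.span (Set.range D.f)

/-- The local ideal of the system at a point. -/
def pp (z : Fin n → ℂ) : Ideal (MvPolynomial (Fin n) ℂ) := locIdeal z D.J

/-- The number of independent differentials at a point. -/
def rk (z : Fin n → ℂ) : ℕ :=
  finrank ℂ (Submodule.span ℂ (Set.range fun s => grad z (D.f s)))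

variable {D} {z z' : Fin n → ℂ}

theorem J_le_iff {Q : Ideal (MvPolynomial (Fin n) ℂ)} : D.J ≤ Q ↔ ∀ s, D.f s ∈ Q := by
  rw [J, Ideal.span_le]
  exact ⟨fun h s => h ⟨s, rfl⟩, by rintro h _ ⟨s, rfl⟩; exact h s⟩

theorem sum_grad (s : Fin c) (z w : Fin n → ℂ) : ∑ l, grad z (D.f s) l * w l = D.β s z w :=
  D.dif_eq s z w

theorem exists_gens (hz : z ≠ 0) (hV : D.J ≤ mz z) : ∃ I : Fin (D.rk z) → Fin c,
    LinearIndependent ℂ (fun i => grad z (D.f (I i))) ∧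
    D.pp z = locIdeal z (Ideal.span (Set.range fun i => D.f (I i))) := by
  obtain ⟨I, hI, hs⟩ := exists_fin_subfamily (fun s => grad z (D.f s)) (D.rk z) rfl
  refine ⟨I, hI, le_antisymm ?_ (locIdeal_mono ?_)⟩
  swap
  · rw [Ideal.span_le]
    rintro _ ⟨i, rfl⟩
    exact Ideal.subset_span ⟨_, rfl⟩
  have hV' := J_le_iff.mp hV
  obtain ⟨g, hg, hgJ⟩ := local_nakayama (mz z) D.J
      (Ideal.span (Set.range fun i => D.f (I i))) (by
    change D.J ≤ locIdeal z (Ideal.span (Set.range fun i => D.f (I i)) ⊔ mz z * D.J)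
    rw [J_le_iff]
    intro s
    have h1 : grad z (D.f s) ∈ Submodule.span ℂ (Set.range ((fun s => grad z (D.f s)) ∘ I)) := by
      rw [hs]
      exact Submodule.subset_span ⟨s, rfl⟩
    obtain ⟨r, hr⟩ := Submodule.mem_span_range_iff_exists_fun ℂ |>.mp h1
    classical
    let a : Fin c → ℂ := fun t => (if t = s then 1 else 0) - ∑ i, if t = I i then r i else 0
    have ha : ∀ {M : Type} [AddCommGroup M] [Module ℂ M] (u : Fin c → M),
        ∑ t, a t • u t = u s - ∑ i, r i • u (I i) := by
      intro M _ _ u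
      simp only [a, sub_smul, Finset.sum_sub_distrib, ite_smul, one_smul, zero_smul,
        Finset.sum_ite_eq', Finset.mem_univ, if_true, Finset.sum_smul]
      rw [Finset.sum_comm]
      simp
    obtain ⟨g, h, hg, hh, he⟩ := D.loc z hz hV' a (by
      intro w
      have h2 := ha (fun t => D.β t z w)
      simp only [smul_eq_mul] at h2
      rw [h2, ← sum_grad, ← hr]
      simp only [← sum_grad, Finset.sum_apply, Pi.smul_apply, Function.comp, smul_eq_mul,
        Finset.sum_mul, Finset.mul_sum]
      rw [Finset.sum_comm, sub_eq_zero]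
      exact Finset.sum_congr rfl fun _ _ => Finset.sum_congr rfl fun _ _ => by ring)
    refine ⟨g, hg, ?_⟩
    have h3 := ha D.f
    simp only [smul_eq_C_mul] at h3
    have h4 : g * D.f s = ∑ i, g * C (r i) * D.f (I i) + ∑ t, h t * D.f t := by
      rw [← he, h3, mul_sub, Finset.mul_sum]
      simp only [mul_assoc]
      ring
    rw [h4]
    refine add_mem (Ideal.mem_sup_left (sum_mem fun i _ => ?_))
      (Ideal.mem_sup_right (sum_mem fun t _ => ?_))
    · exact Ideal.mul_mem_left _ _ (Ideal.subset_span ⟨i, rfl⟩)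
    · exact Ideal.mul_mem_mul (hh t) (Ideal.subset_span ⟨t, rfl⟩))
  rintro p ⟨g', hg', hp⟩
  refine ⟨g * g', ?_, ?_⟩
  · rw [map_mul]
    exact mul_ne_zero hg hg'
  · rw [mul_assoc]
    exact hgJ _ hp

theorem J_le_pp : D.J ≤ D.pp z := le_locIdeal

theorem pp_le_mz (hV : D.J ≤ mz z) : D.pp z ≤ mz z := locIdeal_le_mz hV

theorem pp_isPrime (hz : z ≠ 0) (hV : D.J ≤ mz z) : (D.pp z).IsPrime := by
  obtain ⟨I, hI, hp⟩ := exists_gens hz hV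
  rw [hp]
  exact locIdeal_isPrime _ (fun i => J_le_iff.mp hV _) hI

theorem pp_le {Q : Ideal (MvPolynomial (Fin n) ℂ)} (hQ : Q.IsPrime) (hJ : D.J ≤ Q)
    (h : Q ≤ mz z) : D.pp z ≤ Q := locIdeal_le_of_prime hQ hJ h

theorem height_pp (hz : z ≠ 0) (hV : D.J ≤ mz z) : (D.pp z).height = D.rk z := by
  have hpr := pp_isPrime hz hV
  obtain ⟨I, hI, hp⟩ := exists_gens hz hV
  refine le_antisymm ?_ ?_
  · have := height_le_of_minimal (fun i => D.f (I i)) (Q := D.pp z) (by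
      refine ⟨⟨hpr, hp ▸ le_locIdeal⟩, ?_⟩
      rintro q ⟨hq, hle⟩ hq2
      rw [hp]
      exact locIdeal_le_of_prime hq hle (hq2.trans (pp_le_mz hV)))
    simpa using this
  · exact le_height _ hI hpr (fun i => J_le_pp (J_le_iff.mp le_rfl _)) (pp_le_mz hV)

theorem J_le_hcore {Q : Ideal (MvPolynomial (Fin n) ℂ)} (h : D.J ≤ Q) : D.J ≤ hcore Q :=
  IsHomogeneous_span_isHomog _ (fun s => ⟨2, D.hom s⟩) h

theorem isHomog_pp (hz : z ≠ 0) (hV : D.J ≤ mz z) : IsHomog (D.pp z) :=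
  IsHomog.of_le_hcore (pp_le (hcore_isPrime (pp_isPrime hz hV)) (J_le_hcore J_le_pp)
    (hcore_le.trans (pp_le_mz hV)))

theorem pp_eq (hz : z ≠ 0) (hV : D.J ≤ mz z) (hz' : z' ≠ 0) (h : D.pp z ≤ mz z') :
    D.pp z' = D.pp z := by
  have h1 : D.pp z' ≤ D.pp z := pp_le (pp_isPrime hz hV) J_le_pp h
  exact le_antisymm h1 (pp_le (pp_isPrime hz' (J_le_pp.trans h)) J_le_pp (h1.trans (pp_le_mz hV)))

theorem rk_eq (hz : z ≠ 0) (hV : D.J ≤ mz z) (hz' : z' ≠ 0) (h : D.pp z ≤ mz z') :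
    D.rk z' = D.rk z := by
  have := height_pp hz' (J_le_pp.trans h)
  rw [pp_eq hz hV hz' h, height_pp hz hV] at this
  exact_mod_cast this.symm

end LocSystem

end

section

/-- The linear form with given coefficients. -/
def lin {n : ℕ} (ψ : Fin n → ℂ) : MvPolynomial (Fin n) ℂ := ∑ l, C (ψ l) * X l

theorem lin_hom {n : ℕ} (ψ : Fin n → ℂ) : (lin ψ).IsHomogeneous 1 :=
  IsHomogeneous.sum _ _ _ fun l _ => isHomogeneous_C_mul_X _ _

theorem eval_lin {n : ℕ} (ψ z : Fin n → ℂ) : eval z (lin ψ) = ∑ l, ψ l * z l := by simp [lin]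

theorem pderiv_lin {n : ℕ} (ψ : Fin n → ℂ) (l : Fin n) : pderiv l (lin ψ) = C (ψ l) := by
  classical
  simp [lin, map_sum, Derivation.leibniz, pderiv_X, Pi.single_apply, apply_ite]

theorem grad_lin {n : ℕ} (ψ z : Fin n → ℂ) : grad z (lin ψ) = ψ := by
  ext l
  simp [grad_apply, pderiv_lin]

/-- A homogeneous prime ideal contains, for each linear form `μ`, an element `μN - kΔ`, if `N/Δ` is
regular of degree `-1` outside of the origin. -/
theorem exists_const {n d M : ℕ} (Q : Ideal (MvPolynomial (Fin n) ℂ)) (hQ : Q.IsPrime)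
    (N Δ : MvPolynomial (Fin n) ℂ) (hΔ : Δ ∉ Q) (z0 : Fin n → ℂ) (hz0 : z0 ≠ 0) (hQz : Q ≤ mz z0)
    (hM : ∀ r : MvPolynomial (Fin n) ℂ, r.IsHomogeneous (M + 1) → ∃ t : MvPolynomial (Fin n) ℂ,
      t.IsHomogeneous M ∧ r * N - Δ * t ∈ Q) (μ : Fin n → ℂ) :
    ∃ k : ℂ, lin μ * N - C k * Δ ∈ Q := by
  have hdom : IsDomain (MvPolynomial (Fin n) ℂ ⧸ Q) := Ideal.Quotient.isDomain Q
  let A := MvPolynomial (Fin n) ℂ ⧸ Q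
  let K := FractionRing A
  let ι : MvPolynomial (Fin n) ℂ →ₐ[ℂ] K := (IsScalarTower.toAlgHom ℂ A K).comp (Ideal.Quotient.mkₐ ℂ Q)
  have hι : ∀ p, ι p = 0 ↔ p ∈ Q := fun p => by
    change algebraMap A K (Ideal.Quotient.mk Q p) = 0 ↔ _
    rw [FaithfulSMul.algebraMap_eq_zero_iff, Ideal.Quotient.eq_zero_iff_mem]
  let U : Submodule ℂ K := (homogeneousSubmodule (Fin n) ℂ (M + 1)).map ι.toLinearMap
  have hfin : FiniteDimensional ℂ U :=
    Module.Finite.iff_fg.mpr ((homogeneousSubmodule_fg (Fin n) ℂ (M + 1)).map _)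
  obtain ⟨l, hl⟩ := Function.ne_iff.mp hz0
  have hnt : Nontrivial U := by
    refine ⟨⟨⟨ι (X l ^ (M + 1)), ⟨_, isHomogeneous_X_pow l (M + 1), rfl⟩⟩, 0, fun h => ?_⟩⟩
    have h1 := (hι _).mp (congrArg Subtype.val h)
    have h2 := hQz h1
    rw [mem_mz] at h2
    simp only [map_pow, eval_X] at h2
    exact hl (pow_eq_zero_iff (by simp) |>.mp h2)
  have hΔ0 : ι Δ ≠ 0 := fun h => hΔ ((hι _).mp h)
  let θ : K := ι (lin μ * N) / ι Δ
  have hθ : ∀ u ∈ U, θ * u ∈ U := by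
    rintro _ ⟨r, hr, rfl⟩
    obtain ⟨t, ht, h1⟩ := hM r hr
    refine ⟨t * lin μ, ht.mul (lin_hom μ), ?_⟩
    have h2 := (hι _).mpr h1
    rw [map_sub, sub_eq_zero, map_mul, map_mul] at h2
    change ι (t * lin μ) = θ * ι r
    simp only [θ, map_mul]
    rw [div_mul_eq_mul_div, eq_div_iff hΔ0]
    linear_combination (-ι (lin μ)) * h2
  let T : U →ₗ[ℂ] U := ((LinearMap.mulLeft ℂ θ).restrict hθ)
  obtain ⟨k, hk⟩ := Module.End.exists_eigenvalue T
  obtain ⟨u, hu⟩ := hk.exists_hasEigenvector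
  have h3 : θ * (u : K) = k • (u : K) := congrArg Subtype.val hu.apply_eq_smul
  have hu0 : (u : K) ≠ 0 := fun h => hu.2 (Subtype.ext h)
  rw [Algebra.smul_def] at h3
  have h4 := mul_right_cancel₀ hu0 h3
  refine ⟨k, (hι _).mp ?_⟩
  rw [map_sub, sub_eq_zero, map_mul (f := ι) (C k)]
  rw [div_eq_iff hΔ0] at h4
  rw [h4]
  rfl

theorem det_hom {n d : ℕ} (A : Matrix (Fin d) (Fin d) (MvPolynomial (Fin n) ℂ))
    (h : ∀ i j, (A i j).IsHomogeneous 1) : A.det.IsHomogeneous d := by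
  rw [Matrix.det_apply]
  refine IsHomogeneous.sum _ _ _ fun σ _ => ?_
  have h1 : (∏ i, A (σ i) i).IsHomogeneous d := by
    have := IsHomogeneous.prod Finset.univ (fun i => A (σ i) i) (fun _ => 1) fun i _ => h _ _
    simpa using this
  rcases Int.units_eq_one_or (Equiv.Perm.sign σ) with hs | hs
  · rw [hs, one_smul]; exact h1
  · rw [hs, Units.neg_smul, one_smul]; exact h1.neg

theorem adjugate_hom {n d : ℕ} (A : Matrix (Fin (d + 1)) (Fin (d + 1)) (MvPolynomial (Fin n) ℂ))
    (h : ∀ i j, (A i j).IsHomogeneous 1) (i j) : (A.adjugate i j).IsHomogeneous d := by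
  rw [Matrix.adjugate_fin_succ_eq_det_submatrix]
  have h1 := det_hom (A.submatrix j.succAbove i.succAbove) fun a b => h _ _
  rcases neg_one_pow_eq_or (MvPolynomial (Fin n) ℂ) (j + i : ℕ) with hs | hs
  · rw [hs, one_mul]; exact h1
  · rw [hs, neg_one_mul]; exact h1.neg

namespace LocSystem

variable {n c : ℕ} {D : LocSystem n c} {z : Fin n → ℂ}

theorem not_lin_mem_aux (hcn : c + 1 < n) (hz : z ≠ 0) (hV : D.J ≤ mz z) (ψ : Fin n → ℂ)
    (hψ : lin ψ ∈ D.pp z) (w : Fin n → ℂ) (hw : ∑ l, ψ l * w l = 1) (d : ℕ)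
    (I : Fin (d + 1) → Fin c) (K : Fin (d + 1) → Fin n)
    (hIp : D.pp z = locIdeal z (Ideal.span (Set.range fun i => D.f (I i))))
    (hdet : (Matrix.of fun i j => grad z (D.f (I i)) (K j)).det ≠ 0) : False := by
  classical
  let φ : Fin c → ℂ := fun s => D.β s z w
  let A : Matrix (Fin (d + 1)) (Fin (d + 1)) (MvPolynomial (Fin n) ℂ) :=
    Matrix.of fun i j => pderiv (K j) (D.f (I i))
  have hA : ∀ i j, (A i j).IsHomogeneous 1 := fun i j => (D.hom (I i)).pderiv
  let Δ := A.det
  let W : Fin (d + 1) → MvPolynomial (Fin n) ℂ := A.adjugate.mulVec fun i => C (φ (I i))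
  have hWh : ∀ j, (W j).IsHomogeneous d := fun j =>
    IsHomogeneous.sum _ _ _ fun i _ => (adjugate_hom A hA j i).mul (isHomogeneous_C _ _)
  have hΔh : Δ.IsHomogeneous (d + 1) := det_hom A hA
  have hΔz : eval z Δ ≠ 0 := by
    change eval z A.det ≠ 0
    rw [RingHom.map_det]
    exact hdet
  let G : Fin c → MvPolynomial (Fin n) ℂ := fun s => ∑ j, pderiv (K j) (D.f s) * W j
  have hGh : ∀ s, (G s).IsHomogeneous (d + 1) := fun s => by
    rw [add_comm]
    exact IsHomogeneous.sum _ _ _ fun j _ => ((D.hom s).pderiv (i := K j)).mul (hWh j)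
  have hGI : ∀ i, G (I i) = Δ * C (φ (I i)) := by
    intro i
    have h1 : A.mulVec W = Δ • fun i => C (φ (I i)) := by
      change A.mulVec (A.adjugate.mulVec _) = _
      rw [Matrix.mulVec_mulVec, Matrix.mul_adjugate, Matrix.smul_mulVec, Matrix.one_mulVec]
    exact congrFun h1 i
  let E : Fin c → MvPolynomial (Fin n) ℂ := fun s => G s - Δ * C (φ s)
  have hEI : ∀ i, E (I i) = 0 := fun i => by simp only [E, hGI, sub_self]
  let F : Fin c → MvPolynomial (Fin n) ℂ := fun s => if s ∈ Set.range I then D.f s else E s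
  have hFh : ∀ s, ∃ e, (F s).IsHomogeneous e := by
    intro s
    by_cases hs : s ∈ Set.range I
    · exact ⟨2, by simp only [F, if_pos hs]; exact D.hom s⟩
    · refine ⟨d + 1, ?_⟩
      simp only [F, if_neg hs]
      exact (hGh s).sub (hΔh.mul (isHomogeneous_C _ _))
  have hspan : ∀ ξ ∈ Submodule.span ℂ (Set.range fun i => grad z (D.f (I i))),
      ∑ j, ξ (K j) * eval z (W j) = eval z Δ * ∑ l, ξ l * w l := by
    intro ξ hξ
    induction hξ using Submodule.span_induction with
    | mem x hx =>
      obtain ⟨i, rfl⟩ := hx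
      have := congrArg (eval z) (hGI i)
      simp only [G, map_sum, map_mul, eval_C, φ] at this
      rw [sum_grad, ← this]
      rfl
    | zero => simp
    | add x y _ _ hx hy =>
      simp only [Pi.add_apply, add_mul, Finset.sum_add_distrib, hx, hy, mul_add]
    | smul a x _ hx =>
      simp only [Pi.smul_apply, smul_eq_mul, mul_assoc, ← Finset.mul_sum, hx]
      ring
  have hfz : ∀ i, eval z (D.f (I i)) = 0 := fun i => J_le_iff.mp hV _
  have hppz : ∀ p ∈ D.pp z, grad z p ∈ Submodule.span ℂ (Set.range fun i => grad z (D.f (I i))) :=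
    fun p hp => grad_mem_of_mem_locIdeal hfz (hIp ▸ hp)
  let N : MvPolynomial (Fin n) ℂ := ∑ j, C (ψ (K j)) * W j
  have hNh : N.IsHomogeneous d := by
    refine IsHomogeneous.sum _ _ _ fun j _ => ?_
    have := (isHomogeneous_C (Fin n) (ψ (K j))).mul (hWh j)
    rwa [zero_add] at this
  have hNz : eval z N = eval z Δ := by
    have := hspan ψ (by
      have := hppz _ hψ
      rwa [grad_lin] at this)
    rw [hw, mul_one] at this
    simpa [N] using this
  have hEz : ∀ s, eval z (E s) = 0 := by
    intro s
    have h1 := hspan _ (hppz _ (J_le_pp (J_le_iff.mp le_rfl s)))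
    rw [sum_grad] at h1
    simp only [E, G, map_sub, map_mul, eval_C, map_sum, φ, ← h1]
    exact sub_self _
  have hFz : Ideal.span (Set.range F) ≤ mz z := by
    rw [Ideal.span_le]
    rintro _ ⟨s, rfl⟩
    by_cases hs : s ∈ Set.range I
    · simp only [F, if_pos hs]; exact J_le_iff.mp hV s
    · simp only [F, if_neg hs]; exact hEz s
  obtain ⟨q, hq, hqz⟩ := Ideal.exists_minimalPrimes_le hFz
  have hqp : q.IsPrime := hq.1.1
  have hFq : Ideal.span (Set.range F) ≤ q := hq.1.2
  have hqh : IsHomog q := IsHomog.of_le_hcore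
    (hq.2 ⟨hcore_isPrime hqp, IsHomogeneous_span_isHomog F hFh hFq⟩ hcore_le)
  have hEq : ∀ s, E s ∈ q := by
    intro s
    by_cases hs : s ∈ Set.range I
    · obtain ⟨i, rfl⟩ := hs
      rw [hEI]; exact zero_mem _
    · have : F s = E s := by simp only [F, if_neg hs]
      rw [← this]
      exact hFq (Ideal.subset_span ⟨s, rfl⟩)
  have hpq : D.pp z ≤ q := by
    rw [hIp]
    refine locIdeal_le_of_prime hqp ?_ hqz
    rw [Ideal.span_le]
    rintro _ ⟨i, rfl⟩
    have : F (I i) = D.f (I i) := by simp only [F, if_pos (Set.mem_range_self i)]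
    change D.f (I i) ∈ q
    rw [← this]
    exact hFq (Ideal.subset_span ⟨_, rfl⟩)
  have hfq : ∀ s, D.f s ∈ q := fun s => hpq (J_le_pp (J_le_iff.mp le_rfl s))
  let Dv : Derivation ℂ (MvPolynomial (Fin n) ℂ) (MvPolynomial (Fin n) ℂ) :=
    mkDerivation ℂ fun l => ∑ j, if K j = l then W j else 0
  have hDv : ∀ p, Dv p = ∑ j, W j * pderiv (K j) p := by
    intro p
    simp only [Dv, mkDerivation_apply_eq, Finset.sum_mul]
    rw [Finset.sum_comm]
    refine Finset.sum_congr rfl fun j _ => ?_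
    simp [ite_mul]
  let b : Ideal (MvPolynomial (Fin n) ℂ) :=
    Submodule.comap (LinearMap.toSpanSingleton (MvPolynomial (Fin n) ℂ) _ N) (Ideal.span {Δ} ⊔ q)
  have hb : ∀ g, g ∈ b ↔ g * N ∈ Ideal.span {Δ} ⊔ q := fun g => Iff.rfl
  have hqb : q ≤ b := fun p hp => (hb p).mpr (Ideal.mem_sup_right (Ideal.mul_mem_right _ _ hp))
  obtain ⟨M, hM⟩ := exists_degree_le (Q := b) (by
    intro v hv hbv
    have hpv : D.pp z ≤ mz v := hpq.trans (hqb.trans hbv)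
    have h1 := hψ
    rw [← pp_eq hz hV hv hpv] at h1
    obtain ⟨g, hg, hgψ⟩ := h1
    refine hg (hbv ((hb g).mpr ?_))
    obtain ⟨h, hh⟩ := Ideal.mem_span_range_iff_exists_fun.mp hgψ
    have h2 := congrArg Dv hh
    rw [map_sum] at h2
    simp only [Derivation.leibniz, smul_eq_mul] at h2
    have h3 : Dv (lin ψ) = N := by
      rw [hDv]
      exact Finset.sum_congr rfl fun j _ => by rw [pderiv_lin, mul_comm]
    have h4 : ∀ s, Dv (D.f s) = E s + Δ * C (φ s) := fun s => by
      rw [hDv]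
      simp only [E, G, sub_add_cancel]
      exact Finset.sum_congr rfl fun j _ => mul_comm _ _
    rw [h3] at h2
    have h5 : g * N = ∑ s, (h s * Dv (D.f s) + D.f s * Dv (h s)) - lin ψ * Dv g := by
      rw [h2]; ring
    rw [h5]
    refine sub_mem (sum_mem fun s _ => add_mem ?_ ?_) ?_
    · rw [h4, mul_add]
      refine add_mem (Ideal.mem_sup_right (Ideal.mul_mem_left _ _ (hEq s))) (Ideal.mem_sup_left ?_)
      exact Ideal.mul_mem_left _ _ (Ideal.mul_mem_right _ _ (Ideal.mem_span_singleton_self _))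
    · exact Ideal.mem_sup_right (Ideal.mul_mem_right _ _ (hfq s))
    · exact Ideal.mem_sup_right (Ideal.mul_mem_right _ _ (hpq hψ)))
  have hΔq : Δ ∉ q := fun h => hΔz (hqz h)
  have hNq : N ∉ q := fun h => hΔz (hNz ▸ (hqz h))
  have hlin : ∀ μ : Fin n → ℂ, ∑ l, μ l * z l = 0 → lin μ ∈ q := by
    intro μ hμ
    obtain ⟨k, hk⟩ := exists_const (d := d) (M := M) q hqp N Δ hΔq z hz hqz (by
      intro r hr
      obtain ⟨y, hy, x, hx, hyx⟩ := Submodule.mem_sup.mp ((hb r).mp (hM (M + 1) (by omega) r hr))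
      obtain ⟨t, rfl⟩ := Ideal.mem_span_singleton'.mp hy
      refine ⟨homogeneousComponent M t, homogeneousComponent_isHomogeneous M t, ?_⟩
      have h6 := congrArg (homogeneousComponent (d + 1 + M)) hyx
      have h7 : (r * N).IsHomogeneous (d + 1 + M) := by
        have := hr.mul hNh
        rwa [show M + 1 + d = d + 1 + M by ring] at this
      rw [map_add, mul_comm t, homogeneousComponent_mul_left hΔh, homogeneousComponent_eq_self h7] at h6
      rw [← h6, add_sub_cancel_left]
      exact hqh x hx _) μ
    have h8 := hqz hk
    rw [mem_mz, map_sub, map_mul, eval_lin, hμ, zero_mul, map_mul, eval_C, zero_sub, neg_eq_zero,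
      mul_eq_zero] at h8
    rw [h8.resolve_right hΔz, C_0, zero_mul, sub_zero] at hk
    exact (hqp.mem_or_mem hk).resolve_right hNq
  let H : (Fin n → ℂ) →ₗ[ℂ] ℂ := ∑ l, z l • LinearMap.proj l
  have hH : ∀ μ, H μ = ∑ l, μ l * z l := fun μ => by simp [H, mul_comm]
  let bs := finBasis ℂ (LinearMap.ker H)
  have h9 := le_height (z := z) (Q := q) (fun i => lin (bs i : Fin n → ℂ)) (by
    simp only [grad_lin]
    exact bs.linearIndependent.map' (LinearMap.ker H).subtype (Submodule.ker_subtype _)) hqp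
    (fun i => hlin _ (by rw [← hH]; exact (bs i).2)) hqz
  have h10 := height_le_of_minimal F hq
  have h11 := H.finrank_range_add_finrank_ker
  have h12 : finrank ℂ (LinearMap.range H) ≤ 1 := by
    simpa using Submodule.finrank_le (LinearMap.range H)
  rw [finrank_fin_fun] at h11
  have h13 := h9.trans h10
  rw [Fintype.card_fin] at h13
  have h14 : finrank ℂ (LinearMap.ker H) ≤ c := by exact_mod_cast h13
  omega

/-- The common zero locus is nondegenerate. -/
theorem eq_zero_of_lin_mem (hcn : c + 1 < n) (hz : z ≠ 0) (hV : D.J ≤ mz z) (ψ : Fin n → ℂ)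
    (hψ : lin ψ ∈ D.pp z) : ψ = 0 := by
  classical
  by_contra hne
  obtain ⟨l0, hl0⟩ := Function.ne_iff.mp hne
  obtain ⟨I, hI, hp⟩ := exists_gens hz hV
  have hρ : D.rk z ≠ 0 := by
    intro h0
    have h1 := grad_mem_of_mem_locIdeal (fun i => J_le_iff.mp hV _) (hp ▸ hψ)
    have : IsEmpty (Fin (D.rk z)) := by rw [h0]; infer_instance
    rw [grad_lin, Set.range_eq_empty, Submodule.span_empty] at h1
    exact hne h1
  generalize D.rk z = ρ at I hρ
  obtain ⟨d, rfl⟩ := Nat.exists_eq_succ_of_ne_zero hρ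
  obtain ⟨I', K, hdet⟩ := exists_minor (c := d + 1) (Matrix.of fun i => grad z (D.f (I i))) (by
    have := finrank_span_eq_card hI
    exact this.trans (Fintype.card_fin _))
  have hinj : Function.Injective I' := by
    intro i j hij
    by_contra hne
    refine hdet (Matrix.det_zero_of_row_eq hne ?_)
    ext l
    simp [hij]
  have hsurj := Finite.surjective_of_injective hinj
  refine not_lin_mem_aux hcn hz hV ψ hψ (Pi.single l0 (ψ l0)⁻¹) ?_ d (I ∘ I') K ?_ hdet
  · simp only [Pi.single_apply, mul_ite, mul_zero, Finset.sum_ite_eq', Finset.mem_univ, if_true]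
    exact mul_inv_cancel₀ hl0
  · rw [hp]
    congr 2
    exact (hsurj.range_comp (fun i => D.f (I i))).symm

end LocSystem

end

section

theorem mz_zero_le {n : ℕ} {Q : Ideal (MvPolynomial (Fin n) ℂ)} (hQ : Q.IsPrime)
    (h : ∀ v, v ≠ 0 → ¬ Q ≤ mz v) : mz 0 ≤ Q := by
  obtain ⟨M, hM⟩ := exists_degree_le h
  rw [← idealOfVars_eq, idealOfVars, Ideal.span_le]
  rintro _ ⟨i, rfl⟩
  exact hQ.mem_of_pow_mem _ (hM M le_rfl _ (isHomogeneous_X_pow i M))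

/-- A quotient in which all forms of large degree reduce to lower degree is finite. -/
theorem finite_quotient {n M : ℕ} (q : Ideal (MvPolynomial (Fin n) ℂ))
    (h : ∀ d, ∀ p : MvPolynomial (Fin n) ℂ, p.IsHomogeneous (d + M + 1) →
      ∃ p' : MvPolynomial (Fin n) ℂ, p'.IsHomogeneous (d + M) ∧ p - p' ∈ q) :
    Module.Finite ℂ (MvPolynomial (Fin n) ℂ ⧸ q) := by
  let π := Ideal.Quotient.mkₐ ℂ q
  let U : Submodule ℂ (MvPolynomial (Fin n) ℂ ⧸ q) :=
    ⨆ i ∈ Finset.range (M + 1), (homogeneousSubmodule (Fin n) ℂ i).map π.toLinearMap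
  have hU : U.FG := Submodule.fg_biSup _ _ fun i _ => (homogeneousSubmodule_fg (Fin n) ℂ i).map _
  have key : ∀ d, ∀ p : MvPolynomial (Fin n) ℂ, p.IsHomogeneous d → π p ∈ U := by
    intro d
    induction d with
    | zero =>
      intro p hp
      exact Submodule.mem_iSup_of_mem 0 (Submodule.mem_iSup_of_mem (by simp) ⟨p, hp, rfl⟩)
    | succ d ih =>
      intro p hp
      by_cases hd : d + 1 < M + 1
      · exact Submodule.mem_iSup_of_mem (d + 1)
          (Submodule.mem_iSup_of_mem (Finset.mem_range.mpr hd) ⟨p, hp, rfl⟩)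
      · obtain ⟨e, rfl⟩ := Nat.exists_eq_add_of_le' (show M ≤ d by omega)
        obtain ⟨p', hp', hpp⟩ := h e p hp
        have : π p = π p' := Ideal.Quotient.eq.mpr hpp
        rw [this]
        exact ih p' hp'
  refine ⟨?_⟩
  have : U = ⊤ := by
    refine top_le_iff.mp fun y _ => ?_
    obtain ⟨p, rfl⟩ := Ideal.Quotient.mk_surjective y
    change π p ∈ U
    rw [← sum_homogeneousComponent p, map_sum]
    exact sum_mem fun i _ => key i _ (homogeneousComponent_isHomogeneous i p)
  rwa [← this]

theorem isMaximal_of_finite {n : ℕ} (q : Ideal (MvPolynomial (Fin n) ℂ)) (hq : q.IsPrime)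
    (h : Module.Finite ℂ (MvPolynomial (Fin n) ℂ ⧸ q)) : q.IsMaximal := by
  have : IsDomain (MvPolynomial (Fin n) ℂ ⧸ q) := Ideal.Quotient.isDomain q
  refine Ideal.Quotient.maximal_of_isField q ?_
  exact isField_of_isIntegral_of_isField' (Field.toIsField ℂ)

namespace LocSystem

variable {n c : ℕ} {D : LocSystem n c} {z z' : Fin n → ℂ}

theorem exists_zero (hz : z ≠ 0) (hV : D.J ≤ mz z) {r : ℕ} (ℓ : Fin r → Fin n → ℂ)
    (hr : r + D.rk z < n) : ∃ w, w ≠ 0 ∧ D.pp z ≤ mz w ∧ ∀ j, ∑ l, ℓ j l * w l = 0 := by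
  by_contra! hcon
  obtain ⟨I, hI, hp⟩ := exists_gens hz hV
  obtain ⟨M, hM⟩ := exists_degree_le (Q := D.pp z ⊔ Ideal.span (Set.range fun j => lin (ℓ j))) (by
    intro v hv hle
    obtain ⟨j, hj⟩ := hcon v hv (le_sup_left.trans hle)
    refine hj ?_
    rw [← eval_lin]
    exact hle (Ideal.mem_sup_right (Ideal.subset_span ⟨j, rfl⟩)))
  let G : Fin (D.rk z) ⊕ Fin r → MvPolynomial (Fin n) ℂ :=
    Sum.elim (fun i => D.f (I i)) fun j => lin (ℓ j) - C (∑ l, ℓ j l * z l)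
  have hGz : Ideal.span (Set.range G) ≤ mz z := by
    rw [Ideal.span_le]
    rintro _ ⟨i | j, rfl⟩
    · exact J_le_iff.mp hV _
    · simp [G, mem_mz, eval_lin]
  obtain ⟨q, hq, hqz⟩ := Ideal.exists_minimalPrimes_le hGz
  have hqp : q.IsPrime := hq.1.1
  have hGq : ∀ i, G i ∈ q := fun i => hq.1.2 (Ideal.subset_span ⟨i, rfl⟩)
  have hpq : D.pp z ≤ q := by
    rw [hp]
    refine locIdeal_le_of_prime hqp ?_ hqz
    rw [Ideal.span_le]
    rintro _ ⟨i, rfl⟩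
    exact hGq (Sum.inl i)
  have hfin : Module.Finite ℂ (MvPolynomial (Fin n) ℂ ⧸ q) := by
    refine finite_quotient (M := M) q fun d p hp => ?_
    obtain ⟨a, ha, b, hb, hab⟩ := Submodule.mem_sup.mp (hM (d + M + 1) (by omega) p hp)
    obtain ⟨y, hy⟩ := Ideal.mem_span_range_iff_exists_fun.mp hb
    refine ⟨∑ j, C (∑ l, ℓ j l * z l) * homogeneousComponent (d + M) (y j), ?_, ?_⟩
    · refine IsHomogeneous.sum _ _ _ fun j _ => ?_
      have := (isHomogeneous_C (Fin n) (∑ l, ℓ j l * z l)).mul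
        (homogeneousComponent_isHomogeneous (d + M) (y j))
      rwa [zero_add] at this
    · have h1 := congrArg (homogeneousComponent (1 + (d + M))) hab
      have h2 : homogeneousComponent (1 + (d + M)) p = p :=
        homogeneousComponent_eq_self (by rwa [add_comm 1])
      rw [map_add, h2, ← hy, map_sum] at h1
      simp only [mul_comm (y _), homogeneousComponent_mul_left (lin_hom _)] at h1
      have h3 : p - ∑ j, C (∑ l, ℓ j l * z l) * homogeneousComponent (d + M) (y j) =
          homogeneousComponent (1 + (d + M)) a +
          ∑ j, G (Sum.inr j) * homogeneousComponent (d + M) (y j) := by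
        rw [← h1]
        simp only [G, Sum.elim_inr, sub_mul, Finset.sum_sub_distrib]
        ring
      rw [h3]
      exact add_mem (hpq (isHomog_pp hz hV a ha _))
        (sum_mem fun j _ => Ideal.mul_mem_right _ _ (hGq _))
  have hmax := isMaximal_of_finite q hqp hfin
  have hqe : q = mz z := hmax.eq_of_le (Ideal.IsMaximal.ne_top inferInstance) hqz
  have h4 := height_le_of_minimal G hq
  rw [hqe, height_mz, Fintype.card_sum, Fintype.card_fin, Fintype.card_fin] at h4
  have h5 : n ≤ D.rk z + r := by exact_mod_cast h4
  omega

/-- If the ranks are small, all local ideals agree. -/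
theorem pp_eq_pp (hz : z ≠ 0) (hV : D.J ≤ mz z) (hz' : z' ≠ 0) (hV' : D.J ≤ mz z')
    (hr : D.rk z + D.rk z' < n) : D.pp z = D.pp z' := by
  obtain ⟨I, hI, hs⟩ := exists_fin_subfamily (fun s => grad z (D.f s)) (D.rk z) rfl
  obtain ⟨w, hw, hpw, hl⟩ := exists_zero hz' hV' (fun i => grad z (D.f (I i))) hr
  have hβ : ∀ s, D.β s z w = 0 := by
    intro s
    have h1 : grad z (D.f s) ∈ Submodule.span ℂ (Set.range ((fun s => grad z (D.f s)) ∘ I)) := by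
      rw [hs]
      exact Submodule.subset_span ⟨s, rfl⟩
    obtain ⟨r, hr⟩ := Submodule.mem_span_range_iff_exists_fun ℂ |>.mp h1
    rw [← sum_grad, ← hr]
    simp only [Finset.sum_apply, Pi.smul_apply, Function.comp, smul_eq_mul, Finset.sum_mul]
    rw [Finset.sum_comm]
    refine Finset.sum_eq_zero fun i _ => ?_
    simp only [mul_assoc, ← Finset.mul_sum, hl i, mul_zero]
  let φ : MvPolynomial (Fin n) ℂ →ₐ[ℂ] MvPolynomial (Fin 2) ℂ :=
    aeval fun l => C (z l) * X 0 + C (w l) * X 1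
  have hφ : ∀ p y, eval y (φ p) = eval (y 0 • z + y 1 • w) p := by
    intro p y
    change eval y (aeval _ p) = _
    rw [aeval_def, MvPolynomial.algebraMap_eq, ← coe_eval₂Hom, ← RingHom.comp_apply]
    congr 1
    refine MvPolynomial.ringHom_ext (by simp) fun l => ?_
    simp
    ring
  have hP : (RingHom.ker φ).IsPrime := RingHom.ker_isPrime φ
  have hJ : D.J ≤ RingHom.ker φ := by
    rw [J_le_iff]
    intro s
    refine MvPolynomial.funext fun y => ?_
    rw [hφ, map_zero]
    have h1 := D.two_eval s z
    have h2 := D.two_eval s w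
    rw [mem_mz.mp (J_le_iff.mp hV s)] at h1
    rw [mem_mz.mp (hpw (J_le_pp (J_le_iff.mp le_rfl s)))] at h2
    have h3 := D.two_eval s (y 0 • z + y 1 • w)
    simp only [map_add, map_smul, LinearMap.add_apply, LinearMap.smul_apply, ← h1, ← h2,
      D.symm s w z, hβ s] at h3
    simpa using h3
  have hPz : RingHom.ker φ ≤ mz z := by
    intro p hp
    have := hφ p ![1, 0]
    rw [RingHom.mem_ker.mp hp] at this
    simpa [mem_mz] using this.symm
  have hPw : RingHom.ker φ ≤ mz w := by
    intro p hp
    have := hφ p ![0, 1]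
    rw [RingHom.mem_ker.mp hp] at this
    simpa [mem_mz] using this.symm
  have h4 : D.pp w ≤ RingHom.ker φ := pp_le hP hJ hPw
  rw [pp_eq hz' hV' hw hpw] at h4
  exact pp_eq hz' hV' hz (h4.trans hPz)

theorem exists_ne_zero (hcn : c < n) : ∃ z, z ≠ 0 ∧ D.J ≤ mz z := by
  by_contra! hcon
  have h0 : D.J ≤ mz 0 := J_le_iff.mpr fun s => by
    have := D.two_eval s 0
    simpa [mem_mz] using this
  obtain ⟨q, hq, hqz⟩ := Ideal.exists_minimalPrimes_le h0
  have h1 := mz_zero_le hq.1.1 fun v hv h => hcon v hv (hq.1.2.trans h)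
  have h2 := height_le_of_minimal D.f hq
  rw [le_antisymm hqz h1, height_mz, Fintype.card_fin] at h2
  have h3 : n ≤ c := by exact_mod_cast h2
  omega

end LocSystem

end

section

section
variable {m : ℕ}

/-- The ideal of polynomials vanishing on the affine cone over a set. -/
def coneIdeal (S : Set (PS m)) : Ideal (MvPolynomial (Fin m) ℂ) where
  carrier := {p | ∀ y ∈ S, PVanish p y}
  add_mem' := fun ha hb y hy v hv => by rw [map_add, ha y hy v hv, hb y hy v hv, add_zero]
  zero_mem' := fun y _ v _ => map_zero _
  smul_mem' := fun a p hp y hy v hv => by rw [smul_eq_mul, map_mul, hp y hy v hv, mul_zero]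

theorem coneIdeal_anti {S T : Set (PS m)} (h : S ⊆ T) : coneIdeal T ≤ coneIdeal S :=
  fun _ hp y hy => hp y (h hy)

theorem coneIdeal_le_mz {S : Set (PS m)} {y : PS m} (hy : y ∈ S) {v : Fin m → ℂ}
    (hv : v ∈ y.submodule) : coneIdeal S ≤ mz v := fun _ hp => mem_mz.mpr (hp y hy v hv)

theorem eval_aeval_line (r : MvPolynomial (Fin m) ℂ) (z : Fin m → ℂ) (t : ℂ) :
    (aeval (fun l => Polynomial.C (z l) * Polynomial.X) r : Polynomial ℂ).eval t =
      eval (t • z) r := by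
  change Polynomial.evalRingHom t (aeval _ r) = _
  rw [aeval_def, ← coe_eval₂Hom, ← RingHom.comp_apply]
  congr 1
  refine MvPolynomial.ringHom_ext (by simp) fun l => ?_
  simp only [coe_eval₂Hom, RingHom.comp_apply, eval₂_X, Polynomial.coe_evalRingHom,
    Polynomial.eval_mul, Polynomial.eval_C, Polynomial.eval_X, eval_X, Pi.smul_apply, smul_eq_mul]
  ring

theorem coneIdeal_isPrime {S : Set (PS m)} (hS : ZIrreducible S) : (coneIdeal S).IsPrime := by
  obtain ⟨⟨y, hy⟩, hirr⟩ := hS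
  have hy0 := coneIdeal_le_mz hy (Submodule.zero_mem _)
  refine ⟨fun h => ?_, fun {p q} hpq => ?_⟩
  · rw [h, top_le_iff] at hy0
    exact (inferInstance : (mz (0 : Fin m → ℂ)).IsMaximal).ne_top hy0
  · have h : S ⊆ ZeroLocus {p} ∪ ZeroLocus {q} := by
      intro z hz
      by_contra hcon
      have h1 : ¬ PVanish p z := fun h => hcon (Or.inl (by rintro _ rfl; exact h))
      have h2 : ¬ PVanish q z := fun h => hcon (Or.inr (by rintro _ rfl; exact h))
      have key : ∀ r : MvPolynomial (Fin m) ℂ, ¬ PVanish r z →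
          ∃ φ : Polynomial ℂ, φ ≠ 0 ∧ ∀ t, φ.eval t = eval (t • z.rep) r := by
        intro r hr
        refine ⟨aeval (fun l => Polynomial.C (z.rep l) * Polynomial.X) r, fun h0 => hr fun v hv => ?_,
          fun t => eval_aeval_line _ _ _⟩
        rw [Projectivization.submodule_eq, Submodule.mem_span_singleton] at hv
        obtain ⟨t, rfl⟩ := hv
        rw [← eval_aeval_line, h0, Polynomial.eval_zero]
      obtain ⟨φ, hφ, hφ'⟩ := key p h1
      obtain ⟨χ, hχ, hχ'⟩ := key q h2
      refine mul_ne_zero hφ hχ (Polynomial.funext fun t => ?_)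
      rw [Polynomial.eval_mul, hφ', hχ', ← map_mul, Polynomial.eval_zero]
      refine hpq z hz _ ?_
      rw [Projectivization.submodule_eq]
      exact Submodule.smul_mem _ _ (Submodule.mem_span_singleton_self _)
    rcases hirr _ _ ⟨_, rfl⟩ ⟨_, rfl⟩ h with h | h
    · exact Or.inl fun z hz => h hz p rfl
    · exact Or.inr fun z hz => h hz q rfl

theorem coneIdeal_strictAnti {S T : Set (PS m)} (hS : ZClosed S) (h : S < T) :
    coneIdeal T < coneIdeal S := by
  obtain ⟨hle, hne⟩ := Set.ssubset_iff_subset_ne.mp h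
  refine lt_of_le_of_ne (coneIdeal_anti hle) fun heq => hne (hle.antisymm ?_)
  obtain ⟨P, rfl⟩ := hS
  intro y hy p hp
  have : p ∈ coneIdeal (ZeroLocus P) := fun z hz => hz p hp
  rw [← heq] at this
  exact this y hy

theorem coneIdeal_lt_mz {S : Set (PS m)} (hS : S.Nonempty) : coneIdeal S < mz 0 := by
  obtain ⟨y, hy⟩ := hS
  have h1 := coneIdeal_le_mz hy (Submodule.zero_mem _)
  refine lt_of_le_of_ne h1 fun heq => y.rep_nonzero ?_
  funext l
  have h2 : X l ∈ mz (0 : Fin m → ℂ) := by simp [mem_mz]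
  rw [← heq] at h2
  have h3 := h2 y hy y.rep (by
    rw [Projectivization.submodule_eq]; exact Submodule.mem_span_singleton_self _)
  simpa using h3

/-- The projective zero locus of a homogeneous ideal. -/
def pzl (Q : Ideal (MvPolynomial (Fin m) ℂ)) : Set (PS m) := {y | Q ≤ mz y.rep}

variable {Q : Ideal (MvPolynomial (Fin m) ℂ)}

theorem le_mz_of_mem_pzl (hQ : IsHomog Q) {y : PS m} (hy : y ∈ pzl Q) {v} (hv : v ∈ y.submodule) :
    Q ≤ mz v := by
  rw [Projectivization.submodule_eq, Submodule.mem_span_singleton] at hv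
  obtain ⟨t, rfl⟩ := hv
  exact hQ.le_mz_smul hy t

theorem rep_mem_submodule (y : PS m) : y.rep ∈ y.submodule := by
  rw [Projectivization.submodule_eq]; exact Submodule.mem_span_singleton_self _

theorem mk_mem_pzl (hQ : IsHomog Q) {v : Fin m → ℂ} (hv : v ≠ 0) (h : Q ≤ mz v) :
    Projectivization.mk ℂ v hv ∈ pzl Q := by
  obtain ⟨a, ha⟩ := Projectivization.exists_smul_eq_mk_rep ℂ v hv
  change Q ≤ mz (Projectivization.mk ℂ v hv).rep
  rw [← ha]
  exact hQ.le_mz_smul h _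

theorem pzl_eq_zeroLocus (hQ : IsHomog Q) : pzl Q = ZeroLocus (Q : Set _) := by
  ext y
  refine ⟨fun h p hp v hv => mem_mz.mp (le_mz_of_mem_pzl hQ h hv hp), fun h p hp => ?_⟩
  exact mem_mz.mpr (h p hp _ (rep_mem_submodule y))

theorem pzl_closed (hQ : IsHomog Q) : ZClosed (pzl Q) := ⟨_, pzl_eq_zeroLocus hQ⟩

/-- A point of the zero locus of a prime off a hypersurface. -/
theorem exists_zero_of_notMem (hQ : Q.IsPrime) {p} (hp : p ∉ Q) : ∃ v, Q ≤ mz v ∧ eval v p ≠ 0 := by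
  by_contra hcon
  push Not at hcon
  refine hp ?_
  rw [← hQ.radical, Ideal.radical_eq_jacobson, Ideal.jacobson, Submodule.mem_sInf]
  rintro M ⟨hM, hMm⟩
  obtain ⟨z, rfl⟩ := exists_eq_mz M hMm
  exact mem_mz.mpr (hcon z hM)

theorem exists_ne_zero_of_notMem (hQ : Q.IsPrime) (hw : ∃ w, w ≠ 0 ∧ Q ≤ mz w) {p} (hp : p ∉ Q) :
    ∃ v, v ≠ 0 ∧ Q ≤ mz v ∧ eval v p ≠ 0 := by
  obtain ⟨w, hw0, hw⟩ := hw
  obtain ⟨l, hl⟩ := Function.ne_iff.mp hw0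
  have hX : X l ∉ Q := fun h => hl (by simpa using mem_mz.mp (hw h))
  obtain ⟨v, hv, hv'⟩ := exists_zero_of_notMem hQ (fun h => (hQ.mem_or_mem h).elim hp hX :
    p * X l ∉ Q)
  rw [map_mul] at hv'
  refine ⟨v, fun h => hv' ?_, hv, left_ne_zero_of_mul hv'⟩
  simp [h]

theorem pzl_irreducible (hQ : Q.IsPrime) (hh : IsHomog Q) (hw : ∃ w, w ≠ 0 ∧ Q ≤ mz w) :
    ZIrreducible (pzl Q) := by
  obtain ⟨w, hw0, hww⟩ := id hw
  refine ⟨⟨_, mk_mem_pzl hh hw0 hww⟩, ?_⟩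
  rintro _ _ ⟨P₁, rfl⟩ ⟨P₂, rfl⟩ hsub
  by_contra hcon
  push Not at hcon
  obtain ⟨h1, h2⟩ := hcon
  have key : ∀ P : Set (MvPolynomial (Fin m) ℂ), ¬ pzl Q ⊆ ZeroLocus P → ∃ p ∈ P, p ∉ Q := by
    intro P hP
    obtain ⟨y, hy, hy'⟩ := Set.not_subset.mp hP
    by_contra hcon
    push Not at hcon
    exact hy' fun p hp v hv => mem_mz.mp (le_mz_of_mem_pzl hh hy hv (hcon p hp))
  obtain ⟨p₁, hp₁, hq₁⟩ := key _ h1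
  obtain ⟨p₂, hp₂, hq₂⟩ := key _ h2
  obtain ⟨v, hv0, hv, hv'⟩ := exists_ne_zero_of_notMem hQ hw
    (fun h => (hQ.mem_or_mem h).elim hq₁ hq₂ : p₁ * p₂ ∉ Q)
  rw [map_mul] at hv'
  have hvm : v ∈ (Projectivization.mk ℂ v hv0).submodule := by
    rw [Projectivization.submodule_mk]; exact Submodule.mem_span_singleton_self _
  rcases hsub (mk_mem_pzl hh hv0 hv) with h | h
  · exact left_ne_zero_of_mul hv' (h p₁ hp₁ v hvm)
  · exact right_ne_zero_of_mul hv' (h p₂ hp₂ v hvm)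

theorem coneIdeal_pzl (hQ : Q.IsPrime) (hh : IsHomog Q) (hw : ∃ w, w ≠ 0 ∧ Q ≤ mz w) :
    coneIdeal (pzl Q) = Q := by
  refine le_antisymm (fun p hp => ?_) fun p hp y hy v hv => mem_mz.mp (le_mz_of_mem_pzl hh hy hv hp)
  by_contra hpQ
  obtain ⟨v, hv0, hv, hv'⟩ := exists_ne_zero_of_notMem hQ hw hpQ
  refine hv' (hp _ (mk_mem_pzl hh hv0 hv) v ?_)
  rw [Projectivization.submodule_mk]; exact Submodule.mem_span_singleton_self _

theorem pzl_strictAnti {Q' : Ideal (MvPolynomial (Fin m) ℂ)} (hQ : Q.IsPrime) (hh : IsHomog Q)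
    (hQ' : Q'.IsPrime) (hh' : IsHomog Q') (hw : ∃ w, w ≠ 0 ∧ Q' ≤ mz w) (h : Q < Q') :
    pzl Q' < pzl Q := by
  obtain ⟨w, hw0, hww⟩ := id hw
  refine Set.ssubset_iff_subset_ne.mpr ⟨fun y hy => h.le.trans hy, fun heq => h.ne ?_⟩
  rw [← coneIdeal_pzl hQ hh ⟨w, hw0, h.le.trans hww⟩, ← heq, coneIdeal_pzl hQ' hh' hw]

/-- The dimension of the zero locus is at most what the height allows. -/
theorem not_dimGE (hh : IsHomog Q) {ρ d : ℕ} (hρ : (ρ : ℕ∞) ≤ Q.height)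
    (hd : m < ρ + d + 1) : ¬ DimGE (pzl Q) d := by
  rintro ⟨C, hC, hCi⟩
  have key : ∀ i : ℕ, ∀ hi : i < d + 1,
      ((ρ + (d - i) : ℕ) : ℕ∞) ≤ (coneIdeal (C ⟨i, hi⟩)).height := by
    intro i hi
    obtain ⟨j, hj⟩ : ∃ j, i + j = d := ⟨d - i, by omega⟩
    induction j generalizing i with
    | zero =>
      have h0 : d - i = 0 := by omega
      rw [h0, add_zero]
      refine hρ.trans (Ideal.height_mono fun p hp y hy v hv => ?_)
      exact mem_mz.mp (le_mz_of_mem_pzl hh ((hCi _).2.2 hy) hv hp)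
    | succ j ih =>
      have h1 := ih (i + 1) (by omega) (by omega)
      have h2 : coneIdeal (C ⟨i + 1, by omega⟩) < coneIdeal (C ⟨i, hi⟩) :=
        coneIdeal_strictAnti (hCi _).1 (hC (by simp [Fin.lt_def]))
      have := coneIdeal_isPrime (hCi ⟨i + 1, by omega⟩).2.1
      have := coneIdeal_isPrime (hCi ⟨i, hi⟩).2.1
      have h3 := Ideal.height_add_one_le_of_lt_of_isPrime h2
      refine le_trans ?_ h3
      have h4 : d - i = d - (i + 1) + 1 := by omega
      rw [h4, ← add_assoc]
      push_cast
      push_cast at h1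
      exact add_le_add_left h1 1
  have h1 := key 0 (by omega)
  have := coneIdeal_isPrime (hCi ⟨0, by omega⟩).2.1
  have h0 : coneIdeal (C ⟨0, d.succ_pos⟩) < mz 0 := coneIdeal_lt_mz (hCi _).2.1.1
  have h2 := Ideal.height_add_one_le_of_lt_of_isPrime h0
  rw [height_mz] at h2
  have h3 := (add_le_add_left h1 1).trans h2
  norm_cast at h3
  omega

/-- The homogeneous primes containing `Q`. -/
abbrev HPrime (Q : Ideal (MvPolynomial (Fin m) ℂ)) :=
  {p : Ideal (MvPolynomial (Fin m) ℂ) // p.IsPrime ∧ IsHomog p ∧ Q ≤ p}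

theorem isHomog_of_minimal {J p : Ideal (MvPolynomial (Fin m) ℂ)}
    (hJ : ∀ q : Ideal (MvPolynomial (Fin m) ℂ), J ≤ q → J ≤ hcore q) (hp : p ∈ J.minimalPrimes) :
    IsHomog p :=
  IsHomog.of_le_hcore (hp.2 ⟨hcore_isPrime hp.1.1, hJ p hp.1.2⟩ hcore_le)

theorem exists_chain_of_hyperplanes (hh : IsHomog Q) (i : ℕ) :
    ∃ ℓ : Fin i → Fin m → ℂ, ∀ R : HPrime Q, (∀ j, lin (ℓ j) ∈ R.1) →
      (∃ w, w ≠ 0 ∧ R.1 ≤ mz w) → ∃ s : LTSeries (HPrime Q), s.length = i ∧ s.last = R := by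
  induction i with
  | zero => exact ⟨Fin.elim0, fun R _ _ => ⟨RelSeries.singleton _ R, rfl, rfl⟩⟩
  | succ i ih =>
    obtain ⟨ℓ, hℓ⟩ := ih
    set J := Q ⊔ Ideal.span (Set.range fun j => lin (ℓ j)) with hJdef
    have hJ : ∀ q : Ideal (MvPolynomial (Fin m) ℂ), J ≤ q → J ≤ hcore q := by
      intro q hq
      refine sup_le (hh.le_hcore (le_sup_left.trans hq)) ?_
      rw [Ideal.span_le]
      rintro _ ⟨j, rfl⟩
      exact mem_hcore (lin_hom _) (hq (Ideal.mem_sup_right (Ideal.subset_span ⟨j, rfl⟩)))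
    let L : Ideal (MvPolynomial (Fin m) ℂ) → Submodule ℂ (Fin m → ℂ) := fun q =>
      { carrier := {ψ | lin ψ ∈ q}
        add_mem' := fun {a b} ha hb => by
          have : lin (a + b) = lin a + lin b := by
            simp [lin, add_mul, Finset.sum_add_distrib]
          change lin (a + b) ∈ q
          rw [this]; exact q.add_mem ha hb
        zero_mem' := by simp [lin]
        smul_mem' := fun t a ha => by
          have : lin (t • a) = C t * lin a := by
            simp [lin, Finset.mul_sum, mul_assoc]
          change lin (t • a) ∈ q
          rw [this]; exact q.mul_mem_left _ ha }
    have hfin : Set.Finite {q ∈ J.minimalPrimes | ∃ w, w ≠ 0 ∧ q ≤ mz w} :=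
      (Ideal.finite_minimalPrimes_of_isNoetherianRing _ J).subset fun q hq => hq.1
    classical
    let S : Finset (Subspace ℂ (Fin m → ℂ)) := hfin.toFinset.image L
    have hS : ⊤ ∉ S := by
      intro h
      obtain ⟨q, hq, hqL⟩ := Finset.mem_image.mp h
      rw [Set.Finite.mem_toFinset] at hq
      obtain ⟨-, w, hw0, hw⟩ := hq
      obtain ⟨l, hl⟩ := Function.ne_iff.mp hw0
      have h1 : Pi.single l 1 ∈ L q := by rw [hqL]; trivial
      have h2 := mem_mz.mp (hw h1)
      rw [eval_lin, Finset.sum_eq_single l (by intro b _ hb; simp [hb]) (by simp)] at h2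
      simp at h2
      exact hl h2
    obtain ⟨ψ, hψ⟩ := (Set.ne_univ_iff_exists_notMem _).mp
      (Subspace.biUnion_ne_univ_of_top_notMem hS)
    simp only [Set.mem_iUnion, not_exists] at hψ
    refine ⟨Fin.snoc (α := fun _ => Fin m → ℂ) ℓ ψ, fun R hR hw => ?_⟩
    obtain ⟨w, hw0, hw⟩ := hw
    have hJR : J ≤ R.1 := by
      refine sup_le R.2.2.2 ?_
      rw [Ideal.span_le]
      rintro _ ⟨j, rfl⟩
      have := hR j.castSucc
      rwa [Fin.snoc_castSucc] at this
    have := R.2.1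
    obtain ⟨q, hq, hqR⟩ := Ideal.exists_minimalPrimes_le hJR
    have hqh := isHomog_of_minimal hJ hq
    let q' : HPrime Q := ⟨q, hq.1.1, hqh, le_sup_left.trans hq.1.2⟩
    have hlt : q' < R := by
      refine lt_of_le_of_ne hqR fun h => ?_
      have h1 := hR (Fin.last i)
      rw [Fin.snoc_last] at h1
      refine hψ (L q) (Finset.mem_image_of_mem _ (hfin.mem_toFinset.mpr
        ⟨hq, w, hw0, hqR.trans hw⟩)) ?_
      rw [← h] at h1
      exact h1
    obtain ⟨s, hs, hs'⟩ := hℓ q' (fun j => hq.1.2 (Ideal.mem_sup_right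
      (Ideal.subset_span ⟨j, rfl⟩))) ⟨w, hw0, hqR.trans hw⟩
    refine ⟨s.snoc R (by rw [hs']; exact hlt), ?_, ?_⟩
    · simp [hs]
    · simp

theorem dimGE_pzl (hh : IsHomog Q) {d : ℕ}
    (hsec : ∀ ℓ : Fin d → Fin m → ℂ, ∃ w, w ≠ 0 ∧ Q ≤ mz w ∧ ∀ j, ∑ l, ℓ j l * w l = 0)
    (hQ : Q.IsPrime) : DimGE (pzl Q) d := by
  obtain ⟨ℓ, hℓ⟩ := exists_chain_of_hyperplanes hh d
  obtain ⟨w, hw0, hw, hwℓ⟩ := hsec ℓ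
  have hpr : (mz w).IsPrime := (inferInstance : (mz w).IsMaximal).isPrime
  let R : HPrime Q := ⟨hcore (mz w), hcore_isPrime hpr, isHomog_hcore, hh.le_hcore hw⟩
  obtain ⟨s, hs, hs'⟩ := hℓ R (fun j => mem_hcore (lin_hom _) (by
    rw [mem_mz, eval_lin]; exact hwℓ j)) ⟨w, hw0, hcore_le⟩
  subst hs
  have hsw : ∀ i, (s i).1 ≤ mz w := fun i => by
    have h1 : s i ≤ s.last := s.monotone (Fin.le_last i)
    rw [hs'] at h1
    exact le_trans h1 hcore_le
  refine ⟨fun i => pzl (s i.rev).1, fun i j hij => ?_, fun i => ⟨pzl_closed (s i.rev).2.2.1,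
    pzl_irreducible (s i.rev).2.1 (s i.rev).2.2.1 ⟨w, hw0, hsw _⟩, fun y hy =>
      (s i.rev).2.2.2.trans hy⟩⟩
  have h1 : s j.rev < s i.rev := s.strictMono (Fin.rev_lt_rev.mpr hij)
  exact pzl_strictAnti (s j.rev).2.1 (s j.rev).2.2.1 (s i.rev).2.1 (s i.rev).2.2.1
    ⟨w, hw0, hsw _⟩ h1

end

end

section

theorem polyDiff_apply {m : ℕ} (p : MvPolynomial (Fin m) ℂ) (v w : Fin m → ℂ) :
    polyDiff p v w = dif p v w := by
  simp [polyDiff, dif]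

theorem eval_lin_apply {n : ℕ} (φ : (Fin n → ℂ) →ₗ[ℂ] ℂ) (v : Fin n → ℂ) :
    eval v (lin fun l => φ (Pi.single l 1)) = φ v := by
  rw [eval_lin, LinearMap.pi_apply_eq_sum_univ φ v]
  refine Finset.sum_congr rfl fun l _ => ?_
  rw [smul_eq_mul, mul_comm]
  congr 2
  funext i
  simp [Pi.single_apply, eq_comm]

theorem eq_zero_of_apply_single {n : ℕ} {φ : (Fin n → ℂ) →ₗ[ℂ] ℂ}
    (h : (fun l => φ (Pi.single l 1)) = 0) : φ = 0 := by
  ext l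
  simpa using congrFun h l

namespace LocSystem
variable {n c : ℕ} {D : LocSystem n c} {z z' : Fin n → ℂ}

theorem finrank_tangent (hz : z ≠ 0) (hV : D.J ≤ mz z) :
    finrank ℂ (⨅ p ∈ D.pp z, LinearMap.ker (polyDiff p z) : Submodule ℂ (Fin n → ℂ)) + D.rk z =
      n := by
  let M : Matrix (Fin c) (Fin n) ℂ := Matrix.of fun s => grad z (D.f s)
  have h1 : (⨅ p ∈ D.pp z, LinearMap.ker (polyDiff p z) : Submodule ℂ (Fin n → ℂ)) =
      LinearMap.ker M.mulVecLin := by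
    ext w
    simp only [Submodule.mem_iInf, LinearMap.mem_ker, polyDiff_apply, Matrix.mulVecLin_apply]
    constructor
    · intro h
      funext s
      exact h _ (J_le_pp (J_le_iff.mp le_rfl s))
    · intro h p hp
      have h2 := grad_mem_of_mem_locIdeal (fun s => mem_mz.mp (J_le_iff.mp hV s)) hp
      obtain ⟨r, hr⟩ := (Submodule.mem_span_range_iff_exists_fun ℂ).mp h2
      change ∑ l, grad z p l * w l = 0
      rw [← hr]
      have h3 : ∀ s, ∑ l, grad z (D.f s) l * w l = 0 := fun s => congrFun h s
      simp only [Finset.sum_apply, Pi.smul_apply, smul_eq_mul, Finset.sum_mul, mul_assoc]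
      rw [Finset.sum_comm]
      simp [← Finset.mul_sum, h3]
  have h2 : finrank ℂ (LinearMap.range M.mulVecLin) = D.rk z := by
    change M.rank = _
    rw [Matrix.rank_eq_finrank_span_row]
    rfl
  rw [h1, ← h2, add_comm, LinearMap.finrank_range_add_finrank_ker]
  simp

theorem exists_variety (D : LocSystem n c) (hc : 3 ≤ c) (hn : n + 1 = 2 * c)
    (hrk : ∀ z, z ≠ 0 → D.J ≤ mz z → D.rk z < c) :
    ∃ d : ℕ, SmoothVariety {u : PS n | ∀ s, eval u.rep (D.f s) = 0} d ∧
      Nondegenerate {u : PS n | ∀ s, eval u.rep (D.f s) = 0} ∧ n ≤ 2 * d + 1 := by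
  obtain ⟨z, hz, hV⟩ := exists_ne_zero (D := D) (by omega)
  have hpp : ∀ z', z' ≠ 0 → D.J ≤ mz z' → D.pp z = D.pp z' := fun z' hz' hV' =>
    pp_eq_pp hz hV hz' hV' (by
      have := hrk z hz hV
      have := hrk z' hz' hV'
      omega)
  have hpr := pp_isPrime hz hV
  have hh := isHomog_pp hz hV
  have hex : ∃ w, w ≠ 0 ∧ D.pp z ≤ mz w := ⟨z, hz, pp_le_mz hV⟩
  have hr := hrk z hz hV
  have hW : {u : PS n | ∀ s, eval u.rep (D.f s) = 0} = pzl (D.pp z) := by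
    ext u
    constructor
    · intro h
      have h1 : D.J ≤ mz u.rep := J_le_iff.mpr fun s => mem_mz.mpr (h s)
      change D.pp z ≤ mz u.rep
      rw [hpp _ u.rep_nonzero h1]
      exact pp_le_mz h1
    · intro h s
      exact mem_mz.mp (h (J_le_pp (J_le_iff.mp le_rfl s)))
  rw [hW]
  refine ⟨n - 1 - D.rk z, ⟨pzl_closed hh, pzl_irreducible hpr hh hex, ⟨?_, ?_⟩, ?_⟩, ?_, by omega⟩
  · refine dimGE_pzl hh (fun ℓ => ?_) hpr
    exact exists_zero hz hV ℓ (by omega)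
  · exact not_dimGE hh (height_pp hz hV).ge (by omega)
  · intro x hx
    have h1 : D.J ≤ mz x.rep := J_le_pp.trans hx
    have h2 := finrank_tangent x.rep_nonzero h1
    have h3 : D.rk x.rep = D.rk z := rk_eq hz hV x.rep_nonzero hx
    have h4 : tangentSubmodule (pzl (D.pp z)) x =
        ⨅ p ∈ D.pp x.rep, LinearMap.ker (polyDiff p x.rep) := by
      rw [← hpp _ x.rep_nonzero h1]
      conv_rhs => rw [← coneIdeal_pzl hpr hh hex]
      rfl
    rw [h4]
    omega
  · intro φ hφ
    have h2 : lin (fun l => φ (Pi.single l 1)) ∈ coneIdeal (pzl (D.pp z)) := fun y hy v hv => by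
      rw [eval_lin_apply]; exact hφ y hy v hv
    rw [coneIdeal_pzl hpr hh hex] at h2
    exact eq_zero_of_apply_single (eq_zero_of_lin_mem (by omega) hz hV _ h2)

theorem eq_zero_of_rk_eq (hz : z ≠ 0) (hV : D.J ≤ mz z) (hr : D.rk z = c) (hz' : z' ≠ 0)
    (h : D.pp z ≤ mz z') {a : Fin c → ℂ} (ha : ∀ w, ∑ s, a s * D.β s z' w = 0) : a = 0 := by
  have h1 : D.rk z' = c := (rk_eq hz hV hz' h).trans hr
  have h2 : LinearIndependent ℂ fun s => grad z' (D.f s) := by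
    rw [linearIndependent_iff_card_eq_finrank_span, Fintype.card_fin]
    exact h1.symm
  funext s
  refine Fintype.linearIndependent_iff.mp h2 a ?_ s
  funext l
  have h3 := ha (Pi.single l 1)
  simpa [← sum_grad, Pi.single_apply] using h3

/-- If the differentials are independent somewhere, a linear form vanishing at all common zeros
near which this happens vanishes. -/
theorem linear_eq_zero (hcn : c + 1 < n) (hz : z ≠ 0) (hV : D.J ≤ mz z)
    (φ : (Fin n → ℂ) →ₗ[ℂ] ℂ) (h : ∀ z', z' ≠ 0 → D.pp z ≤ mz z' → φ z' = 0) : φ = 0 := by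
  refine eq_zero_of_apply_single (eq_zero_of_lin_mem hcn hz hV _ ?_)
  by_contra hcon
  obtain ⟨v, hv0, hv, hv'⟩ := exists_ne_zero_of_notMem (pp_isPrime hz hV)
    ⟨z, hz, pp_le_mz hV⟩ hcon
  exact hv' (by rw [eval_lin_apply]; exact h v hv0 hv)

end LocSystem

end

section

section quadForm
variable {n : ℕ}

/-- The quadratic polynomial of a bilinear form `β`, that is `β z z / 2`. -/
def quadForm (β : (Fin n → ℂ) →ₗ[ℂ] (Fin n → ℂ) →ₗ[ℂ] ℂ) : MvPolynomial (Fin n) ℂ :=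
  ∑ i, ∑ j, C (2⁻¹ * β (Pi.single i 1) (Pi.single j 1)) * (X i * X j)

variable (β : (Fin n → ℂ) →ₗ[ℂ] (Fin n → ℂ) →ₗ[ℂ] ℂ)

theorem bilin_eq_sum (z w : Fin n → ℂ) :
    β z w = ∑ i, ∑ j, β (Pi.single i 1) (Pi.single j 1) * (z i * w j) := by
  have h : ∀ (φ : (Fin n → ℂ) →ₗ[ℂ] ℂ) (v : Fin n → ℂ), φ v = ∑ i, φ (Pi.single i 1) * v i := by
    intro φ v
    rw [← eval_lin_apply φ v, eval_lin]
  rw [h (β z)]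
  simp only [fun j => h (β.flip (Pi.single j 1)) z, ← LinearMap.flip_apply (f := β) (m := z),
    Finset.sum_mul]
  rw [Finset.sum_comm]
  simp only [LinearMap.flip_apply]
  exact Finset.sum_congr rfl fun _ _ => Finset.sum_congr rfl fun _ _ => by ring

theorem quadForm_hom : (quadForm β).IsHomogeneous 2 := by
  refine IsHomogeneous.sum _ _ _ fun i _ => IsHomogeneous.sum _ _ _ fun j _ => ?_
  have h := (isHomogeneous_C (Fin n) (2⁻¹ * β (Pi.single i 1) (Pi.single j 1))).mul
    ((isHomogeneous_X ℂ i).mul (isHomogeneous_X ℂ j))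
  simpa using h

theorem eval_quadForm (z : Fin n → ℂ) : eval z (quadForm β) = 2⁻¹ * β z z := by
  rw [bilin_eq_sum β z z]
  simp [quadForm, Finset.mul_sum, mul_assoc]

theorem dif_quadForm (hβ : ∀ z w, β z w = β w z) (z w : Fin n → ℂ) :
    dif (quadForm β) z w = β z w := by
  have h1 : dif (quadForm β) z w = 2⁻¹ * (β z w + β w z) := by
    rw [bilin_eq_sum β z w, bilin_eq_sum β w z]
    simp only [quadForm, dif_sum, dif_mul, dif_C, dif_X, eval_C, eval_X, ← Finset.sum_add_distrib,
      Finset.mul_sum]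
    exact Finset.sum_congr rfl fun _ _ => Finset.sum_congr rfl fun _ _ => by ring
  rw [h1, hβ w z]
  ring

end quadForm

namespace QuadSystem
variable {m k c n : ℕ} (D : QuadSystem m k c)

/-- The restriction of the polar form to a parametrized subspace. -/
def pull (j : (Fin n → ℂ) →ₗ[ℂ] (Fin m → ℂ)) (a : Fin k → ℂ) :
    (Fin n → ℂ) →ₗ[ℂ] (Fin n → ℂ) →ₗ[ℂ] ℂ := (D.B a).compl₁₂ j j

theorem pull_apply (j : (Fin n → ℂ) →ₗ[ℂ] (Fin m → ℂ)) (a z w) :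
    D.pull j a z w = D.B a (j z) (j w) := rfl

/-- Membership in the tangent frame at a point. -/
structure Frame (I : Fin c → Fin k) (J : Fin c → Fin m) (g : MvPolynomial (Fin m) ℂ)
    (x : Fin m → ℂ) (j : (Fin n → ℂ) →ₗ[ℂ] (Fin m → ℂ)) : Prop where
  good : ∀ y ∈ D.cone, eval y g ≠ 0 → y ≠ 0 ∧ eval y (D.jac I J).det ≠ 0 ∧
      ∀ a, D.B a y = 0 → ∃ h : Fin c → MvPolynomial (Fin m) ℂ,
        g * D.q a = ∑ s, h s * D.qs (I s) ∧ ∀ s, eval y (h s) = 0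
  mem : x ∈ D.cone
  ne : eval x g ≠ 0
  free : ∀ v ∈ D.cone, (∀ a, D.B a x v = 0) → ∀ w, (∀ a, D.B a x w = 0) →
      ∃ u, ∀ a, D.B a v u = 0 ∧ D.B a w v + D.B a x u = 0
  tan : ∀ (z : Fin n → ℂ) a, D.B a x (j z) = 0
  indep : ∀ (z : Fin n → ℂ) (s t : ℂ), s • x + t • j z = 0 → t • z = 0 ∧ s = 0
  span : ∀ w, (∀ a, D.B a x w = 0) → ∃ (z : Fin n → ℂ) (t : ℂ), w = j z + t • x

namespace Frame
variable {D} {I : Fin c → Fin k} {J : Fin c → Fin m} {g : MvPolynomial (Fin m) ℂ}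
    {x : Fin m → ℂ} {j : (Fin n → ℂ) →ₗ[ℂ] (Fin m → ℂ)} (H : D.Frame I J g x j)
include H

theorem singular {a} (ha : D.B a x = 0) {w w'} (hw : ∀ b, D.B b x w = 0)
    (hw' : ∀ b, D.B b x w' = 0) : D.B a w w' = 0 := by
  obtain ⟨h, hh, h0⟩ := (H.good x H.mem H.ne).2.2 a ha
  exact D.polar_zero (T := D.tangent x) (fun w hw => singular_quadric_tangent H.mem H.ne ha h hh h0
    (mem_tangent.mp hw)) (mem_tangent.mpr hw) (mem_tangent.mpr hw')

theorem mem_cone_of {v} (hv : ∀ b, D.B b x v = 0)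
    (h : ∀ s, D.B (Pi.single (I s) 1) v v = 0) : v ∈ D.cone := by
  intro a
  obtain ⟨hx0, hdet, -⟩ := H.good x H.mem H.ne
  obtain ⟨r, hr⟩ := exists_coeff hx0 H.mem hdet (ψ := D.B a x) ⟨a, rfl⟩
  have h1 : D.B (a - ∑ s, r s • Pi.single (I s) 1) x = 0 := by
    simp only [map_sub, map_sum, map_smul, LinearMap.sub_apply, LinearMap.sum_apply,
      LinearMap.smul_apply, hr, sub_self]
  have h2 := H.singular h1 hv hv
  simp only [map_sub, map_sum, map_smul, LinearMap.sub_apply, LinearMap.sum_apply,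
      LinearMap.smul_apply, h, smul_zero, Finset.sum_const_zero, sub_zero] at h2
  exact h2

theorem line_cone {v} (hv : ∀ b, D.B b x v = 0) (hvc : v ∈ D.cone) (s t : ℂ) :
    s • x + t • v ∈ D.cone := by
  intro a
  simp [H.mem a, hvc a, hv a, D.symm a v x]

theorem local_equation {z : Fin n → ℂ} {t : ℂ} (ht : t ≠ 0) (hzc : j z ∈ D.cone)
    (hg : eval (x + t • j z) g ≠ 0) {a} (ha : D.B a (x + t • j z) = 0) :
    quadForm (D.pull j a) ∈ locIdeal z (mz z •
      Ideal.span (Set.range fun s => quadForm (D.pull j (Pi.single (I s) 1)))) := by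
  have hy : x + t • j z ∈ D.cone := by
    have := H.line_cone (H.tan z) hzc 1 t
    rwa [one_smul] at this
  obtain ⟨h, hh, h0⟩ := (H.good _ hy hg).2.2 a ha
  let θ : MvPolynomial (Fin m) ℂ →ₐ[ℂ] MvPolynomial (Fin n) ℂ :=
    aeval fun l => C (x l) + C t * lin fun i => j (Pi.single i 1) l
  have hθ : ∀ p w, eval w (θ p) = eval (x + t • j w) p := by
    intro p w
    change eval w (aeval _ p) = _
    rw [aeval_def, MvPolynomial.algebraMap_eq, ← coe_eval₂Hom, ← RingHom.comp_apply]
    congr 1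
    refine MvPolynomial.ringHom_ext (by simp) fun l => ?_
    have := eval_lin_apply ((LinearMap.proj l).comp j) w
    simp only [LinearMap.comp_apply, LinearMap.proj_apply] at this
    simp [this]
  have hq : ∀ b, θ (D.q b) = C (t ^ 2) * quadForm (D.pull j b) := by
    intro b
    refine MvPolynomial.funext fun w => ?_
    have h2 := D.two_eval b (x + t • j w)
    simp only [map_add, map_smul, LinearMap.add_apply, LinearMap.smul_apply, H.mem b, H.tan w b,
      D.symm b (j w) x, smul_eq_mul, mul_zero, zero_add, add_zero] at h2
    rw [hθ, map_mul, eval_C, eval_quadForm, pull_apply]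
    linear_combination (1/2) * h2
  refine ⟨θ g, by rwa [hθ], ?_⟩
  have h1 := congrArg θ hh
  simp only [qs, map_mul, map_sum, hq] at h1
  have h2 : θ g * quadForm (D.pull j a) =
      ∑ s, θ (h s) * quadForm (D.pull j (Pi.single (I s) 1)) := by
    have h3 : (C (t ^ 2) : MvPolynomial (Fin n) ℂ) ≠ 0 := by
      simpa using ht
    refine mul_left_cancel₀ h3 ?_
    rw [Finset.mul_sum]
    calc _ = θ g * (C (t ^ 2) * quadForm (D.pull j a)) := by ring
      _ = _ := by rw [h1]; exact Finset.sum_congr rfl fun _ _ => by ring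
  rw [h2]
  refine sum_mem fun s _ => ?_
  rw [← smul_eq_mul]
  exact Submodule.smul_mem_smul (mem_mz.mpr (by rw [hθ]; exact h0 s)) (Ideal.subset_span ⟨s, rfl⟩)

theorem finite_bad (v : Fin m → ℂ) : Set.Finite {t : ℂ | eval (x + t • v) g = 0} := by
  let φ : Polynomial ℂ := aeval (fun l => Polynomial.C (x l) + Polynomial.C (v l) * Polynomial.X) g
  have hφ : ∀ t, φ.eval t = eval (x + t • v) g := by
    intro t
    change Polynomial.evalRingHom t (aeval _ g) = _
    rw [aeval_def, ← coe_eval₂Hom, ← RingHom.comp_apply]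
    congr 1
    refine MvPolynomial.ringHom_ext (by simp) fun l => ?_
    simp only [coe_eval₂Hom, RingHom.comp_apply, eval₂_X, Polynomial.coe_evalRingHom,
      Polynomial.eval_mul, Polynomial.eval_C, Polynomial.eval_X, eval_X, Pi.smul_apply,
      smul_eq_mul, Polynomial.eval_add, Pi.add_apply]
    ring
  have h0 : φ ≠ 0 := by
    intro h
    refine H.ne ?_
    have := hφ 0
    rw [h] at this
    simpa using this.symm
  refine (φ.roots.toFinset.finite_toSet).subset fun t ht => ?_
  simp only [Finset.mem_coe, Multiset.mem_toFinset]
  exact (Polynomial.mem_roots h0).mpr (by rw [Polynomial.IsRoot, hφ]; exact ht)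

theorem loc {z : Fin n → ℂ} (hz : z ≠ 0) (hzc : j z ∈ D.cone) {a : Fin k → ℂ}
    (ha : ∀ w, D.B a (j z) (j w) = 0) :
    quadForm (D.pull j a) ∈ locIdeal z (mz z •
      Ideal.span (Set.range fun s => quadForm (D.pull j (Pi.single (I s) 1)))) := by
  let K := locIdeal z (mz z •
    Ideal.span (Set.range fun s => quadForm (D.pull j (Pi.single (I s) 1))))
  let PP : Submodule ℂ (Fin k → ℂ) :=
    { carrier := {a | quadForm (D.pull j a) ∈ K}
      add_mem' := fun {a b} ha hb => by
        have : quadForm (D.pull j (a + b)) = quadForm (D.pull j a) + quadForm (D.pull j b) :=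
          MvPolynomial.funext fun w => by
            simp only [map_add, eval_quadForm, pull_apply, LinearMap.add_apply]; ring
        change quadForm (D.pull j (a + b)) ∈ K
        rw [this]
        exact add_mem ha hb
      zero_mem' := by
        have : quadForm (D.pull j 0) = 0 := MvPolynomial.funext fun w => by
            simp only [map_zero, eval_quadForm, pull_apply, LinearMap.zero_apply, mul_zero]
        change quadForm (D.pull j 0) ∈ K
        rw [this]
        exact zero_mem _
      smul_mem' := fun t a ha => by
        have : quadForm (D.pull j (t • a)) = C t * quadForm (D.pull j a) :=
          MvPolynomial.funext fun w => by
            simp only [map_mul, map_smul, eval_C, eval_quadForm, pull_apply, LinearMap.smul_apply,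
              smul_eq_mul]
            ring
        change quadForm (D.pull j (t • a)) ∈ K
        rw [this]
        exact Ideal.mul_mem_left _ _ ha }
  refine pencil (D.B.flip x) (D.B.flip (j z)) (k - c) ?_ ?_ ?_ PP
    ({0} ∪ {t : ℂ | eval (x + t • j z) g = 0}) ((Set.finite_singleton 0).union (H.finite_bad _))
    ?_ ?_
  · intro s t hst
    have h1 : s • D.B.flip x + t • D.B.flip (j z) = D.B.flip (s • x + t • j z) := by simp
    have h2 : s • x + t • j z ≠ 0 := by
      intro h
      obtain ⟨h3, h4⟩ := H.indep z s t h
      rcases hst with h5 | h5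
      · exact h5 h4
      · exact (smul_ne_zero h5 hz) h3
    have h3 := D.rank _ h2 (H.line_cone (H.tan z) hzc s t)
    have h4 := LinearMap.finrank_range_add_finrank_ker (D.B.flip (s • x + t • j z))
    rw [h1]
    simp only [finrank_fintype_fun_eq_card, Fintype.card_fin] at h4
    omega
  · intro b hb
    exact D.mem_range_flip _ fun w hw => H.singular hb (H.tan z) hw
  · rintro b ⟨b', hb'⟩
    refine D.mem_range_flip _ fun w hw => ?_
    obtain ⟨u, hu⟩ := H.free _ hzc (H.tan z) w hw
    have h1 := LinearMap.congr_fun hb' u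
    simp only [LinearMap.flip_apply] at h1 ⊢
    rw [D.symm]
    have h2 := (hu b).2
    rw [← h1, (hu b').1, add_zero] at h2
    exact h2
  · intro t ht
    simp only [Set.mem_union, Set.mem_singleton_iff, not_or] at ht
    intro b hb
    exact H.local_equation ht.1 hzc ht.2 (by simpa using hb)
  · refine D.mem_range_flip _ fun w hw => ?_
    obtain ⟨z', t, rfl⟩ := H.span w hw
    rw [LinearMap.flip_apply, map_add, ha, map_smul, D.symm, H.tan, smul_zero, add_zero]

/-- The system of quadrics defining the lines through a general point. -/
def locSystem : LocSystem n c where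
  f s := quadForm (D.pull j (Pi.single (I s) 1))
  β s := D.pull j (Pi.single (I s) 1)
  hom s := quadForm_hom _
  symm s z w := D.symm _ _ _
  two_eval s z := by rw [eval_quadForm]; ring
  dif_eq s z w := dif_quadForm (D.pull j (Pi.single (I s) 1)) (fun z w => D.symm _ _ _) z w
  loc z hz hV a ha := by
    have hzc : j z ∈ D.cone := H.mem_cone_of (H.tan z) fun s => by
      have := hV s
      rw [eval_quadForm, pull_apply] at this
      simpa using this
    have h1 : ∀ w w', D.B (∑ s, a s • Pi.single (I s) 1) w w' =
        ∑ s, a s * D.B (Pi.single (I s) 1) w w' := by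
      intro w w'
      simp only [map_sum, map_smul, LinearMap.sum_apply, LinearMap.smul_apply, smul_eq_mul]
    obtain ⟨g', hg', hmem⟩ := H.loc hz hzc (a := ∑ s, a s • Pi.single (I s) 1) (fun w => by
      rw [h1]; exact ha w)
    obtain ⟨h, hh, he⟩ := (Submodule.mem_ideal_smul_span_iff_exists_sum _ _ _).mp hmem
    refine ⟨g', h, hg', fun s => mem_mz.mp (hh s), ?_⟩
    have h2 : ∑ s, C (a s) * quadForm (D.pull j (Pi.single (I s) 1)) =
        quadForm (D.pull j (∑ s, a s • Pi.single (I s) 1)) :=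
      MvPolynomial.funext fun w => by
        rw [eval_quadForm, pull_apply, h1, map_sum, Finset.mul_sum]
        simp only [map_mul, eval_C, eval_quadForm, pull_apply]
        exact Finset.sum_congr rfl fun _ _ => by ring
    rw [h2, ← he, Finsupp.sum_fintype _ _ (by simp)]
    simp

end Frame
end QuadSystem

end

section

namespace QuadSystem.Frame
variable {m k c n : ℕ} {D : QuadSystem m k c} {I : Fin c → Fin k} {J : Fin c → Fin m}
    {g : MvPolynomial (Fin m) ℂ} {x : Fin m → ℂ} {j : (Fin n → ℂ) →ₗ[ℂ] (Fin m → ℂ)}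
    (H : D.Frame I J g x j)
include H

theorem mem_cone_iff {z : Fin n → ℂ} : j z ∈ D.cone ↔ ∀ s, eval z (H.locSystem.f s) = 0 := by
  have h : ∀ s, eval z (H.locSystem.f s) = 2⁻¹ * D.B (Pi.single (I s) 1) (j z) (j z) := fun s =>
    eval_quadForm _ z
  constructor
  · intro hz s
    rw [h, hz, mul_zero]
  · intro hz
    refine H.mem_cone_of (H.tan z) fun s => ?_
    have := hz s
    rw [h] at this
    simpa using this

theorem apply_ne_zero {z : Fin n → ℂ} (hz : z ≠ 0) : j z ≠ 0 := fun h => hz (by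
  have := (H.indep z 0 1 (by simp [h])).1
  simpa using this)

theorem rank_lt (hc : 3 ≤ c) (hn : n + 1 = 2 * c)
    (hmove : ∃ a, D.B a x = 0 ∧ ∃ w, (∀ b, D.B b x w = 0) ∧ D.B a w ≠ 0) (z : Fin n → ℂ)
    (hz : z ≠ 0) (hV : H.locSystem.J ≤ mz z) : H.locSystem.rk z < c := by
  by_contra hlt
  have hle : H.locSystem.rk z ≤ c := by
    have := finrank_range_le_card (R := ℂ) fun s => grad z (H.locSystem.f s)
    rwa [Fintype.card_fin] at this
  have hr : H.locSystem.rk z = c := by omega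
  obtain ⟨a, ha, w, hw, haw⟩ := hmove
  obtain ⟨hx0, hdet, -⟩ := H.good x H.mem H.ne
  have key : ∀ z', z' ≠ 0 → H.locSystem.pp z ≤ mz z' → D.B a (j z') = 0 := by
    intro z' hz' hle
    have hc' : j z' ∈ D.cone := H.mem_cone_iff.mpr fun s =>
      mem_mz.mp (hle (LocSystem.J_le_pp (LocSystem.J_le_iff.mp le_rfl s)))
    have h1 : LinearMap.ker (D.B.flip (j z')) ≤ LinearMap.ker (D.B.flip x) := by
      intro b hb
      have hb' : D.B b (j z') = 0 := hb
      obtain ⟨r, hrr⟩ := QuadSystem.exists_coeff hx0 H.mem hdet (ψ := D.B b x) ⟨b, rfl⟩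
      have h2 : D.B (b - ∑ s, r s • Pi.single (I s) 1) x = 0 := by
        simp only [map_sub, map_sum, map_smul, LinearMap.sub_apply, LinearMap.sum_apply,
          LinearMap.smul_apply, hrr, sub_self]
      have h3 : r = 0 := by
        refine LocSystem.eq_zero_of_rk_eq hz hV hr hz' hle fun w => ?_
        have h4 := H.singular h2 (H.tan z') (H.tan w)
        rw [map_sub, LinearMap.sub_apply, hb', zero_sub, LinearMap.neg_apply, neg_eq_zero, map_sum,
          LinearMap.sum_apply, LinearMap.sum_apply] at h4
        simp only [map_smul, LinearMap.smul_apply, smul_eq_mul] at h4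
        exact h4
      rw [h3] at hrr
      change D.B b x = 0
      rw [← hrr]
      simp
    have h5 : LinearMap.ker (D.B.flip (j z')) = LinearMap.ker (D.B.flip x) := by
      refine Submodule.eq_of_le_of_finrank_eq h1 ?_
      have h6 := LinearMap.finrank_range_add_finrank_ker (D.B.flip (j z'))
      have h7 := LinearMap.finrank_range_add_finrank_ker (D.B.flip x)
      rw [D.rank _ (H.apply_ne_zero hz') hc'] at h6
      rw [D.rank _ hx0 H.mem] at h7
      omega
    have h8 : a ∈ LinearMap.ker (D.B.flip x) := ha
    rw [← h5] at h8
    exact h8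
  refine haw ?_
  obtain ⟨z₁, t, rfl⟩ := H.span w hw
  rw [map_add, map_smul, ha, smul_zero, add_zero]
  refine LinearMap.ext fun w' => ?_
  have h9 := LocSystem.linear_eq_zero (by omega) hz hV (((D.B a).flip w').comp j)
    fun z' hz' hle => by
      change D.B a (j z') w' = 0
      rw [key z' hz' hle, LinearMap.zero_apply]
  exact LinearMap.congr_fun h9 z₁

end QuadSystem.Frame

end

section

theorem pderiv_comm {σ : Type} (l l' : σ) (p : MvPolynomial σ ℂ) :
    pderiv l (pderiv l' p) = pderiv l' (pderiv l p) := by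
  have h : ⁅pderiv (R := ℂ) l, pderiv (R := ℂ) l'⁆ = 0 := by
    classical
    refine MvPolynomial.derivation_ext fun i => ?_
    rw [Derivation.commutator_apply, pderiv_X, pderiv_X]
    simp [Pi.single_apply, apply_ite]
  have := DFunLike.congr_fun h p
  rwa [Derivation.commutator_apply, Derivation.zero_apply, sub_eq_zero] at this

variable {m : ℕ}

theorem eval_of_isHomogeneous_one {r : MvPolynomial (Fin m) ℂ} (hr : r.IsHomogeneous 1)
    (x : Fin m → ℂ) : eval x r = ∑ l, eval 0 (pderiv l r) * x l := by
  have h := congrArg (eval x) hr.sum_X_mul_pderiv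
  rw [one_smul, map_sum] at h
  rw [← h]
  refine Finset.sum_congr rfl fun l _ => ?_
  have h0 := eval_smul_of_isHomogeneous (hr.pderiv (i := l)) 0 x
  rw [zero_smul, Nat.sub_self, pow_zero, one_mul] at h0
  rw [h0, map_mul, eval_X, mul_comm]

/-- The second differential of a polynomial at the origin. -/
def hess (p : MvPolynomial (Fin m) ℂ) : (Fin m → ℂ) →ₗ[ℂ] (Fin m → ℂ) →ₗ[ℂ] ℂ :=
  LinearMap.mk₂ ℂ (fun x w => ∑ l, (∑ l', eval 0 (pderiv l' (pderiv l p)) * x l') * w l)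
    (fun x y w => by
      simp only [Pi.add_apply, mul_add, add_mul, Finset.sum_add_distrib])
    (fun t x w => by
      simp only [Pi.smul_apply, smul_eq_mul, Finset.mul_sum, Finset.sum_mul]
      exact Finset.sum_congr rfl fun l _ => Finset.sum_congr rfl fun l' _ => by ring)
    (fun x y w => by
      simp only [Pi.add_apply, mul_add, Finset.sum_add_distrib])
    (fun t x w => by
      simp only [Pi.smul_apply, smul_eq_mul, Finset.mul_sum, Finset.sum_mul]
      exact Finset.sum_congr rfl fun l _ => Finset.sum_congr rfl fun l' _ => by ring)

theorem hess_apply (p : MvPolynomial (Fin m) ℂ) (x w : Fin m → ℂ) :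
    hess p x w = ∑ l, (∑ l', eval 0 (pderiv l' (pderiv l p)) * x l') * w l := rfl

theorem hess_symm (p : MvPolynomial (Fin m) ℂ) (x w : Fin m → ℂ) : hess p x w = hess p w x := by
  simp only [hess_apply, Finset.sum_mul]
  rw [Finset.sum_comm]
  refine Finset.sum_congr rfl fun l _ => Finset.sum_congr rfl fun l' _ => ?_
  rw [pderiv_comm]
  ring

theorem dif_eq_hess {p : MvPolynomial (Fin m) ℂ} (hp : p.IsHomogeneous 2) (x w : Fin m → ℂ) :
    dif p x w = hess p x w :=
  Finset.sum_congr rfl fun l _ => by rw [eval_of_isHomogeneous_one (hp.pderiv (i := l))]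

theorem two_mul_eval {p : MvPolynomial (Fin m) ℂ} (hp : p.IsHomogeneous 2) (x : Fin m → ℂ) :
    2 * eval x p = hess p x x := by
  have h := congrArg (eval x) hp.sum_X_mul_pderiv
  rw [map_sum, map_nsmul, nsmul_eq_mul, Nat.cast_ofNat] at h
  rw [← h, ← dif_eq_hess hp]
  exact Finset.sum_congr rfl fun l _ => by rw [map_mul, eval_X, mul_comm]

/-- Rescaling the variables of a polynomial. -/
theorem eval_aeval_smul (t : ℂ) (p : MvPolynomial (Fin m) ℂ) (y : Fin m → ℂ) :
    eval y (aeval (fun l => C t * X l : Fin m → MvPolynomial (Fin m) ℂ) p) = eval (t • y) p := by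
  rw [aeval_def, MvPolynomial.algebraMap_eq, ← coe_eval₂Hom, ← RingHom.comp_apply]
  congr 1
  exact MvPolynomial.ringHom_ext (by simp) fun l => by simp

theorem dif_aeval_smul (t : ℂ) (p : MvPolynomial (Fin m) ℂ) (y w : Fin m → ℂ) :
    dif (aeval (fun l => C t * X l : Fin m → MvPolynomial (Fin m) ℂ) p) y w =
      t * dif p (t • y) w := by
  classical
  unfold dif
  rw [Finset.mul_sum]
  refine Finset.sum_congr rfl fun l _ => ?_
  rw [derivation_aeval, map_sum, Finset.sum_eq_single l]
  · rw [pderiv_C_mul, pderiv_X_self, smul_eq_mul, map_mul, eval_aeval_smul]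
    simp only [mul_one, eval_C]
    ring
  · intro l' _ hl
    rw [pderiv_C_mul, pderiv_X_of_ne hl]
    simp
  · intro h
    exact absurd (Finset.mem_univ l) h

theorem submodule_eq_span {x : PS m} {v : Fin m → ℂ} (hv : v ≠ 0) (hx : v ∈ x.submodule) :
    x.submodule = Submodule.span ℂ {v} := by
  have hle : Submodule.span ℂ {v} ≤ x.submodule := by simpa using hx
  refine (Submodule.eq_of_le_of_finrank_eq hle ?_).symm
  rw [finrank_span_singleton hv, x.finrank_submodule]

theorem mem_submodule_mk {v : Fin m → ℂ} (hv : v ≠ 0) :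
    v ∈ (Projectivization.mk ℂ v hv).submodule := by
  rw [Projectivization.submodule_mk]
  exact Submodule.mem_span_singleton_self _

section System

variable {k : ℕ} {X : Set (PS m)} {Q : Fin k → MvPolynomial (Fin m) ℂ}

/-- The polar forms of the quadrics in a linear system. -/
def polar (Q : Fin k → MvPolynomial (Fin m) ℂ) :
    (Fin k → ℂ) →ₗ[ℂ] (Fin m → ℂ) →ₗ[ℂ] (Fin m → ℂ) →ₗ[ℂ] ℂ :=
  Fintype.linearCombination ℂ fun i => hess (Q i)

theorem polar_apply (a x w) : polar Q a x w = ∑ i, a i * hess (Q i) x w := by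
  simp [polar, Fintype.linearCombination_apply]

theorem forall_polar_eq_zero {x w : Fin m → ℂ} :
    (∀ a, polar Q a x w = 0) ↔ ∀ i, hess (Q i) x w = 0 := by
  classical
  refine ⟨fun h i => ?_, fun h a => ?_⟩
  · have := h (Pi.single i 1)
    rw [polar_apply, Finset.sum_eq_single i (fun b _ hb => by simp [hb]) (by simp)] at this
    simpa using this
  · rw [polar_apply]
    exact Finset.sum_eq_zero fun i _ => by rw [h, mul_zero]

variable (hQ : ∀ i, (Q i).IsHomogeneous 2)
include hQ

theorem mem_iff_polar (hX : X = {x | ∀ i, PVanish (Q i) x}) {x : PS m} {v : Fin m → ℂ} (hv : v ≠ 0)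
    (hx : v ∈ x.submodule) : x ∈ X ↔ ∀ a, polar Q a v v = 0 := by
  rw [forall_polar_eq_zero, hX]
  constructor
  · intro h i
    rw [← two_mul_eval (hQ i), h i v hx, mul_zero]
  · intro h i y hy
    rw [submodule_eq_span hv hx] at hy
    obtain ⟨t, rfl⟩ := Submodule.mem_span_singleton.mp hy
    have := two_mul_eval (hQ i) v
    rw [h i] at this
    rw [eval_smul_of_isHomogeneous (hQ i)]
    have h2 : eval v (Q i) = 0 := by simpa using this
    rw [h2, mul_zero]

theorem polyDiff_quadric (i) (x w : Fin m → ℂ) : polyDiff (Q i) x w = hess (Q i) x w := by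
  rw [polyDiff_apply, dif_eq_hess (hQ i)]

theorem mem_tangentSubmodule_iff (hX : SchemeCutOutBy X Q) {x : PS m} (hx : x ∈ X) {v : Fin m → ℂ}
    (hv : v ≠ 0) (hvx : v ∈ x.submodule) {w : Fin m → ℂ} :
    w ∈ tangentSubmodule X x ↔ ∀ a, polar Q a v w = 0 := by
  have hrep := rep_mem_submodule x
  rw [submodule_eq_span hv hvx] at hrep
  obtain ⟨t, ht⟩ := Submodule.mem_span_singleton.mp hrep
  have ht0 : t ≠ 0 := by
    rintro rfl
    exact x.rep_nonzero (by rw [← ht, zero_smul])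
  have hpt : ∀ i, polyDiff (Q i) x.rep w = t * hess (Q i) v w := fun i => by
    rw [polyDiff_quadric hQ, ← ht, map_smul, LinearMap.smul_apply, smul_eq_mul]
  rw [forall_polar_eq_zero]
  constructor
  · intro h i
    simp only [tangentSubmodule, Submodule.mem_iInf, LinearMap.mem_ker] at h
    have := h (Q i) fun y hy => by
      rw [hX.1] at hy
      exact hy i
    rw [hpt] at this
    exact (mul_eq_zero.mp this).resolve_left ht0
  · intro h
    simp only [tangentSubmodule, Submodule.mem_iInf]
    refine fun p hp => hX.2 x hx p hp ?_
    simp only [Submodule.mem_iInf, LinearMap.mem_ker]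
    exact fun i => by rw [hpt, h, mul_zero]

theorem mk_mem_iff (hX : X = {x | ∀ i, PVanish (Q i) x}) {v : Fin m → ℂ} (hv : v ≠ 0) :
    Projectivization.mk ℂ v hv ∈ X ↔ ∀ a, polar Q a v v = 0 :=
  mem_iff_polar hQ hX hv (mem_submodule_mk hv)

theorem polar_eq_zero_of_mem (hX : X = {x | ∀ i, PVanish (Q i) x}) {x : PS m} (hx : x ∈ X)
    {v : Fin m → ℂ} (hvx : v ∈ x.submodule) (a) : polar Q a v v = 0 := by
  rcases eq_or_ne v 0 with rfl | hv
  · rw [map_zero]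
  · exact (mem_iff_polar hQ hX hv hvx).mp hx a

theorem mem_coneIdeal_iff (hX : X = {x | ∀ i, PVanish (Q i) x}) (hne : X.Nonempty)
    {p : MvPolynomial (Fin m) ℂ} :
    p ∈ coneIdeal X ↔ ∀ v, (∀ a, polar Q a v v = 0) → eval v p = 0 := by
  constructor
  · intro hp v hv
    rcases eq_or_ne v 0 with rfl | hv0
    · obtain ⟨x, hx⟩ := hne
      exact hp x hx 0 (zero_mem _)
    · exact hp _ ((mk_mem_iff hQ hX hv0).mpr hv) v (mem_submodule_mk hv0)
  · intro h x hx v hvx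
    exact h v (polar_eq_zero_of_mem hQ hX hx hvx)

/-- The system of quadrics attached to a smooth quadratic variety. -/
def quadSystem {n c : ℕ} (hm : m = n + c + 1) (hX : SchemeCutOutBy X Q) (hsm : SmoothVariety X n)
    (hnd : Nondegenerate X) : QuadSystem m k c where
  q := Fintype.linearCombination ℂ Q
  B := polar Q
  symm a x y := by
    rw [polar_apply, polar_apply]
    exact Finset.sum_congr rfl fun i _ => by rw [hess_symm]
  two_eval a x := by
    rw [polar_apply, Fintype.linearCombination_apply, map_sum, Finset.mul_sum]
    refine Finset.sum_congr rfl fun i _ => ?_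
    rw [smul_eval, ← two_mul_eval (hQ i)]
    ring
  deriv_eval a x w := by
    change dif _ x w = _
    rw [polar_apply, Fintype.linearCombination_apply, dif_sum]
    refine Finset.sum_congr rfl fun i _ => ?_
    rw [smul_eq_C_mul, dif_mul, dif_C, eval_C, mul_zero, add_zero, dif_eq_hess (hQ i)]
  P := coneIdeal X
  prime := coneIdeal_isPrime hsm.2.1
  mem_P p := mem_coneIdeal_iff hQ hX.1 hsm.2.1.1
  rank x hx hxc := by
    have hmem := (mk_mem_iff hQ hX.1 hx).mpr hxc
    have h1 := Subspace.finrank_add_finrank_dualCoannihilator_eq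
      (LinearMap.range ((polar Q).flip x))
    have h2 : (LinearMap.range ((polar Q).flip x)).dualCoannihilator =
        tangentSubmodule X (Projectivization.mk ℂ x hx) := by
      ext w
      rw [mem_tangentSubmodule_iff hQ hX hmem hx (mem_submodule_mk hx),
        Submodule.mem_dualCoannihilator]
      simp
    rw [h2, hsm.2.2.2 _ hmem, finrank_fin_fun] at h1
    exact Nat.add_right_cancel (h1.trans (by omega))
  reg p hp x hx hxc w hw := by
    have hmem := (mk_mem_iff hQ hX.1 hx).mpr hxc
    obtain ⟨t, ht⟩ := Projectivization.exists_smul_eq_mk_rep ℂ x hx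
    rw [← mem_tangentSubmodule_iff hQ hX hmem hx (mem_submodule_mk hx)] at hw
    simp only [tangentSubmodule, Submodule.mem_iInf, LinearMap.mem_ker] at hw
    have h1 := hw (aeval (fun l => C (t : ℂ)⁻¹ * MvPolynomial.X l : Fin m → MvPolynomial (Fin m) ℂ) p)
      fun y hy v hv => by
        rw [eval_aeval_smul]
        exact hp y hy _ (Submodule.smul_mem _ _ hv)
    rw [polyDiff_apply, dif_aeval_smul, ← ht, Units.smul_def, inv_smul_smul₀ t.ne_zero] at h1
    exact (mul_eq_zero.mp h1).resolve_left (inv_ne_zero t.ne_zero)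
  exists_ne := by
    obtain ⟨x, hx⟩ := hsm.2.1.1
    exact ⟨x.rep, x.rep_nonzero, polar_eq_zero_of_mem hQ hX.1 hx (rep_mem_submodule x)⟩
  nondeg φ hφ := hnd φ fun x hx v hvx => hφ v (polar_eq_zero_of_mem hQ hX.1 hx hvx)

end System

end

section

theorem linearCombination_single {m k : ℕ} (Q : Fin k → MvPolynomial (Fin m) ℂ) (i : Fin k) :
    Fintype.linearCombination ℂ Q (Pi.single i 1) = Q i := by
  rw [Fintype.linearCombination_apply_single, one_smul]

theorem polyDiff_sum {m c : ℕ} (F : Fin c → MvPolynomial (Fin m) ℂ) (r : Fin c → ℂ)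
    (x w : Fin m → ℂ) : polyDiff (∑ s, r s • F s) x w = ∑ s, r s * polyDiff (F s) x w := by
  simp only [polyDiff_apply]
  rw [dif_sum]
  refine Finset.sum_congr rfl fun s _ => ?_
  rw [smul_eq_C_mul, dif_mul, dif_C, eval_C, mul_zero, add_zero]

theorem SchemeCutOutBy.of_span {m k c : ℕ} {X : Set (PS m)} {Q : Fin k → MvPolynomial (Fin m) ℂ}
    (hX : SchemeCutOutBy X Q) {F : Fin c → MvPolynomial (Fin m) ℂ} (I : Fin c → Fin k)
    (hF : ∀ s, F s = Q (I s)) (h : ∀ i, ∃ r : Fin c → ℂ, Q i = ∑ s, r s • F s) :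
    SchemeCutOutBy X F := by
  constructor
  · ext x
    constructor
    · intro hx s
      rw [hX.1] at hx
      rw [hF]
      exact hx _
    · intro hx
      rw [hX.1]
      intro i v hv
      obtain ⟨r, hr⟩ := h i
      rw [hr, map_sum]
      exact Finset.sum_eq_zero fun s _ => by rw [smul_eval, hx s v hv, mul_zero]
  · intro x hx p hp w hw
    refine hX.2 x hx p hp ?_
    simp only [Submodule.mem_iInf, LinearMap.mem_ker] at hw ⊢
    intro i
    obtain ⟨r, hr⟩ := h i
    rw [hr, polyDiff_sum]
    exact Finset.sum_eq_zero fun s _ => by rw [hw, mul_zero]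

theorem exists_complement {m n : ℕ} {T : Submodule ℂ (Fin m → ℂ)} {x : Fin m → ℂ} (hx : x ≠ 0)
    (hxT : x ∈ T) (hT : finrank ℂ T = n + 1) :
    ∃ j : (Fin n → ℂ) →ₗ[ℂ] (Fin m → ℂ), Function.Injective j ∧
      LinearMap.range j ⊓ Submodule.span ℂ {x} = ⊥ ∧
      LinearMap.range j ⊔ Submodule.span ℂ {x} = T := by
  obtain ⟨S, hS⟩ := Submodule.exists_isCompl (Submodule.span ℂ {x})
  have hle : Submodule.span ℂ {x} ≤ T := by simpa using hxT
  have hinf : S ⊓ T ⊓ Submodule.span ℂ {x} = ⊥ :=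
    le_bot_iff.mp (hS.inf_eq_bot ▸ le_inf inf_le_right (inf_le_left.trans inf_le_left))
  have hsup : S ⊓ T ⊔ Submodule.span ℂ {x} = T := by
    rw [sup_comm, ← sup_inf_assoc_of_le S hle, hS.sup_eq_top, top_inf_eq]
  have hfin := Submodule.finrank_sup_add_finrank_inf_eq (S ⊓ T) (Submodule.span ℂ {x})
  rw [hinf, hsup, hT, finrank_bot, finrank_span_singleton hx] at hfin
  let e : (Fin n → ℂ) ≃ₗ[ℂ] (S ⊓ T : Submodule ℂ (Fin m → ℂ)) :=
    LinearEquiv.ofFinrankEq _ _ (by rw [finrank_fin_fun]; omega)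
  have hr : LinearMap.range ((S ⊓ T).subtype ∘ₗ e.toLinearMap) = S ⊓ T := by
    rw [LinearEquiv.range_comp, Submodule.range_subtype]
  refine ⟨(S ⊓ T).subtype ∘ₗ e.toLinearMap, ?_, ?_, ?_⟩
  · exact (Submodule.injective_subtype _).comp e.injective
  · rw [hr, hinf]
  · rw [hr, hsup]

theorem QuadSystem.exists_frame {m k c n : ℕ} (D : QuadSystem m k c) :
    (∃ I : Fin c → Fin k, ∀ a, ∃ r : Fin c → ℂ, D.q a = ∑ s, r s • D.qs (I s)) ∨
    ∃ (G g : MvPolynomial (Fin m) ℂ) (I : Fin c → Fin k) (J : Fin c → Fin m), G ∉ D.P ∧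
      ∀ x ∈ D.cone, eval x G ≠ 0 → x ≠ 0 ∧
        (∃ a, D.B a x = 0 ∧ ∃ w, (∀ b, D.B b x w = 0) ∧ D.B a w ≠ 0) ∧
        ∀ j : (Fin n → ℂ) →ₗ[ℂ] (Fin m → ℂ), Function.Injective j →
          LinearMap.range j ⊓ Submodule.span ℂ {x} = ⊥ →
          (∀ w, w ∈ LinearMap.range j ⊔ Submodule.span ℂ {x} ↔ ∀ a, D.B a x w = 0) →
          D.Frame I J g x j := by
  refine D.exists_moving.imp_right ?_
  rintro ⟨f₁, hf₁, hmove⟩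
  obtain ⟨f₂, hf₂, hfree⟩ := exists_free D
  obtain ⟨I, J, hIJ⟩ := D.exists_chart
  replace hIJ : (D.jac I J).det ∉ D.P := hIJ
  obtain ⟨g, hg, -, hgood⟩ := exists_good_equations hIJ
  refine ⟨g * f₁ * f₂, g, I, J, ?_, fun x hx hG => ?_⟩
  · intro h
    rcases D.prime.mem_or_mem h with h | h
    · exact (D.prime.mem_or_mem h).elim hg hf₁
    · exact hf₂ h
  rw [map_mul, map_mul] at hG
  have hgx := left_ne_zero_of_mul (left_ne_zero_of_mul hG)
  refine ⟨(hgood x hx hgx).1, hmove x hx (right_ne_zero_of_mul (left_ne_zero_of_mul hG)), fun j hj hinf hsup => ?_⟩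
  refine ⟨hgood, hx, hgx, hfree x hx (right_ne_zero_of_mul hG), fun z => ?_, fun z s t h => ?_,
    fun w hw => ?_⟩
  · exact (hsup _).mp (Submodule.mem_sup_left ⟨z, rfl⟩)
  · have h1 : j (t • z) ∈ LinearMap.range j ⊓ Submodule.span ℂ {x} := by
      refine ⟨⟨_, rfl⟩, Submodule.mem_span_singleton.mpr ⟨-s, ?_⟩⟩
      rw [map_smul, neg_smul]
      exact neg_eq_of_add_eq_zero_right h
    rw [hinf, Submodule.mem_bot] at h1
    refine ⟨hj (by rw [h1, map_zero]), ?_⟩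
    rw [← map_smul, h1, add_zero] at h
    exact (smul_eq_zero.mp h).resolve_right (hgood x hx hgx).1
  · obtain ⟨_, ⟨z, rfl⟩, y, hy, rfl⟩ := Submodule.mem_sup.mp ((hsup w).mpr hw)
    obtain ⟨t, rfl⟩ := Submodule.mem_span_singleton.mp hy
    exact ⟨z, t, rfl⟩

/-- The polar directions of lines through a point of a quadratic variety. -/
theorem lineThrough_subset_iff {m k : ℕ} {X : Set (PS m)} {Q : Fin k → MvPolynomial (Fin m) ℂ}
    (hQ : ∀ i, (Q i).IsHomogeneous 2) (hX : X = {x | ∀ i, PVanish (Q i) x}) {x : PS m}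
    (hxX : x ∈ X) {v : Fin m → ℂ} (hv : v ≠ 0) (hvx : v ∈ x.submodule) {w : Fin m → ℂ} (hw : w ≠ 0)
    (hT : ∀ a, polar Q a v w = 0) :
    LineThrough x w ⊆ X ↔ ∀ a, polar Q a w w = 0 := by
  constructor
  · intro h
    rw [← mk_mem_iff hQ hX hw]
    refine h ?_
    change (Projectivization.mk ℂ w hw).submodule ≤ _
    rw [Projectivization.submodule_mk]
    exact le_sup_right
  · intro h y hy
    have hmem := hy (rep_mem_submodule y)
    rw [submodule_eq_span hv hvx] at hmem
    obtain ⟨_, hs, _, ht, hst⟩ := Submodule.mem_sup.mp hmem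
    obtain ⟨s, rfl⟩ := Submodule.mem_span_singleton.mp hs
    obtain ⟨t, rfl⟩ := Submodule.mem_span_singleton.mp ht
    rw [mem_iff_polar hQ hX y.rep_nonzero (rep_mem_submodule y), ← hst]
    intro a
    have hsymm : polar Q a w v = 0 := by
      have := hT a
      rw [polar_apply] at this ⊢
      rw [← this]
      exact Finset.sum_congr rfl fun i _ => by rw [hess_symm]
    simp only [map_add, map_smul, LinearMap.add_apply, LinearMap.smul_apply, hT a, hsymm, h a,
      polar_eq_zero_of_mem hQ hX hxX hvx a, smul_zero, add_zero]

end

end QuadVar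

/-- **Lemma 4.3.** For a quadratic, non-complete-intersection `X` with
`n = 2c - 1`, `c ≥ 3`, one has `2 dim L_x ≥ n - 1` for a general point `x`;
in particular `L_x ⊆ ℙ^{n-1}` is smooth, irreducible and nondegenerate. -/
theorem vmrt_dim_ge (n c : ℕ) (hc : 3 ≤ c) (hn : n + 1 = 2 * c)
    (X : Set (PS (n + c + 1)))
    (hsm : SmoothVariety X n) (hnd : Nondegenerate X) (hq : IsQuadratic X)
    (hci : ¬ IsCompleteIntersection X n) :
    GenericallyOn X (fun x => ∃ W : Set (PS n), IsVMRTModel X x W ∧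
      ∃ d : ℕ, SmoothVariety W d ∧ Nondegenerate W ∧ n ≤ 2 * d + 1) := by
  open QuadVar in
  obtain ⟨k, Q, hQ, -, hX⟩ := hq
  let D : QuadSystem (n + c + 1) k c := quadSystem hQ rfl hX hsm hnd
  have hqs : ∀ i, D.qs i = Q i := fun i => linearCombination_single Q i
  rcases D.exists_frame (n := n) with ⟨I, hI⟩ | ⟨G, g, I, J, hG, H⟩
  · have hcc : n + c + 1 - 1 - n = c := by omega
    refine absurd ⟨fun i => Q (I (Fin.cast hcc i)), fun _ => 2, fun i => hQ _, fun _ => one_le_two,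
      SchemeCutOutBy.of_span hX (fun i => I (Fin.cast hcc i)) (fun _ => rfl) fun i => ?_⟩ hci
    obtain ⟨r, hr⟩ := hI (Pi.single i 1)
    refine ⟨fun s => r (Fin.cast hcc s), ?_⟩
    have h1 : Q i = ∑ s, r s • Q (I s) := by
      rw [← hqs i]
      exact hr.trans (Finset.sum_congr rfl fun s _ => by rw [hqs])
    rw [h1]
    exact (Fintype.sum_equiv (finCongr hcc) _ _ fun s => rfl).symm
  · refine ⟨ZeroLocus {G}, ⟨_, rfl⟩, fun hsub => hG fun y hy => hsub hy G rfl, ?_⟩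
    rintro x ⟨hxX, hxG⟩
    obtain ⟨v, hvx, hvG⟩ : ∃ v ∈ x.submodule, MvPolynomial.eval v G ≠ 0 := by
      by_contra hcon
      push Not at hcon
      exact hxG fun p hp => by
        rw [Set.mem_singleton_iff.mp hp]
        exact hcon
    have hvc : v ∈ D.cone := polar_eq_zero_of_mem hQ hX.1 hxX hvx
    obtain ⟨hv, hmove, hframe⟩ := H v hvc hvG
    have htan : ∀ w, w ∈ tangentSubmodule X x ↔ ∀ a, D.B a v w = 0 := fun w =>
      mem_tangentSubmodule_iff hQ hX hxX hv hvx
    obtain ⟨j, hj, hinf, hsup⟩ := exists_complement hv ((htan v).mpr hvc) (hsm.2.2.2 x hxX)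
    have hF := hframe j hj hinf fun w => by rw [hsup, htan]
    have hW : {u : PS n | LineThrough x (j u.rep) ⊆ X} =
        {u : PS n | ∀ s, MvPolynomial.eval u.rep (hF.locSystem.f s) = 0} := by
      ext u
      exact (lineThrough_subset_iff hQ hX.1 hxX hv hvx (hF.apply_ne_zero u.rep_nonzero)
        (hF.tan u.rep)).trans hF.mem_cone_iff
    refine ⟨_, ⟨j, hj, ?_, ?_, rfl⟩, ?_⟩
    · rw [submodule_eq_span hv hvx, hinf]
    · rw [submodule_eq_span hv hvx, hsup]
    · rw [hW]
      exact hF.locSystem.exists_variety hc hn (hF.rank_lt hc hn hmove)
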